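/- Assume hypothesis (****) with d = 2, and that both K and L have supporting circles at all of their boundary points (for S² of radii less than π/2); for S² assume additionally that K and L are C¹. Then the following are equivalent. (1) For each φ, ψ, the set conv((φK) ∪ (ψL)) is axially symmetric. (2) The same as (1) with 'is axially symmetric' replaced by 'admits some non-trivial congruence'. (3) Whenever φ, ψ and x ∈ bd K, y ∈ bd L satisfy hypotheses (A) and (B) of condition (3) of Theorem 7, conv((φK) ∪ (ψL)) is axially symmetric. (4) The same as (3) with 'is axially symmetric' replaced by 'admits some non-trivial congruence'. (5) Whenever φ, ψ, x, y satisfy (A) and (B) of condition (3) of Theorem 7, there exists ε(K,L,x,y,φ,ψ) > 0 (for S² with D(ε) ⊂ S) such that for all 0 < ε < ε(K,L,x,y,φ,ψ), the set conv((φK) ∪ (ψL)) ∩ D(ε) is axially symmetric, where D := [φx, ψy]. (6) The same as (5) with 'is axially symmetric' replaced by 'admits some non-trivial congruence'. (7) K and L are (in general incongruent) circles (for S² of radii less than π/2). -/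

import Mathlib

open Metric Set Filter

namespace BallChar

/-- `X` is (isometric to) the `d`-dimensional round sphere of radius 1,
with the intrinsic (great-circle) metric. -/
def IsSphereSpace (X : Type*) [MetricSpace X] (d : ℕ) : Prop :=
  ∃ e : X → EuclideanSpace ℝ (Fin (d + 1)),
    Function.Injective e ∧
    Set.range e = Metric.sphere (0 : EuclideanSpace ℝ (Fin (d + 1))) 1 ∧
    ∀ x y : X, dist x y = Real.arccos (@inner ℝ _ _ (e x) (e y))

/-- `X` is (isometric to) the `d`-dimensional Euclidean space. -/
def IsEuclideanSpaceForm (X : Type*) [MetricSpace X] (d : ℕ) : Prop :=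
  Nonempty (X ≃ᵢ EuclideanSpace ℝ (Fin d))

/-- The Minkowski bilinear form on `ℝ^d × ℝ`. -/
noncomputable def mink (d : ℕ) (u v : EuclideanSpace ℝ (Fin d) × ℝ) : ℝ :=
  @inner ℝ _ _ u.1 v.1 - u.2 * v.2

/-- `X` is (isometric to) the `d`-dimensional hyperbolic space of curvature `-1`
(the hyperboloid model). -/
def IsHyperbolicSpace (X : Type*) [MetricSpace X] (d : ℕ) : Prop :=
  ∃ e : X → EuclideanSpace ℝ (Fin d) × ℝ,
    Function.Injective e ∧
    Set.range e = {u | mink d u u = -1 ∧ 0 < u.2} ∧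
    ∀ x y : X, Real.cosh (dist x y) = - mink d (e x) (e y)

/-- `X` is `S^d`, `ℝ^d` or `H^d`. -/
def IsSpaceForm (X : Type*) [MetricSpace X] (d : ℕ) : Prop :=
  IsSphereSpace X d ∨ IsEuclideanSpaceForm X d ∨ IsHyperbolicSpace X d

variable {X : Type*} [MetricSpace X]

/-- Metric betweenness: `z` lies on a shortest geodesic from `x` to `y`. -/
def Btw (x z y : X) : Prop := dist x z + dist z y = dist x y

/-- `z` is the unique point between `x` and `y` at its distance from `x`. -/
def UniqueBtwPt (x z y : X) : Prop :=
  Btw x z y ∧ ∀ w, Btw x w y → dist x w = dist x z → w = z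

/-- Geodesic convexity (for two antipodal points of a sphere no condition is imposed). -/
def GConvex (K : Set X) : Prop :=
  ∀ x ∈ K, ∀ y ∈ K, ∀ z, UniqueBtwPt x z y → z ∈ K

/-- `p` is a (metric) midpoint of `x` and `y`. -/
def IsMidpoint (p x y : X) : Prop := Btw x p y ∧ dist x p = dist p y

/-- A reflection in a hyperplane: a non-trivial involutive isometry whose
non-fixed locus is disconnected (by the mirror hyperplane). -/
def IsReflection (σ : X ≃ᵢ X) : Prop :=
  σ.trans σ = IsometryEquiv.refl X ∧ σ ≠ IsometryEquiv.refl X ∧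
    ¬ IsPreconnected {x : X | σ x ≠ x}

/-- An orientation preserving congruence: a product of an even number of reflections. -/
def OrientationPreserving (f : X ≃ᵢ X) : Prop :=
  ∃ l : List (X ≃ᵢ X), (∀ σ ∈ l, IsReflection σ) ∧ Even l.length ∧
    f = l.foldr IsometryEquiv.trans (IsometryEquiv.refl X)

/-- Two subsets are congruent if some isometry of the space maps one onto the other. -/
def Congruent (A B : Set X) : Prop := ∃ f : X ≃ᵢ X, ⇑f '' A = B

/-- `S` admits some non-trivial congruence. -/
def AdmitsNontrivialCongruence (S : Set X) : Prop :=
  ∃ f : X ≃ᵢ X, f ≠ IsometryEquiv.refl X ∧ ⇑f '' S = S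

/-- `S` is axially symmetric (symmetric with respect to some reflection). -/
def AxiallySymmetric (S : Set X) : Prop :=
  ∃ σ : X ≃ᵢ X, IsReflection σ ∧ ⇑σ '' S = S

/-- `S` is centrally symmetric: some involutive isometry fixing a point `p`
maps `S` onto itself, `p` being a midpoint of every pair `x`, `σ x` of `S`. -/
def CentrallySymmetric (S : Set X) : Prop :=
  ∃ (σ : X ≃ᵢ X) (p : X), Function.Involutive ⇑σ ∧ σ p = p ∧ ⇑σ '' S = S ∧
    ∀ x ∈ S, IsMidpoint p x (σ x)

/-- `S` is symmetric with respect to the orthogonal bisector hyperplane of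
the segment `[a, b]`, i.e. invariant under the reflection interchanging `a` and `b`. -/
def SymmetricWrtPerpBisector (S : Set X) (a b : X) : Prop :=
  ∃ σ : X ≃ᵢ X, IsReflection σ ∧ σ a = b ∧ ⇑σ '' S = S

/-- A closed half-space: one of the two closed sides of the mirror of a reflection. -/
def IsHalfspace (P : Set X) : Prop :=
  ∃ σ : X ≃ᵢ X, IsReflection σ ∧ IsClosed P ∧
    P ∪ ⇑σ '' P = univ ∧ P ∩ ⇑σ '' P = {x | σ x = x}

/-- A hyperplane: the mirror (fixed point set) of a reflection. -/
def IsHyperplane (B : Set X) : Prop :=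
  ∃ σ : X ≃ᵢ X, IsReflection σ ∧ B = {x | σ x = x}

/-- A paraball (horoball): a sublevel set of a Busemann function. -/
def IsParaball (K : Set X) : Prop :=
  ∃ γ : ℝ → X, Isometry γ ∧
    K = {x | ∃ b ≤ 0, Tendsto (fun t => dist x (γ t) - t) atTop (nhds b)}

/-- A parasphere (horosphere): the boundary of a paraball. -/
def IsParasphere (C : Set X) : Prop := ∃ K : Set X, IsParaball K ∧ C = frontier K

/-- A hypersphere at distance `lam > 0` from its base hyperplane
(degeneration to a hyperplane excluded). -/
def IsHypersphere (C : Set X) (lam : ℝ) : Prop :=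
  0 < lam ∧ (∃ P : Set X, IsHalfspace P ∧ C = frontier {x | infDist x P ≤ lam}) ∧
    ¬ IsHyperplane C

/-- The family of connected components of the boundary of `K`. -/
def bdryComponents (K : Set X) : Set (Set X) :=
  (connectedComponentIn (frontier K)) '' (frontier K)

/-- `closedBall p r` is an inball of `M` (a ball of maximal radius contained in `M`). -/
def IsInball (M : Set X) (p : X) (r : ℝ) : Prop :=
  0 ≤ r ∧ closedBall p r ⊆ M ∧ ∀ (q : X) (s : ℝ), closedBall q s ⊆ M → s ≤ r

/-- `closedBall p r` is the unique inball of `M`. -/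
def HasUniqueInball (M : Set X) (p : X) (r : ℝ) : Prop :=
  IsInball M p r ∧ ∀ (q : X) (s : ℝ), IsInball M q s → q = p

/-- The (geodesic) convex hull of a set. -/
def gconvexHull (Y : Set X) : Set X := ⋂₀ {C : Set X | GConvex C ∧ Y ⊆ C}

/-- `z` lies on the complete geodesic line through `a` and `b`. -/
def OnLine (a b z : X) : Prop := Btw a z b ∨ Btw z a b ∨ Btw a b z

/-- The closed `(d-1)`-ball of radius `ε` centred at `a` in the hyperplane through `a`
orthogonal to the segment `[a, b]`. -/
def perpDisc (a b : X) (ε : ℝ) : Set X :=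
  {x | (∀ z, OnLine a b z → dist x a ≤ dist x z) ∧ dist x a ≤ ε}

/-- The set `D(ε)` associated to the segment `D = [a, b]`: the convex hull of the two
`(d-1)`-balls of radius `ε` orthogonal to `D` at its endpoints. -/
def segCyl (a b : X) (ε : ℝ) : Set X :=
  gconvexHull (perpDisc a b ε ∪ perpDisc b a ε)

/-- `[a, b]` is the unique diametral segment of `M`. -/
def UniqueDiametral (M : Set X) (a b : X) : Prop :=
  a ∈ M ∧ b ∈ M ∧ a ≠ b ∧ dist a b = diam M ∧
    ∀ a' ∈ M, ∀ b' ∈ M, dist a' b' = diam M → (a' = a ∧ b' = b) ∨ (a' = b ∧ b' = a)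

/-- Condition (**): at every boundary point, `K` contains a ball having this point
on its boundary. -/
def CondBallInside (K : Set X) : Prop :=
  ∀ x ∈ frontier K, ∃ ε > 0, ∃ p : X, closedBall p ε ⊆ K ∧ x ∈ sphere p ε

/-- `K` has an extreme point. -/
def HasExtremePoint (K : Set X) : Prop :=
  ∃ x ∈ K, ∀ y ∈ K, ∀ z ∈ K, Btw y x z → x = y ∨ x = z

/-- Condition (***): near every boundary point, `K` is contained in a ball
(resp. in a convex set bounded by a hypersphere, for hyperbolic space) whose boundary
has sectional curvatures bounded below and passes through the given point. -/
def CondCurvBound (d : ℕ) (K : Set X) : Prop :=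
  ∀ x ∈ frontier K, ∃ ε > 0, ∃ B : Set X,
    {y | y ∈ K ∧ dist y x ≤ ε} ⊆ B ∧ x ∈ frontier B ∧
    (IsSphereSpace X d → ∃ (q : X) (R : ℝ), 0 < R ∧ R < Real.pi / 2 ∧
        ε ≤ Real.cos R / Real.sin R ∧ B = closedBall q R) ∧
    (IsEuclideanSpaceForm X d → ∃ (q : X) (R : ℝ), 0 < R ∧ ε ≤ 1 / R ∧ B = closedBall q R) ∧
    (IsHyperbolicSpace X d → ∃ (P : Set X) (lam : ℝ), IsHalfspace P ∧ 0 < lam ∧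
        ε ≤ Real.tanh lam ∧ B = {y | infDist y P ≤ lam})

/-- `K` has a supporting sphere at each of its boundary points
(for the sphere, of radius less than `π/2`). -/
def SupportingSpheres (d : ℕ) (K : Set X) : Prop :=
  ∀ x ∈ frontier K, ∃ (p : X) (R : ℝ), 0 < R ∧ K ⊆ closedBall p R ∧ x ∈ sphere p R ∧
    (IsSphereSpace X d → R < Real.pi / 2)

/-- `K` is `C¹` (smooth): at each boundary point there is a unique supporting half-space. -/
def SmoothBody (K : Set X) : Prop :=
  ∀ x ∈ frontier K, ∃! P : Set X, IsHalfspace P ∧ K ⊆ P ∧ x ∈ frontier P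

/-- A complete geodesic (straight line). -/
def IsGeodesicLine (B : Set X) : Prop := ∃ γ : ℝ → X, Isometry γ ∧ B = Set.range γ

/-- A circle (closed disc) of positive radius. -/
def IsDisc (K : Set X) : Prop := ∃ (p : X) (r : ℝ), 0 < r ∧ K = closedBall p r

/-- The parallel domain of `B` at distance `l`. -/
def parallelDomain (B : Set X) (l : ℝ) : Set X := {x | infDist x B ≤ l}

/-- `K` is the parallel domain of some straight line, at some distance `l > 0`. -/
def IsParallelDomain (K : Set X) : Prop :=
  ∃ (B : Set X) (l : ℝ), IsGeodesicLine B ∧ 0 < l ∧ K = parallelDomain B l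

/-- A convex domain bounded by a (proper) hypercycle. -/
def IsHypercycleDomain (K : Set X) : Prop :=
  ∃ (P : Set X) (l : ℝ), IsHalfspace P ∧ 0 < l ∧ K = {x | infDist x P ≤ l}

/-- `C` is a hypercycle or a straight line (a curve at constant distance `l ≥ 0`
from its base line). -/
def IsHypercycleOrLine (C : Set X) : Prop :=
  ∃ (P : Set X) (l : ℝ), IsHalfspace P ∧ 0 ≤ l ∧ C = frontier {x | infDist x P ≤ l}

/-- `C` is a hypercycle (or straight line) with base line `B`. -/
def HypercycleWithBase (C B : Set X) : Prop :=
  ∃ (P : Set X) (l : ℝ), IsHalfspace P ∧ 0 ≤ l ∧ frontier P = B ∧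
    C = frontier {x | infDist x P ≤ l}


/-! Cases (A)-(E) of Theorem 5 (hyperbolic plane). -/

/-- One of the basic bodies of case (A). -/
def CaseABody (K : Set X) : Prop :=
  IsDisc K ∨ IsParaball K ∨ IsHypercycleDomain K ∨ IsHalfspace K

/-- Case (A) of Theorem 5. -/
def CaseA (K L : Set X) : Prop :=
  CaseABody K ∧ CaseABody L ∧
    ((IsHypercycleDomain K ∨ IsHalfspace K) → IsDisc L ∨ Congruent K L) ∧
    ((IsHypercycleDomain L ∨ IsHalfspace L) → IsDisc K ∨ Congruent L K)

/-- `M` is bounded either by two hypercycles whose base lines coincide, or by a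
hypercycle and its base line. -/
def TwoHypSameBase (M : Set X) : Prop :=
  ∃ (B C₁ C₂ : Set X), IsGeodesicLine B ∧ C₁ ≠ C₂ ∧
    HypercycleWithBase C₁ B ∧ HypercycleWithBase C₂ B ∧ frontier M = C₁ ∪ C₂

/-- Case (B) of Theorem 5. -/
def CaseB (K L : Set X) : Prop :=
  (IsDisc K ∧ TwoHypSameBase L) ∨ (IsDisc L ∧ TwoHypSameBase K)

/-- `M` is bounded by at least two hypercycles or straight lines, with all base lines
different, whose mutual distances are at least `2r`. -/
def MultiHypFarApart (M : Set X) (r : ℝ) : Prop :=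
  (∀ x ∈ frontier M, IsHypercycleOrLine (connectedComponentIn (frontier M) x)) ∧
  (∃ x ∈ frontier M, ∃ y ∈ frontier M,
      connectedComponentIn (frontier M) x ≠ connectedComponentIn (frontier M) y) ∧
  (∀ x ∈ frontier M, ∀ y ∈ frontier M,
      connectedComponentIn (frontier M) x ≠ connectedComponentIn (frontier M) y →
        2 * r ≤ dist x y ∧
        ∀ B₁ B₂ : Set X, HypercycleWithBase (connectedComponentIn (frontier M) x) B₁ →
          HypercycleWithBase (connectedComponentIn (frontier M) y) B₂ → B₁ ≠ B₂)

/-- Case (C) of Theorem 5. -/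
def CaseC (K L : Set X) : Prop :=
  (∃ (p : X) (r : ℝ), 0 < r ∧ K = closedBall p r ∧ MultiHypFarApart L r) ∨
  (∃ (p : X) (r : ℝ), 0 < r ∧ L = closedBall p r ∧ MultiHypFarApart K r)

/-- Case (D) of Theorem 5. -/
def CaseD (K L : Set X) : Prop :=
  (IsParaball K ∧ IsParallelDomain L) ∨ (IsParaball L ∧ IsParallelDomain K)

/-- Case (E) of Theorem 5. -/
def CaseE (K L : Set X) : Prop :=
  Congruent K L ∧ IsParallelDomain K ∧ IsParallelDomain L

/-- All cases of (3) of Theorem 5 together. -/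
def Theorem5Cases (K L : Set X) : Prop :=
  CaseA K L ∨ CaseB K L ∨ CaseC K L ∨ CaseD K L ∨ CaseE K L

/-- Condition (1) of Theorem 5: every intersection of congruent copies admits some
non-trivial congruence. -/
def T5Cond1 (K L : Set X) : Prop :=
  ∀ φ ψ : X ≃ᵢ X, OrientationPreserving φ → OrientationPreserving ψ →
    (interior ((⇑φ '' K) ∩ (⇑ψ '' L))).Nonempty →
    AdmitsNontrivialCongruence ((⇑φ '' K) ∩ (⇑ψ '' L))

/-- Condition (2) of Theorem 5: every intersection of congruent copies is axially
symmetric. -/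
def T5Cond2 (K L : Set X) : Prop :=
  ∀ φ ψ : X ≃ᵢ X, OrientationPreserving φ → OrientationPreserving ψ →
    (interior ((⇑φ '' K) ∩ (⇑ψ '' L))).Nonempty →
    AxiallySymmetric ((⇑φ '' K) ∩ (⇑ψ '' L))

/-- All connected components of the boundary of `K` are hypercycles or straight lines. -/
def BdryHypOrLine (K : Set X) : Prop :=
  ∀ x ∈ frontier K, IsHypercycleOrLine (connectedComponentIn (frontier K) x)

/-- The boundary of `K` has at least two connected components. -/
def AtLeastTwoComponents (K : Set X) : Prop :=
  ∃ x ∈ frontier K, ∃ y ∈ frontier K,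
    connectedComponentIn (frontier K) x ≠ connectedComponentIn (frontier K) y

/-- The boundary of `K` is nonempty and has a single connected component. -/
def SingleComponent (K : Set X) : Prop :=
  (frontier K).Nonempty ∧ ∀ x ∈ frontier K, ∀ y ∈ frontier K,
    connectedComponentIn (frontier K) x = connectedComponentIn (frontier K) y

/-- The associated graph of `K` contains two edges with at least one common endpoint:
`K` has two distinct boundary components which are asymptotic (come arbitrarily close). -/
def TwoAsymptoticComponents (K : Set X) : Prop :=
  ∃ x ∈ frontier K, ∃ y ∈ frontier K,
    connectedComponentIn (frontier K) x ≠ connectedComponentIn (frontier K) y ∧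
    ∀ δ > (0 : ℝ), ∃ p ∈ connectedComponentIn (frontier K) x,
      ∃ q ∈ connectedComponentIn (frontier K) y, dist p q < δ

/-- The associated graph of `K` has only pairwise vertex-disjoint edges: distinct
boundary components of `K` stay at positive distance from each other. -/
def VertexDisjointEdges (K : Set X) : Prop :=
  ∀ x ∈ frontier K, ∀ y ∈ frontier K,
    connectedComponentIn (frontier K) x ≠ connectedComponentIn (frontier K) y →
      ∃ δ > (0 : ℝ), ∀ p ∈ connectedComponentIn (frontier K) x,
        ∀ q ∈ connectedComponentIn (frontier K) y, δ ≤ dist p q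

/-! Conditions of Theorem 6. -/

/-- Condition (1) of Theorem 6. -/
def T6Cond1 (K L : Set X) : Prop :=
  ∃ ε > (0 : ℝ), ∀ φ ψ : X ≃ᵢ X, OrientationPreserving φ → OrientationPreserving ψ →
    (interior ((⇑φ '' K) ∩ (⇑ψ '' L))).Nonempty →
    diam ((⇑φ '' K) ∩ (⇑ψ '' L)) < ε →
    CentrallySymmetric ((⇑φ '' K) ∩ (⇑ψ '' L))

/-- Condition (2) of Theorem 6. -/
def T6Cond2 (K L : Set X) : Prop :=
  ∀ x ∈ frontier K, ∀ y ∈ frontier L, ∃ ε > (0 : ℝ),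
    ∀ φ ψ : X ≃ᵢ X, OrientationPreserving φ → OrientationPreserving ψ →
      (interior ((⇑φ '' K) ∩ (⇑ψ '' L))).Nonempty →
      diam ((⇑φ '' K) ∩ (⇑ψ '' L)) < ε →
      ∀ (p : X) (r : ℝ), HasUniqueInball ((⇑φ '' K) ∩ (⇑ψ '' L)) p r →
        frontier ((⇑φ '' K) ∩ (⇑ψ '' L)) ∩ sphere p r = {φ x, ψ y} →
        φ x ∈ interior (⇑ψ '' L) → ψ y ∈ interior (⇑φ '' K) →
        IsMidpoint p (φ x) (ψ y) →
        CentrallySymmetric ((⇑φ '' K) ∩ (⇑ψ '' L))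

/-- Condition (3) of Theorem 6. -/
def T6Cond3 (K L : Set X) : Prop :=
  ∀ x ∈ frontier K, ∀ y ∈ frontier L, ∃ ε > (0 : ℝ),
    ∀ φ ψ : X ≃ᵢ X, OrientationPreserving φ → OrientationPreserving ψ →
      (interior ((⇑φ '' K) ∩ (⇑ψ '' L))).Nonempty →
      diam ((⇑φ '' K) ∩ (⇑ψ '' L)) < ε →
      ∀ (p : X) (r : ℝ), HasUniqueInball ((⇑φ '' K) ∩ (⇑ψ '' L)) p r →
        frontier ((⇑φ '' K) ∩ (⇑ψ '' L)) ∩ sphere p r = {φ x, ψ y} →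
        φ x ∈ interior (⇑ψ '' L) → ψ y ∈ interior (⇑φ '' K) →
        IsMidpoint p (φ x) (ψ y) →
        SymmetricWrtPerpBisector ((⇑φ '' K) ∩ (⇑ψ '' L)) (φ x) (ψ y)

/-- Condition (4) of Theorem 6. -/
def T6Cond4 (d : ℕ) (K L : Set X) : Prop :=
  (∃ r > (0 : ℝ), (IsSphereSpace X d → r ≤ Real.pi / 2) ∧
      (∀ C ∈ bdryComponents K ∪ bdryComponents L, ∃ p : X, C = sphere p r) ∧
      (∃ p : X, K = closedBall p r) ∧ ∃ q : X, L = closedBall q r) ∨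
  ((∀ C ∈ bdryComponents K ∪ bdryComponents L, IsParasphere C) ∧
      IsParaball K ∧ IsParaball L) ∨
  (∃ lam > (0 : ℝ), ∀ C ∈ bdryComponents K ∪ bdryComponents L, IsHypersphere C lam)

/-! Conditions of Theorems 7 and 8. -/

/-- The pair `φ, ψ` is admissible for hypothesis (****): both are orientation
preserving, and for the sphere `(φ K) ∪ (ψ L)` lies in an open hemisphere. -/
def GoodPair (d : ℕ) (K L : Set X) (φ ψ : X ≃ᵢ X) : Prop :=
  OrientationPreserving φ ∧ OrientationPreserving ψ ∧
    (IsSphereSpace X d → ∃ s : X, (⇑φ '' K) ∪ (⇑ψ '' L) ⊆ ball s (Real.pi / 2))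

/-- The convex hull of the union of the two congruent copies. -/
def hullUnion (K L : Set X) (φ ψ : X ≃ᵢ X) : Set X := gconvexHull ((⇑φ '' K) ∪ (⇑ψ '' L))

/-- Condition (A) of (3) of Theorem 7: the diameter of `M` is sufficiently close to `π`
(sphere), resp. sufficiently large (Euclidean, hyperbolic), as measured by `δ`. -/
def BigDiam (d : ℕ) (X : Type*) [MetricSpace X] (M : Set X) (δ : ℝ) : Prop :=
  (IsSphereSpace X d → Real.pi - δ < diam M) ∧ (¬ IsSphereSpace X d → 1 / δ < diam M)

/-- Condition (1) of Theorem 7. -/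
def T7Cond1 (d : ℕ) (K L : Set X) : Prop :=
  ∀ φ ψ : X ≃ᵢ X, GoodPair d K L φ ψ → CentrallySymmetric (hullUnion K L φ ψ)

/-- Condition (2) of Theorem 7. -/
def T7Cond2 (d : ℕ) (K L : Set X) : Prop :=
  ∀ φ ψ : X ≃ᵢ X, GoodPair d K L φ ψ → ∀ a b : X, UniqueDiametral (hullUnion K L φ ψ) a b →
    SymmetricWrtPerpBisector (hullUnion K L φ ψ) a b

/-- Condition (3) of Theorem 7. -/
def T7Cond3 (d : ℕ) (K L : Set X) : Prop :=
  ∃ δ > (0 : ℝ), ∀ φ ψ : X ≃ᵢ X, GoodPair d K L φ ψ →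
    ∀ x ∈ frontier K, ∀ y ∈ frontier L,
      BigDiam d X (hullUnion K L φ ψ) δ →
      UniqueDiametral (hullUnion K L φ ψ) (φ x) (ψ y) →
      CentrallySymmetric (hullUnion K L φ ψ)

/-- Condition (4) of Theorem 7. -/
def T7Cond4 (d : ℕ) (K L : Set X) : Prop :=
  ∃ δ > (0 : ℝ), ∀ φ ψ : X ≃ᵢ X, GoodPair d K L φ ψ →
    ∀ x ∈ frontier K, ∀ y ∈ frontier L,
      BigDiam d X (hullUnion K L φ ψ) δ →
      UniqueDiametral (hullUnion K L φ ψ) (φ x) (ψ y) →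
      SymmetricWrtPerpBisector (hullUnion K L φ ψ) (φ x) (ψ y)

/-- Condition (5) of Theorem 7. -/
def T7Cond5 (d : ℕ) (K L : Set X) : Prop :=
  ∃ δ > (0 : ℝ), ∀ φ ψ : X ≃ᵢ X, GoodPair d K L φ ψ →
    ∀ x ∈ frontier K, ∀ y ∈ frontier L,
      BigDiam d X (hullUnion K L φ ψ) δ →
      UniqueDiametral (hullUnion K L φ ψ) (φ x) (ψ y) →
      ∃ ε₀ > (0 : ℝ), ∀ ε : ℝ, 0 < ε → ε < ε₀ →
        (IsSphereSpace X d → ∃ s : X, (⇑φ '' K) ∪ (⇑ψ '' L) ⊆ ball s (Real.pi / 2) ∧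
            segCyl (φ x) (ψ y) ε ⊆ ball s (Real.pi / 2)) ∧
        CentrallySymmetric (hullUnion K L φ ψ ∩ segCyl (φ x) (ψ y) ε)

/-- Condition (6) of Theorem 7. -/
def T7Cond6 (d : ℕ) (K L : Set X) : Prop :=
  ∃ δ > (0 : ℝ), ∀ φ ψ : X ≃ᵢ X, GoodPair d K L φ ψ →
    ∀ x ∈ frontier K, ∀ y ∈ frontier L,
      BigDiam d X (hullUnion K L φ ψ) δ →
      UniqueDiametral (hullUnion K L φ ψ) (φ x) (ψ y) →
      ∃ ε₀ > (0 : ℝ), ∀ ε : ℝ, 0 < ε → ε < ε₀ →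
        (IsSphereSpace X d → ∃ s : X, (⇑φ '' K) ∪ (⇑ψ '' L) ⊆ ball s (Real.pi / 2) ∧
            segCyl (φ x) (ψ y) ε ⊆ ball s (Real.pi / 2)) ∧
        SymmetricWrtPerpBisector (hullUnion K L φ ψ ∩ segCyl (φ x) (ψ y) ε) (φ x) (ψ y)

/-- Condition (7) of Theorem 7: `K` and `L` are congruent balls. -/
def T7Cond7 (d : ℕ) (K L : Set X) : Prop :=
  ∃ r > (0 : ℝ), (IsSphereSpace X d → r < Real.pi / 2) ∧
    (∃ p : X, K = closedBall p r) ∧ ∃ q : X, L = closedBall q r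

/-- Condition (1) of Theorem 8. -/
def T8Cond1 (K L : Set X) : Prop :=
  ∀ φ ψ : X ≃ᵢ X, GoodPair 2 K L φ ψ → AxiallySymmetric (hullUnion K L φ ψ)

/-- Condition (2) of Theorem 8. -/
def T8Cond2 (K L : Set X) : Prop :=
  ∀ φ ψ : X ≃ᵢ X, GoodPair 2 K L φ ψ → AdmitsNontrivialCongruence (hullUnion K L φ ψ)

/-- Condition (3) of Theorem 8. -/
def T8Cond3 (K L : Set X) : Prop :=
  ∃ δ > (0 : ℝ), ∀ φ ψ : X ≃ᵢ X, GoodPair 2 K L φ ψ →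
    ∀ x ∈ frontier K, ∀ y ∈ frontier L,
      BigDiam 2 X (hullUnion K L φ ψ) δ →
      UniqueDiametral (hullUnion K L φ ψ) (φ x) (ψ y) →
      AxiallySymmetric (hullUnion K L φ ψ)

/-- Condition (4) of Theorem 8. -/
def T8Cond4 (K L : Set X) : Prop :=
  ∃ δ > (0 : ℝ), ∀ φ ψ : X ≃ᵢ X, GoodPair 2 K L φ ψ →
    ∀ x ∈ frontier K, ∀ y ∈ frontier L,
      BigDiam 2 X (hullUnion K L φ ψ) δ →
      UniqueDiametral (hullUnion K L φ ψ) (φ x) (ψ y) →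
      AdmitsNontrivialCongruence (hullUnion K L φ ψ)

/-- Condition (5) of Theorem 8. -/
def T8Cond5 (K L : Set X) : Prop :=
  ∃ δ > (0 : ℝ), ∀ φ ψ : X ≃ᵢ X, GoodPair 2 K L φ ψ →
    ∀ x ∈ frontier K, ∀ y ∈ frontier L,
      BigDiam 2 X (hullUnion K L φ ψ) δ →
      UniqueDiametral (hullUnion K L φ ψ) (φ x) (ψ y) →
      ∃ ε₀ > (0 : ℝ), ∀ ε : ℝ, 0 < ε → ε < ε₀ →
        (IsSphereSpace X 2 → ∃ s : X, (⇑φ '' K) ∪ (⇑ψ '' L) ⊆ ball s (Real.pi / 2) ∧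
            segCyl (φ x) (ψ y) ε ⊆ ball s (Real.pi / 2)) ∧
        AxiallySymmetric (hullUnion K L φ ψ ∩ segCyl (φ x) (ψ y) ε)

/-- Condition (6) of Theorem 8. -/
def T8Cond6 (K L : Set X) : Prop :=
  ∃ δ > (0 : ℝ), ∀ φ ψ : X ≃ᵢ X, GoodPair 2 K L φ ψ →
    ∀ x ∈ frontier K, ∀ y ∈ frontier L,
      BigDiam 2 X (hullUnion K L φ ψ) δ →
      UniqueDiametral (hullUnion K L φ ψ) (φ x) (ψ y) →
      ∃ ε₀ > (0 : ℝ), ∀ ε : ℝ, 0 < ε → ε < ε₀ →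
        (IsSphereSpace X 2 → ∃ s : X, (⇑φ '' K) ∪ (⇑ψ '' L) ⊆ ball s (Real.pi / 2) ∧
            segCyl (φ x) (ψ y) ε ⊆ ball s (Real.pi / 2)) ∧
        AdmitsNontrivialCongruence (hullUnion K L φ ψ ∩ segCyl (φ x) (ψ y) ε)

/-- Condition (7) of Theorem 8: `K` and `L` are (in general incongruent) circles. -/
def T8Cond7 (K L : Set X) : Prop :=
  ∃ (p q : X) (r s : ℝ), 0 < r ∧ 0 < s ∧
    (IsSphereSpace X 2 → r < Real.pi / 2 ∧ s < Real.pi / 2) ∧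
    K = closedBall p r ∧ L = closedBall q s

/-- The squared chord length belonging to the distance `d` in curvature `k`. -/
noncomputable def chordSq (k d : ℝ) : ℝ :=
  if k = 1 then 2 - 2 * Real.cos d else if k = 0 then d ^ 2 else 2 * Real.cosh d - 2

/-- The Euclidean inner product on `ℂ`. -/
def dot (a b : ℂ) : ℝ := a.re * b.re + a.im * b.im

/-- A simultaneous description of the sphere, the Euclidean plane and the hyperbolic plane as
quadrics `k |w|² + t² = 1` in `ℂ × ℝ`. -/
structure KModel (X : Type*) [MetricSpace X] where
  k : ℝ
  hk : k = 1 ∨ k = 0 ∨ k = -1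
  sph : IsSphereSpace X 2 ↔ k = 1
  w : X → ℂ
  t : X → ℝ
  ext : ∀ x y, w x = w y → t x = t y → x = y
  mem : ∀ x, k * Complex.normSq (w x) + t x ^ 2 = 1
  pos : k ≠ 1 → ∀ x, 0 < t x
  surj : ∀ z s, k * Complex.normSq z + s ^ 2 = 1 → (k ≠ 1 → 0 < s) → ∃ x, w x = z ∧ t x = s
  q_eq : ∀ x y, Complex.normSq (w x - w y) + k * (t x - t y) ^ 2 = chordSq k (dist x y)
  dist_le_pi : k = 1 → ∀ x y : X, dist x y ≤ Real.pi

namespace KModel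
variable (m : KModel X)

def q (x y : X) : ℝ := Complex.normSq (m.w x - m.w y) + m.k * (m.t x - m.t y) ^ 2

theorem chordSq_lt {k a b : ℝ} (ha : 0 ≤ a) (hb : 0 ≤ b) (hp : k = 1 → a ≤ Real.pi ∧ b ≤ Real.pi) :
    chordSq k a < chordSq k b ↔ a < b := by
  unfold chordSq
  split_ifs with h1 h0
  · obtain ⟨h2, h3⟩ := hp h1
    have := Real.strictAntiOn_cos.lt_iff_gt (a := b) (b := a) ⟨hb, h3⟩ ⟨ha, h2⟩
    rw [← this]
    constructor <;> intro h <;> linarith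
  · exact pow_lt_pow_iff_left₀ ha hb (by norm_num)
  · have := Real.cosh_lt_cosh (x := a) (y := b)
    rw [abs_of_nonneg ha, abs_of_nonneg hb] at this
    rw [← this]
    constructor <;> intro h <;> linarith

theorem q_lt {x y z u : X} : m.q x y < m.q z u ↔ dist x y < dist z u := by
  unfold q
  rw [m.q_eq, m.q_eq]
  exact chordSq_lt dist_nonneg dist_nonneg fun h => ⟨m.dist_le_pi h _ _, m.dist_le_pi h _ _⟩

theorem q_le {x y z u : X} : m.q x y ≤ m.q z u ↔ dist x y ≤ dist z u := by
  rw [← not_lt, ← not_lt, m.q_lt]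

theorem q_inj {x y z u : X} : m.q x y = m.q z u ↔ dist x y = dist z u := by
  rw [le_antisymm_iff, le_antisymm_iff, m.q_le, m.q_le]

theorem q_self (x : X) : m.q x x = 0 := by simp [q]

theorem q_nonneg (x y : X) : 0 ≤ m.q x y := by
  rw [← m.q_self x, m.q_le, dist_self]; exact dist_nonneg

theorem mem' (x : X) : m.k * ((m.w x).re * (m.w x).re + (m.w x).im * (m.w x).im) + m.t x ^ 2 = 1 := by
  rw [← Complex.normSq_apply]; exact m.mem x

theorem k_sq (h : m.k ≠ 0) : m.k * m.k = 1 := by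
  rcases m.hk with h1 | h1 | h1 <;> simp_all

theorem t_of_zero (h : m.k = 0) (x : X) : m.t x = 1 := by
  have h1 := m.mem x
  have h2 := m.pos (by rw [h]; norm_num) x
  rw [h] at h1
  nlinarith

/-- The bilinear form of the ambient space. -/
def B (x y : X) : ℝ := m.k * dot (m.w x) (m.w y) + m.t x * m.t y

theorem q_eq_B (h : m.k ≠ 0) (x y : X) : m.q x y = 2 * m.k * (1 - m.B x y) := by
  have h1 := m.mem' x
  have h2 := m.mem' y
  have h3 := m.k_sq h
  simp only [q, B, dot, Complex.normSq_apply, Complex.sub_re, Complex.sub_im]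
  linear_combination m.k * h1 + m.k * h2 - ((m.w x).re * (m.w x).re + (m.w x).im * (m.w x).im +
    (m.w y).re * (m.w y).re + (m.w y).im * (m.w y).im -
    2 * ((m.w x).re * (m.w y).re + (m.w x).im * (m.w y).im)) * h3

/-- The base point of the model. -/
noncomputable def o : X := (m.surj 0 1 (by simp) (by intro; norm_num)).choose

theorem w_o : m.w m.o = 0 := (m.surj 0 1 (by simp) (by intro; norm_num)).choose_spec.1

theorem t_o : m.t m.o = 1 := (m.surj 0 1 (by simp) (by intro; norm_num)).choose_spec.2

theorem q_o (x : X) : m.q m.o x = Complex.normSq (m.w x) + m.k * (1 - m.t x) ^ 2 := by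
  simp [q, w_o, t_o]

theorem exists_small (z : ℂ) (hz : Complex.normSq z ≤ 1 / 4) : ∃ x, m.w x = z := by
  have h0 := Complex.normSq_nonneg z
  have h1 : 0 < 1 - m.k * Complex.normSq z := by
    rcases m.hk with h | h | h <;> rw [h] <;> linarith
  obtain ⟨x, hx, -⟩ := m.surj z (√(1 - m.k * Complex.normSq z)) (by
    rw [Real.sq_sqrt h1.le]; ring) (fun _ => Real.sqrt_pos.2 h1)
  exact ⟨x, hx⟩

theorem continuous_chordSq (k : ℝ) : Continuous (chordSq k) := by
  unfold chordSq
  split_ifs <;> fun_prop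

theorem continuous_q (x : X) : Continuous fun z => m.q x z := by
  have : (fun z => m.q x z) = fun z => chordSq m.k (dist x z) := by
    funext z; exact m.q_eq x z
  rw [this]
  exact (continuous_chordSq m.k).comp (continuous_const.dist continuous_id)

theorem continuous_t : Continuous m.t := by
  by_cases h : m.k = 0
  · have : m.t = fun _ => 1 := by funext x; exact m.t_of_zero h x
    rw [this]; exact continuous_const
  · have : m.t = fun z => 1 - m.k / 2 * m.q m.o z := by
      funext z
      rw [m.q_eq_B h]
      have := m.k_sq h
      simp only [B, w_o, t_o, dot, Complex.zero_re, Complex.zero_im]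
      linear_combination (1 - m.t z) * this
    rw [this]; exact continuous_const.sub (continuous_const.mul (m.continuous_q _))

theorem continuous_dot_w (z : ℂ) (hz : Complex.normSq z ≤ 1 / 4) :
    Continuous fun x => dot (m.w x) z := by
  obtain ⟨y, rfl⟩ := m.exists_small z hz
  have : (fun x => dot (m.w x) (m.w y)) =
      fun x => (m.q m.o x - m.k * (1 - m.t x) ^ 2 + m.q m.o y - m.k * (1 - m.t y) ^ 2
        + m.k * (m.t y - m.t x) ^ 2 - m.q y x) / 2 := by
    funext x
    simp only [m.q_o]
    simp only [q, dot, Complex.normSq_apply, Complex.sub_re, Complex.sub_im]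
    ring
  rw [this]
  have h1 := m.continuous_q m.o
  have h2 := m.continuous_q y
  have h3 := m.continuous_t
  fun_prop

theorem continuous_w : Continuous m.w := by
  have h1 := m.continuous_dot_w (1 / 2) (by norm_num [Complex.normSq_apply])
  have h2 := m.continuous_dot_w (Complex.I / 2) (by norm_num [Complex.normSq_apply])
  have : m.w = fun x => ((2 * dot (m.w x) (1 / 2) : ℝ) : ℂ) +
      ((2 * dot (m.w x) (Complex.I / 2) : ℝ) : ℂ) * Complex.I := by
    funext x
    apply Complex.ext <;> simp [dot] <;> ring
  rw [this]
  fun_prop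

theorem isReflection_of (s : X ≃ᵢ X) (f : X → ℝ) (hf : Continuous f)
    (hinv : ∀ x, s (s x) = x) (hfix : ∀ x, s x = x ↔ f x = 0)
    (hneg : ∃ x, f x < 0) (hpos : ∃ x, 0 < f x) : IsReflection s := by
  obtain ⟨a, ha⟩ := hneg
  obtain ⟨b, hb⟩ := hpos
  refine ⟨?_, ?_, ?_⟩
  · ext x; exact hinv x
  · rintro rfl
    exact ha.ne ((hfix a).1 rfl)
  · intro h
    have h1 := (h.image f hf.continuousOn).ordConnected.out
      (mem_image_of_mem f (show a ∈ {x | s x ≠ x} from fun h => ha.ne ((hfix a).1 h)))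
      (mem_image_of_mem f (show b ∈ {x | s x ≠ x} from fun h => hb.ne' ((hfix b).1 h)))
    obtain ⟨x, hx, hx0⟩ := h1 ⟨ha.le, hb.le⟩
    exact hx ((hfix x).2 hx0)

/-- The isometry given by an involution preserving the chord form. -/
def involIso (F : X → X) (h : ∀ x, F (F x) = x) (hq : ∀ x y, m.q (F x) (F y) = m.q x y) : X ≃ᵢ X :=
  IsometryEquiv.mk' F F h (Isometry.of_dist_eq fun x y => m.q_inj.1 (hq x y))

theorem exists_involution (a : X → ℂ) (b : X → ℝ)
    (hmem : ∀ x, m.k * Complex.normSq (a x) + b x ^ 2 = 1) (hpos : m.k ≠ 1 → ∀ x, 0 < b x)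
    (hq : ∀ x y, Complex.normSq (a x - a y) + m.k * (b x - b y) ^ 2 = m.q x y)
    (hinv : ∀ x y, m.w y = a x → m.t y = b x → a y = m.w x ∧ b y = m.t x) :
    ∃ s : X ≃ᵢ X, (∀ x, s (s x) = x) ∧ ∀ x, m.w (s x) = a x ∧ m.t (s x) = b x := by
  choose F hF1 hF2 using fun x => m.surj (a x) (b x) (hmem x) (fun h => hpos h x)
  have h1 : ∀ x, F (F x) = x := fun x => by
    obtain ⟨h1, h2⟩ := hinv x (F x) (hF1 x) (hF2 x)
    exact m.ext _ _ ((hF1 _).trans h1) ((hF2 _).trans h2)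
  refine ⟨m.involIso F h1 fun x y => ?_, h1, fun x => ⟨hF1 x, hF2 x⟩⟩
  unfold q at hq ⊢
  rw [hF1, hF1, hF2, hF2, hq]

/-- The reflection in a line through the base point. -/
theorem exists_lineRefl (b : ℂ) (hb : Complex.normSq b = 1) :
    ∃ s : X ≃ᵢ X, IsReflection s ∧ (∀ x, m.t (s x) = m.t x) ∧
      ∀ x, m.w (s x) = b ^ 2 * (starRingEnd ℂ) (m.w x) := by
  have hb' : b * (starRingEnd ℂ) b = 1 := by
    rw [Complex.mul_conj, hb]; simp
  have hb2 : Complex.normSq (b ^ 2) = 1 := by rw [map_pow, hb]; simp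
  obtain ⟨s, hs1, hs2⟩ := m.exists_involution (fun x => b ^ 2 * (starRingEnd ℂ) (m.w x)) m.t
    (fun x => by rw [map_mul, hb2, Complex.normSq_conj, one_mul]; exact m.mem x) m.pos
    (fun x y => by
      rw [← mul_sub, ← map_sub, map_mul, hb2, Complex.normSq_conj, one_mul]; rfl)
    (fun x y h1 h2 => ⟨by
      rw [h1]; simp only [map_mul, map_pow, Complex.conj_conj]
      linear_combination m.w x * (b * (starRingEnd ℂ) b + 1) * hb', h2⟩)
  have hbb := hb
  rw [Complex.normSq_apply] at hbb
  refine ⟨s, isReflection_of s (fun x => (m.w x).im * b.re - (m.w x).re * b.im) ?_ hs1 ?_ ?_ ?_,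
    fun x => (hs2 x).2, fun x => (hs2 x).1⟩
  · have := m.continuous_w
    fun_prop
  · intro x
    constructor
    · intro h
      have h1 := (hs2 x).1
      rw [h] at h1
      have h2 := congrArg (fun z => z * (starRingEnd ℂ) b) h1
      have h3 : b ^ 2 * (starRingEnd ℂ) (m.w x) * (starRingEnd ℂ) b = b * (starRingEnd ℂ) (m.w x) := by
        linear_combination b * (starRingEnd ℂ) (m.w x) * hb'
      simp only [h3] at h2
      have := congrArg Complex.im h2
      simp at this
      linarith
    · intro h
      apply m.ext
      · rw [(hs2 x).1]
        apply Complex.ext <;> simp [pow_two]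
        · linear_combination (m.w x).re * hbb + 2 * b.im * h
        · linear_combination (m.w x).im * hbb - 2 * b.re * h
      · exact (hs2 x).2
  · obtain ⟨x, hx⟩ := m.exists_small (-(Complex.I * b / 2)) (by
      simp [Complex.normSq_apply]; nlinarith)
    refine ⟨x, ?_⟩
    rw [hx]; simp; nlinarith
  · obtain ⟨x, hx⟩ := m.exists_small (Complex.I * b / 2) (by
      simp [Complex.normSq_apply]; nlinarith)
    refine ⟨x, ?_⟩
    rw [hx]; simp; nlinarith

end KModel

namespace KModel
variable (m : KModel X)

/-- Restrictions of linear functionals of the ambient space. -/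
def LinF (l : X → ℝ) : Prop := ∃ (n : ℂ) (c : ℝ), ∀ z, l z = dot (m.w z) n + c * m.t z

/-- The reflection interchanging `s` with the base point. -/
theorem exists_swap (s : X) (hs : m.w s ≠ 0) : ∃ f : X ≃ᵢ X, IsReflection f ∧ f s = m.o ∧
    (∀ x, f (f x) = x) ∧ ∀ l, m.LinF l → m.LinF (l ∘ f) := by
  have hn0 : 0 < Complex.normSq (m.w s) := Complex.normSq_pos.2 hs
  rw [Complex.normSq_apply] at hn0
  have hms := m.mem' s
  set u := m.w s with hu
  set T := m.t s with hT
  set n := u.re * u.re + u.im * u.im with hn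
  set c := (1 + T) / n with hc
  have hcn : c * n = 1 + T := by rw [hc]; field_simp
  have hkc : m.k = c * (1 - T) := by
    have : m.k * n = c * (1 - T) * n := by linear_combination hms - (1 - T) * hcn
    exact mul_right_cancel₀ hn0.ne' this
  let K : X → ℝ := fun x => c * dot (m.w x) u - m.t x
  obtain ⟨f, hf1, hf2⟩ := m.exists_involution (fun x => m.w x - (K x : ℂ) * u)
    (fun x => m.k * dot (m.w x) u + m.t x * T)
    (fun x => by
      have h1 := m.mem' x
      simp only [K, dot, Complex.normSq_apply, Complex.sub_re, Complex.sub_im, Complex.mul_re,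
        Complex.mul_im, Complex.ofReal_re, Complex.ofReal_im]
      set p := (m.w x).re * u.re + (m.w x).im * u.im with hp
      linear_combination h1 + (c * p - m.t x) ^ 2 * hms +
        (-2 * c * p ^ 2 + 2 * p * m.t x + 2 * p * m.t x * T + p ^ 2 * (m.k + c * (1 - T))) * hkc)
    (fun hk x => by
      have h1 := m.mem' x
      have h2 := m.pos hk x
      have h3 : 0 < T := m.pos hk s
      rcases m.hk with h | h | h
      · exact absurd h hk
      · rw [h]; simp; positivity
      · rw [h] at h1 hms ⊢
        have h4 : (dot (m.w x) u) ^ 2 < (m.t x * T) ^ 2 := by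
          simp only [dot]
          nlinarith [sq_nonneg ((m.w x).re * u.im - (m.w x).im * u.re), sq_nonneg (m.t x), hn0,
            mul_self_nonneg (m.w x).re, mul_self_nonneg (m.w x).im]
        have := abs_lt_of_sq_lt_sq h4 (by positivity)
        have := (abs_lt.1 this).2
        linarith)
    (fun x y => by
      simp only [q, K, dot, Complex.normSq_apply, Complex.sub_re, Complex.sub_im, Complex.mul_re,
        Complex.mul_im, Complex.ofReal_re, Complex.ofReal_im]
      have hp : ∃ p, p = ((m.w x).re - (m.w y).re) * u.re + ((m.w x).im - (m.w y).im) * u.im := ⟨_, rfl⟩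
      obtain ⟨p, hp⟩ := hp
      have hd : ∃ d, d = m.t x - m.t y := ⟨_, rfl⟩
      obtain ⟨d, hd⟩ := hd
      by_cases hk : m.k = 0
      · have h1 := m.t_of_zero hk
        have hT1 : T = 1 := h1 s
        rw [h1 x, h1 y, hk]
        linear_combination (c * p ^ 2) * (hcn.trans (by rw [hT1] : (1 + T) = 1 + 1)) +
          (-2 * c + c ^ 2 * n) * (((m.w x).re - (m.w y).re) * u.re +
            ((m.w x).im - (m.w y).im) * u.im + p) * (-hp)
      · have hkk := m.k_sq hk
        have e1 : ∀ p d : ℝ, -2 * (c * p - d) * p + (c * p - d) ^ 2 * n + m.k * (m.k * p + d * T) ^ 2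
            = m.k * d ^ 2 := by
          intro p d
          have e3 : n = m.k * (1 - T ^ 2) := by linear_combination m.k * hms - n * hkk
          linear_combination (c * p ^ 2 - 2 * p * d) * hcn + d ^ 2 * e3 + p ^ 2 * hkc +
            (m.k * p ^ 2 + 2 * p * d * T) * hkk
        have e2 := e1 (((m.w x).re - (m.w y).re) * u.re + ((m.w x).im - (m.w y).im) * u.im)
          (m.t x - m.t y)
        linear_combination e2)
    (fun x y h1 h2 => by
      have hKy : K y = - K x := by
        simp only [K, h1, h2]
        simp only [dot, Complex.sub_re, Complex.sub_im, Complex.mul_re,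
          Complex.mul_im, Complex.ofReal_re, Complex.ofReal_im]
        set p := (m.w x).re * u.re + (m.w x).im * u.im with hp
        linear_combination -(c * p - m.t x) * hcn - p * hkc
      refine ⟨by rw [hKy, h1]; push_cast; ring, ?_⟩
      simp only [h1, h2]
      simp only [K, dot, Complex.sub_re, Complex.sub_im, Complex.mul_re,
          Complex.mul_im, Complex.ofReal_re, Complex.ofReal_im]
      set p := (m.w x).re * u.re + (m.w x).im * u.im with hp
      linear_combination -(c * p - m.t x) * hms + p * (1 + T) * hkc)
  have hKs : K s = 1 := by
    simp only [K, dot, ← hu, ← hT, ← hn]; linarith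
  refine ⟨f, isReflection_of f K ?_ hf1 ?_ ⟨m.o, ?_⟩ ⟨s, ?_⟩, ?_, hf1, ?_⟩
  · have h1 := m.continuous_w
    have h2 := m.continuous_t
    simp only [K, dot]
    fun_prop
  · intro x
    constructor
    · intro h
      have h1 := (hf2 x).1
      rw [h] at h1
      have h2 : (K x : ℂ) * u = 0 := by linear_combination h1
      rcases mul_eq_zero.1 h2 with h3 | h3
      · exact_mod_cast h3
      · exact absurd h3 hs
    · intro h
      apply m.ext
      · rw [(hf2 x).1, h]; simp
      · rw [(hf2 x).2]
        simp only [K] at h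
        linear_combination dot (m.w x) u * hkc - (T - 1) * h
  · simp [K, w_o, t_o, dot]
  · rw [hKs]; norm_num
  · apply m.ext
    · rw [(hf2 s).1, hKs, w_o, ← hu]; simp
    · rw [(hf2 s).2, t_o, ← hu, ← hT]
      simp only [dot]
      linear_combination hms
  · rintro l ⟨a, b, hl⟩
    refine ⟨a - ((c * dot u a - b * m.k : ℝ) : ℂ) * u, dot u a + b * T, fun z => ?_⟩
    simp only [Function.comp, hl, (hf2 z).1, (hf2 z).2, K, dot, Complex.sub_re, Complex.sub_im,
      Complex.mul_re, Complex.mul_im, Complex.ofReal_re, Complex.ofReal_im]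
    ring

/-- Products of `n` reflections. -/
inductive RefProd : ℕ → (X ≃ᵢ X) → Prop
  | refl : RefProd 0 (IsometryEquiv.refl X)
  | cons {n : ℕ} {s f : X ≃ᵢ X} : IsReflection s → RefProd n f → RefProd (n + 1) (s.trans f)

theorem RefProd.exists_list {n : ℕ} {f : X ≃ᵢ X} (h : RefProd n f) :
    ∃ l : List (X ≃ᵢ X), (∀ s ∈ l, IsReflection s) ∧ l.length = n ∧
      f = l.foldr IsometryEquiv.trans (IsometryEquiv.refl X) := by
  induction h with
  | refl => exact ⟨[], by simp, rfl, rfl⟩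
  | cons hs _ ih =>
    obtain ⟨l, h1, h2, h3⟩ := ih
    exact ⟨_ :: l, by simpa using ⟨hs, h1⟩, by simp [h2], by rw [h3]; rfl⟩

theorem RefProd.orientationPreserving {n : ℕ} {f : X ≃ᵢ X} (h : RefProd n f) (hn : Even n) :
    OrientationPreserving f := by
  obtain ⟨l, h1, h2, h3⟩ := h.exists_list
  exact ⟨l, h1, h2 ▸ hn, h3⟩

theorem RefProd.trans {n k : ℕ} {f g : X ≃ᵢ X} (hf : RefProd n f) (hg : RefProd k g) :
    RefProd (n + k) (f.trans g) := by
  induction hf with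
  | refl =>
    rw [zero_add]
    exact hg
  | cons hs _ ih =>
    have := RefProd.cons hs ih
    rw [Nat.add_right_comm] at this
    exact this

theorem RefProd.single {s : X ≃ᵢ X} (hs : IsReflection s) : RefProd 1 s := 
  RefProd.cons hs RefProd.refl

theorem RefProd.symm {n : ℕ} {f : X ≃ᵢ X} (hf : RefProd n f) : RefProd n f.symm := by
  induction hf with
  | refl => exact RefProd.refl
  | @cons n s f hs _ ih =>
    have h1 : s.symm = s := by
      ext x
      rw [IsometryEquiv.symm_apply_eq]
      exact (DFunLike.congr_fun hs.1 x).symm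
    have := ih.trans (RefProd.single hs)
    rw [← h1] at this
    exact this

theorem exists_to_o (s : X) : ∃ f : X ≃ᵢ X, (∃ n, RefProd n f) ∧ f s = m.o ∧
    (∀ l, m.LinF l → m.LinF (l ∘ f)) ∧ ∀ l, m.LinF l → m.LinF (l ∘ f.symm) := by
  have key : ∀ f : X ≃ᵢ X, (∀ x, f (f x) = x) → (f.symm : X → X) = f := fun f hf => by
    funext x
    rw [IsometryEquiv.symm_apply_eq]
    exact (hf x).symm
  by_cases hs : m.w s = 0
  · obtain ⟨z, hz⟩ := m.exists_small (1 / 2) (by norm_num [Complex.normSq_apply])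
    obtain ⟨f, hf1, hf2, hf3, hf4⟩ := m.exists_swap z (by rw [hz]; norm_num)
    by_cases h : m.w (f s) = 0
    · by_cases hso : s = m.o
      · exact ⟨IsometryEquiv.refl X, ⟨0, RefProd.refl⟩, hso, fun l h => h, fun l h => h⟩
      · refine ⟨f, ⟨1, RefProd.single hf1⟩, ?_, hf4, (key f hf3).symm ▸ hf4⟩
        by_contra h2
        have e1 := m.mem (f s)
        have e2 := m.mem s
        rw [h] at e1
        rw [hs] at e2
        simp only [map_zero, mul_zero, zero_add] at e1 e2
        have e3 : m.t s = -1 := by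
          rcases sq_eq_sq_iff_eq_or_eq_neg.1 (e2.trans (one_pow 2).symm) with h | h
          · exact absurd (m.ext _ _ (hs.trans m.w_o.symm) (h.trans m.t_o.symm)) hso
          · exact h
        have e4 : m.t (f s) = -1 := by
          rcases sq_eq_sq_iff_eq_or_eq_neg.1 (e1.trans (one_pow 2).symm) with h' | h'
          · exact absurd (m.ext _ _ (h.trans m.w_o.symm) (h'.trans m.t_o.symm)) h2
          · exact h'
        have e5 : f s = s := m.ext _ _ (h.trans hs.symm) (e4.trans e3.symm)
        have e6 : m.q s z = m.q s m.o := by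
          rw [m.q_inj, ← f.dist_eq s z, e5, hf2]
        simp only [q, hs, e3, w_o, t_o, hz] at e6
        have e7 := m.mem z
        rw [hz] at e7
        have e8 : m.k = 1 := by
          by_contra hk
          have := m.pos hk s
          linarith
        rw [e8] at e6 e7
        norm_num [Complex.normSq_apply] at e6 e7
        nlinarith
    · obtain ⟨g, hg1, hg2, hg3, hg4⟩ := m.exists_swap (f s) h
      refine ⟨f.trans g, ⟨_, (RefProd.single hf1).trans (RefProd.single hg1)⟩, hg2,
        fun l h => hf4 (l ∘ g) (hg4 l h), fun l h => ?_⟩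
      have e1 := hg4 (l ∘ f) (hf4 l h)
      rw [← key f hf3, ← key g hg3] at e1
      exact e1
  · obtain ⟨f, hf1, hf2, hf3, hf4⟩ := m.exists_swap s hs
    exact ⟨f, ⟨1, RefProd.single hf1⟩, hf2, hf4, (key f hf3).symm ▸ hf4⟩

end KModel

theorem dot_comm (a b : ℂ) : dot a b = dot b a := by unfold dot; ring
theorem dot_add_left (a b c : ℂ) : dot (a + b) c = dot a c + dot b c := by simp [dot]; ring
theorem dot_add_right (a b c : ℂ) : dot a (b + c) = dot a b + dot a c := by simp [dot]; ring
theorem dot_sub_left (a b c : ℂ) : dot (a - b) c = dot a c - dot b c := by simp [dot]; ring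
theorem dot_sub_right (a b c : ℂ) : dot a (b - c) = dot a b - dot a c := by simp [dot]; ring
theorem dot_mul_left (r : ℝ) (a b : ℂ) : dot (r * a) b = r * dot a b := by simp [dot]; ring
theorem dot_mul_right (r : ℝ) (a b : ℂ) : dot a (r * b) = r * dot a b := by simp [dot]; ring
theorem dot_self (a : ℂ) : dot a a = ‖a‖ ^ 2 := by
  rw [← Complex.normSq_eq_norm_sq, Complex.normSq_apply]; rfl
theorem dot_zero_left (a : ℂ) : dot 0 a = 0 := by simp [dot]
theorem dot_zero_right (a : ℂ) : dot a 0 = 0 := by simp [dot]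
theorem dot_neg_left (a b : ℂ) : dot (-a) b = - dot a b := by simp [dot]; ring
theorem dot_neg_right (a b : ℂ) : dot a (-b) = - dot a b := by simp [dot]; ring

theorem normSq_sub (a b : ℂ) :
    Complex.normSq (a - b) = Complex.normSq a - 2 * dot a b + Complex.normSq b := by
  simp only [Complex.normSq_apply, dot, Complex.sub_re, Complex.sub_im]; ring

theorem normSq_eq_dot (a : ℂ) : Complex.normSq a = dot a a := by
  rw [Complex.normSq_apply]; rfl

namespace KModel
variable (m : KModel X)

theorem linF_re : m.LinF fun z => (m.w z).re := ⟨1, 0, fun z => by simp [dot]⟩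
theorem linF_im : m.LinF fun z => (m.w z).im := ⟨Complex.I, 0, fun z => by simp [dot]⟩
theorem linF_t : m.LinF m.t := ⟨0, 1, fun z => by simp [dot]⟩

theorem linF_dot_w (n : ℂ) : m.LinF fun z => dot (m.w z) n := ⟨n, 0, fun z => by simp⟩

theorem LinF.continuous {m : KModel X} {l : X → ℝ} (h : m.LinF l) : Continuous l := by
  obtain ⟨a, b, h⟩ := h
  have : l = fun z => dot (m.w z) a + b * m.t z := funext h
  rw [this]
  have h1 := m.continuous_w
  have h2 := m.continuous_t
  simp only [dot]
  fun_prop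

theorem t_eq_of_fix (g : X ≃ᵢ X) (hg : g m.o = m.o) (z : X) : m.t (g z) = m.t z := by
  by_cases h : m.k = 0
  · rw [m.t_of_zero h, m.t_of_zero h]
  · have h1 : m.q m.o (g z) = m.q m.o z := by
      rw [m.q_inj]; conv_lhs => rw [← hg]
      exact g.dist_eq _ _
    rw [m.q_eq_B h, m.q_eq_B h] at h1
    simp only [B, w_o, t_o, dot_zero_left] at h1
    have h2 : (2 * m.k) ≠ 0 := by simpa using h
    have := mul_left_cancel₀ h2 h1
    linarith

theorem dot_w_eq_of_fix (g : X ≃ᵢ X) (hg : g m.o = m.o) (z z' : X) :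
    dot (m.w (g z)) (m.w (g z')) = dot (m.w z) (m.w z') := by
  have ht := m.t_eq_of_fix g hg
  have hn : ∀ z, Complex.normSq (m.w (g z)) = Complex.normSq (m.w z) := fun z => by
    have h1 : m.q m.o (g z) = m.q m.o z := by
      rw [m.q_inj]; conv_lhs => rw [← hg]
      exact g.dist_eq _ _
    rw [q_o, q_o, ht] at h1
    linarith
  have h1 : m.q (g z) (g z') = m.q z z' := by rw [m.q_inj]; exact g.dist_eq _ _
  simp only [q, ht, normSq_sub, hn] at h1
  linarith

/-- An isometry fixing the base point acts on `ℂ` by a rotation or a reflection. -/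
theorem exists_unit_of_fix (g : X ≃ᵢ X) (hg : g m.o = m.o) :
    ∃ a : ℂ, ‖a‖ = 1 ∧
      ((∀ z, m.w (g z) = a * m.w z) ∨ ∀ z, m.w (g z) = a * (starRingEnd ℂ) (m.w z)) := by
  obtain ⟨x, hx⟩ := m.exists_small (1 / 2) (by norm_num [Complex.normSq_apply])
  obtain ⟨y, hy⟩ := m.exists_small (Complex.I / 2) (by norm_num [Complex.normSq_apply])
  have hd := m.dot_w_eq_of_fix g hg
  have h1 := hd x x
  have h2 := hd y y
  have h3 := hd x y
  have h4 := fun z => hd z x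
  have h5 := fun z => hd z y
  simp only [hx, hy] at h1 h2 h3 h4 h5
  set a := m.w (g x)
  set b := m.w (g y)
  simp [dot] at h1 h2 h3 h4 h5
  have h6 : (b = Complex.I * a) ∨ (b = - Complex.I * a) := by
    have : (a.re * b.im - a.im * b.re - 1 / 4) * (a.re * b.im - a.im * b.re + 1 / 4) = 0 := by
      linear_combination h1 * (b.re * b.re + b.im * b.im) + 1 / 4 * h2 - h3 *  (a.re * b.re + a.im * b.im)
    rcases mul_eq_zero.1 this with h | h
    · left
      apply Complex.ext <;> simp
      · linear_combination 4 * a.re * h3 - 4 * b.re * h1 - 4 * a.im * h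
      · linear_combination 4 * a.im * h3 - 4 * b.im * h1 + 4 * a.re * h
    · right
      apply Complex.ext <;> simp
      · linear_combination 4 * a.re * h3 - 4 * b.re * h1 - 4 * a.im * h
      · linear_combination 4 * a.im * h3 - 4 * b.im * h1 + 4 * a.re * h
  refine ⟨2 * a, ?_, ?_⟩
  · rw [← sq_eq_sq₀ (norm_nonneg _) zero_le_one, ← Complex.normSq_eq_norm_sq, Complex.normSq_apply]
    simp
    linear_combination 4 * h1
  · rcases h6 with h | h
    · left
      intro z
      have e1 := h4 z
      have e2 := h5 z
      rw [h] at e2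
      simp at e2
      apply Complex.ext <;> simp
      · linear_combination 4 * a.re * e1 - 4 * a.im * e2 - 4 * (m.w (g z)).re * h1
      · linear_combination 4 * a.im * e1 + 4 * a.re * e2 - 4 * (m.w (g z)).im * h1
    · right
      intro z
      have e1 := h4 z
      have e2 := h5 z
      rw [h] at e2
      simp at e2
      apply Complex.ext <;> simp
      · linear_combination 4 * a.re * e1 + 4 * a.im * e2 - 4 * (m.w (g z)).re * h1
      · linear_combination 4 * a.im * e1 - 4 * a.re * e2 - 4 * (m.w (g z)).im * h1

theorem exists_linear_of_fix (g : X ≃ᵢ X) (hg : g m.o = m.o) :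
    ∃ A : ℂ ≃ₗᵢ[ℝ] ℂ, ∀ z, m.w (g z) = A (m.w z) := by
  obtain ⟨a, ha, h⟩ := m.exists_unit_of_fix g hg
  let c : Circle := ⟨a, mem_sphere_zero_iff_norm.2 ha⟩
  rcases h with h | h
  · exact ⟨rotation c, fun z => by rw [h]; rfl⟩
  · exact ⟨Complex.conjLIE.trans (rotation c), fun z => by rw [h]; rfl⟩

theorem _root_.BallChar.dot_map (A : ℂ ≃ₗᵢ[ℝ] ℂ) (a b : ℂ) : dot (A a) (A b) = dot a b := by
  have h : ∀ a b : ℂ, dot a b = (‖a‖ ^ 2 + ‖b‖ ^ 2 - ‖a - b‖ ^ 2) / 2 := fun a b => by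
    rw [← dot_self, ← dot_self, ← dot_self, dot_sub_left, dot_sub_right, dot_sub_right, dot_comm b a]
    ring
  rw [h, h, ← map_sub, A.norm_map, A.norm_map, A.norm_map]

theorem LinF.comp {m : KModel X} {l : X → ℝ} (h : m.LinF l) (g : X ≃ᵢ X) : m.LinF (l ∘ g) := by
  obtain ⟨f, -, hf1, hf2, hf3⟩ := m.exists_to_o (g m.o)
  have h0 : (g.trans f) m.o = m.o := hf1
  obtain ⟨A, hA⟩ := m.exists_linear_of_fix _ h0
  have ht := m.t_eq_of_fix _ h0
  obtain ⟨a, b, h1⟩ := hf3 l h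
  refine ⟨A.symm a, b, fun z => ?_⟩
  have h2 := h1 ((g.trans f) z)
  rw [hA, ht] at h2
  simp only [Function.comp, IsometryEquiv.trans_apply, IsometryEquiv.symm_apply_apply] at h2 ⊢
  rw [h2]
  congr 1
  conv_rhs => rw [← dot_map A]
  simp

/-- `z` is the combination of `x` and `y` with coefficients `a` and `b`. -/
def Comb (a : ℝ) (x : X) (b : ℝ) (y z : X) : Prop :=
  m.w z = a * m.w x + b * m.w y ∧ m.t z = a * m.t x + b * m.t y

theorem Comb.linF {m : KModel X} {a b : ℝ} {x y z : X} (h : m.Comb a x b y z) {l : X → ℝ}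
    (hl : m.LinF l) : l z = a * l x + b * l y := by
  obtain ⟨n, c, hl⟩ := hl
  rw [hl, hl, hl, h.1, h.2, dot_add_left, dot_mul_left, dot_mul_left]
  ring

end KModel

namespace KModel
variable (m : KModel X)

theorem eq_o {x : X} (h : m.w x = 0) (h' : m.t x = 1) : x = m.o :=
  m.ext _ _ (h.trans m.w_o.symm) (h'.trans m.t_o.symm)

/-- The model with base point `s`. -/
noncomputable def cen (s : X) : KModel X :=
  let g := (m.exists_to_o s).choose
  { k := m.k
    hk := m.hk
    sph := m.sph
    w := fun x => m.w (g x)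
    t := fun x => m.t (g x)
    ext := fun x y h h' => g.injective (m.ext _ _ h h')
    mem := fun x => m.mem (g x)
    pos := fun h x => m.pos h (g x)
    surj := fun z s h h' => by
      obtain ⟨x, hx⟩ := m.surj z s h h'
      exact ⟨g.symm x, by simpa using hx⟩
    q_eq := fun x y => by rw [m.q_eq, g.dist_eq]
    dist_le_pi := m.dist_le_pi }

@[simp] theorem cen_k (s : X) : (m.cen s).k = m.k := rfl

@[simp] theorem cen_o (s : X) : (m.cen s).o = s := by
  have h := (m.exists_to_o s).choose_spec.2.1
  refine ((m.cen s).eq_o ?_ ?_).symm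
  · change m.w ((m.exists_to_o s).choose s) = 0
    rw [h, w_o]
  · change m.t ((m.exists_to_o s).choose s) = 1
    rw [h, t_o]

theorem cen_linF_iff (s : X) {l : X → ℝ} : (m.cen s).LinF l ↔ m.LinF l := by
  set g := (m.exists_to_o s).choose with hg
  constructor
  · rintro ⟨n, c, h⟩
    have : l = (fun z => dot (m.w z) n + c * m.t z) ∘ g := funext h
    rw [this]
    exact LinF.comp ⟨n, c, fun _ => rfl⟩ g
  · intro h
    obtain ⟨n, c, h'⟩ := h.comp g.symm
    refine ⟨n, c, fun z => ?_⟩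
    have := h' (g z)
    rw [Function.comp, g.symm_apply_apply] at this
    exact this

theorem comb_iff_linF {a b : ℝ} {x y z : X} :
    m.Comb a x b y z ↔ ∀ l, m.LinF l → l z = a * l x + b * l y := by
  refine ⟨fun h l hl => h.linF hl, fun h => ⟨Complex.ext ?_ ?_, h _ m.linF_t⟩⟩
  · simpa using h _ m.linF_re
  · simpa using h _ m.linF_im

theorem cen_comb (s : X) {a b : ℝ} {x y z : X} :
    (m.cen s).Comb a x b y z ↔ m.Comb a x b y z := by
  simp only [comb_iff_linF, cen_linF_iff]

/-! ### Topology -/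

/-- The embedding into the ambient space. -/
def v (x : X) : ℂ × ℝ := (m.w x, m.t x)

theorem continuous_v : Continuous m.v := m.continuous_w.prodMk m.continuous_t

theorem isInducing_v : Topology.IsInducing m.v := by
  rw [Topology.isInducing_iff_nhds]
  intro x
  refine le_antisymm (tendsto_iff_comap.1 m.continuous_v.continuousAt) ?_
  rw [Metric.nhds_basis_ball.ge_iff]
  intro ε hε
  set ε' := min ε 1
  have h0 : 0 < ε' := lt_min hε one_pos
  have h1 : chordSq m.k 0 < chordSq m.k ε' := by
    rw [chordSq_lt le_rfl h0.le]
    · exact h0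
    · intro; refine ⟨Real.pi_pos.le, (min_le_right _ _).trans ?_⟩
      linarith [Real.pi_gt_three]
  have h2 : chordSq m.k 0 = 0 := by
    rw [← dist_self x, ← m.q_eq]; simp
  rw [h2] at h1
  have hc : Continuous fun p : ℂ × ℝ => Complex.normSq (m.w x - p.1) + m.k * (m.t x - p.2) ^ 2 := by
    have := Complex.continuous_normSq
    fun_prop
  refine ⟨{p : ℂ × ℝ | Complex.normSq (m.w x - p.1) + m.k * (m.t x - p.2) ^ 2 < chordSq m.k ε'},
    (isOpen_lt hc continuous_const).mem_nhds ?_, ?_⟩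
  · simpa [v] using h1
  · intro y hy
    have h3 : chordSq m.k (dist x y) < chordSq m.k ε' := by
      rw [← m.q_eq]; exact hy
    rw [chordSq_lt dist_nonneg h0.le] at h3
    · rw [mem_ball, dist_comm]; exact h3.trans_le (min_le_left _ _)
    · intro h; refine ⟨m.dist_le_pi h _ _, (min_le_right _ _).trans ?_⟩
      linarith [Real.pi_gt_three]

theorem isClosedEmbedding_v : Topology.IsClosedEmbedding m.v := by
  refine ⟨⟨m.isInducing_v, fun x y h => ?_⟩, ?_⟩
  · exact m.ext _ _ (congrArg Prod.fst h) (congrArg Prod.snd h)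
  · have : range m.v = {p | m.k * Complex.normSq p.1 + p.2 ^ 2 = 1} ∩
        {p | m.k = 1 ∨ 0 ≤ p.2} := by
      ext p
      constructor
      · rintro ⟨x, rfl⟩
        exact ⟨m.mem x, or_iff_not_imp_left.2 fun h => (m.pos h x).le⟩
      · rintro ⟨h1, h2⟩
        obtain ⟨x, hx⟩ := m.surj p.1 p.2 h1 (fun h => by
          have h3 : 0 ≤ p.2 := h2.resolve_left h
          refine lt_of_le_of_ne h3 fun h4 => ?_
          rw [mem_ofPred_eq, ← h4] at h1
          have := Complex.normSq_nonneg p.1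
          rcases m.hk with h5 | h5 | h5
          · exact h h5
          · rw [h5] at h1; linarith
          · rw [h5] at h1; linarith)
        exact ⟨x, Prod.ext hx.1 hx.2⟩
    rw [this]
    refine IsClosed.inter (isClosed_eq ?_ continuous_const) ?_
    · have := Complex.continuous_normSq
      fun_prop
    · by_cases h : m.k = 1
      · simp [h]
      · simp only [h, false_or]
        exact isClosed_le continuous_const continuous_snd

theorem t_eq_of_ne (h : m.k ≠ 0) (x : X) : m.t x = 1 - m.k / 2 * m.q m.o x := by
  rw [m.q_eq_B h]
  have := m.k_sq h
  simp only [B, w_o, t_o, dot_zero_left]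
  linear_combination (1 - m.t x) * this

theorem properSpace (m : KModel X) : ProperSpace X := by
  have key : ∀ r, IsCompact (closedBall m.o r) := fun r => by
    by_cases hr : r < 0
    · rw [closedBall_eq_empty.2 hr]; exact isCompact_empty
    push Not at hr
    suffices h : ∃ C D, ∀ x ∈ closedBall m.o r, ‖m.w x‖ ^ 2 ≤ C ∧ m.t x ^ 2 ≤ D by
      obtain ⟨C, D, h⟩ := h
      refine (m.isClosedEmbedding_v.isCompact_preimage
        ((isCompact_closedBall (0 : ℂ) √C).prod (isCompact_closedBall (0 : ℝ) √D))).of_isClosed_subset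
        isClosed_closedBall fun x hx => ?_
      obtain ⟨h1, h2⟩ := h x hx
      refine ⟨?_, ?_⟩
      · rw [mem_closedBall_zero_iff]; exact Real.le_sqrt_of_sq_le h1
      · rw [mem_closedBall_zero_iff, Real.norm_eq_abs]; exact Real.abs_le_sqrt h2
    have hq : ∀ x ∈ closedBall m.o r, ∀ _ : m.k ≠ 1, m.q m.o x ≤ chordSq m.k r := fun x hx h => by
      have h1 := mem_closedBall'.1 hx
      unfold q
      rw [m.q_eq]
      by_contra! h2
      rw [chordSq_lt hr dist_nonneg (fun h' => absurd h' h)] at h2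
      linarith
    rcases m.hk with h | h | h
    · refine ⟨1, 1, fun x _ => ?_⟩
      have := m.mem x
      rw [h, Complex.normSq_eq_norm_sq] at this
      constructor <;> nlinarith [sq_nonneg (m.t x), sq_nonneg ‖m.w x‖]
    · refine ⟨chordSq m.k r, 1, fun x hx => ?_⟩
      have h1 := hq x hx (by rw [h]; norm_num)
      rw [q_o, m.t_of_zero h, Complex.normSq_eq_norm_sq] at h1
      rw [m.t_of_zero h]
      constructor <;> nlinarith
    · refine ⟨(1 + chordSq m.k r / 2) ^ 2, (1 + chordSq m.k r / 2) ^ 2, fun x hx => ?_⟩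
      have h1 := hq x hx (by rw [h]; norm_num)
      have h2 := m.t_eq_of_ne (by rw [h]; norm_num) x
      have h3 := m.mem x
      have h4 := m.pos (by rw [h]; norm_num) x
      rw [h] at h2 h3
      rw [Complex.normSq_eq_norm_sq] at h3
      rw [h] at h1
      rw [h]
      constructor <;> nlinarith
  refine ⟨fun x r => (key (r + dist x m.o)).of_isClosed_subset isClosed_closedBall ?_⟩
  exact closedBall_subset_closedBall' le_rfl

/-! ### The central chart -/

/-- The open hemisphere (or the whole space) around the base point. -/
def U : Set X := {x | 0 < m.t x}

theorem mem_U {x : X} : x ∈ m.U ↔ 0 < m.t x := Iff.rfl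

theorem o_mem_U : m.o ∈ m.U := by rw [mem_U, t_o]; exact one_pos

theorem isOpen_U : IsOpen m.U := isOpen_lt continuous_const m.continuous_t

theorem cos_dist_o (h : m.k = 1) (x : X) : Real.cos (dist m.o x) = m.t x := by
  have h1 := m.q_eq m.o x
  have h2 := m.mem x
  simp only [chordSq, h, if_true, w_o, t_o, zero_sub, Complex.normSq_neg] at h1 h2
  linarith

theorem mem_U_iff {x : X} : x ∈ m.U ↔ (IsSphereSpace X 2 → x ∈ ball m.o (Real.pi / 2)) := by
  rw [m.sph, mem_ball', mem_U]
  by_cases h : m.k = 1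
  · simp only [h, true_imp_iff]
    rw [← m.cos_dist_o h]
    have h1 := m.dist_le_pi h m.o x
    have h2 : 0 ≤ dist m.o x := dist_nonneg
    constructor
    · intro h3
      by_contra! h4
      have := Real.cos_nonpos_of_pi_div_two_le_of_le h4 (by linarith)
      linarith
    · intro h3
      exact Real.cos_pos_of_mem_Ioo ⟨by linarith [Real.pi_pos], h3⟩
  · simp only [h, false_imp_iff, iff_true]
    exact m.pos h x

/-- The central projection. -/
noncomputable def c (x : X) : ℂ := ((m.t x)⁻¹ : ℝ) * m.w x

theorem c_o : m.c m.o = 0 := by simp [c, w_o]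

theorem w_eq {x : X} (hx : x ∈ m.U) : m.w x = (m.t x : ℝ) * m.c x := by
  have : m.t x ≠ 0 := (m.mem_U.1 hx).ne'
  rw [c, ← mul_assoc, ← Complex.ofReal_mul, mul_inv_cancel₀ this]; simp

theorem t_sq {x : X} (hx : x ∈ m.U) : m.t x ^ 2 * (1 + m.k * Complex.normSq (m.c x)) = 1 := by
  have h := m.mem x
  rw [m.w_eq hx, map_mul, Complex.normSq_ofReal] at h
  linear_combination h

/-- The image of the central projection. -/
def dom : Set ℂ := {z | 0 < 1 + m.k * Complex.normSq z}

theorem isOpen_dom : IsOpen m.dom := by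
  have := Complex.continuous_normSq
  exact isOpen_lt continuous_const (by fun_prop)

theorem c_mem_dom {x : X} (hx : x ∈ m.U) : m.c x ∈ m.dom := by
  have h1 := m.t_sq hx
  have h2 : 0 < m.t x ^ 2 := pow_pos (m.mem_U.1 hx) 2
  by_contra h
  have h3 : 1 + m.k * Complex.normSq (m.c x) ≤ 0 := not_lt.1 h
  nlinarith

theorem convex_dom : Convex ℝ m.dom := by
  by_cases h : m.k = -1
  · have : m.dom = ball 0 1 := by
      ext z
      rw [mem_ball_zero_iff, dom, mem_ofPred_eq, h, Complex.normSq_eq_norm_sq, ← abs_norm z,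
        ← sq_lt_one_iff_abs_lt_one]
      simp
    rw [this]; exact convex_ball _ _
  · have : m.dom = univ := by
      ext z
      have := Complex.normSq_nonneg z
      rcases m.hk with h' | h' | h'
      · simp [dom, h']; linarith
      · simp [dom, h']
      · exact absurd h' h
    rw [this]; exact convex_univ

theorem exists_c {z : ℂ} (hz : z ∈ m.dom) :
    ∃ x, m.w x = ((√(1 + m.k * Complex.normSq z))⁻¹ : ℝ) * z ∧
      m.t x = (√(1 + m.k * Complex.normSq z))⁻¹ := by
  have h0 : 0 < √(1 + m.k * Complex.normSq z) := Real.sqrt_pos.2 hz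
  have h1 : √(1 + m.k * Complex.normSq z) ^ 2 = 1 + m.k * Complex.normSq z :=
    Real.sq_sqrt (le_of_lt hz)
  refine m.surj _ _ ?_ fun _ => inv_pos.2 h0
  rw [map_mul, Complex.normSq_ofReal]
  field_simp
  linarith

open Classical in
/-- The inverse of the central projection. -/
noncomputable def ci (z : ℂ) : X := if h : z ∈ m.dom then (m.exists_c h).choose else m.o

theorem t_ci {z : ℂ} (hz : z ∈ m.dom) : m.t (m.ci z) = (√(1 + m.k * Complex.normSq z))⁻¹ := by
  rw [ci, dif_pos hz]; exact (m.exists_c hz).choose_spec.2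

theorem w_ci {z : ℂ} (hz : z ∈ m.dom) :
    m.w (m.ci z) = ((√(1 + m.k * Complex.normSq z))⁻¹ : ℝ) * z := by
  rw [ci, dif_pos hz]; exact (m.exists_c hz).choose_spec.1

theorem ci_mem_U {z : ℂ} (hz : z ∈ m.dom) : m.ci z ∈ m.U := by
  rw [mem_U, m.t_ci hz]; exact inv_pos.2 (Real.sqrt_pos.2 hz)

theorem c_ci {z : ℂ} (hz : z ∈ m.dom) : m.c (m.ci z) = z := by
  have h0 : √(1 + m.k * Complex.normSq z) ≠ 0 := (Real.sqrt_pos.2 hz).ne'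
  rw [c, m.t_ci hz, m.w_ci hz, inv_inv, ← mul_assoc, ← Complex.ofReal_mul, mul_inv_cancel₀ h0]
  simp

theorem c_inj {x y : X} (hx : x ∈ m.U) (hy : y ∈ m.U) (h : m.c x = m.c y) : x = y := by
  have h1 := m.t_sq hx
  have h2 := m.t_sq hy
  rw [← h] at h2
  have h3 : m.t x ^ 2 = m.t y ^ 2 := by
    have : 1 + m.k * Complex.normSq (m.c x) ≠ 0 := fun h0 => by rw [h0] at h1; simp at h1
    exact mul_right_cancel₀ this (h1.trans h2.symm)
  have h4 : m.t x = m.t y := (sq_eq_sq₀ (le_of_lt hx) (le_of_lt hy)).1 h3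
  refine m.ext _ _ ?_ h4
  rw [m.w_eq hx, m.w_eq hy, h, h4]

theorem ci_c {x : X} (hx : x ∈ m.U) : m.ci (m.c x) = x :=
  m.c_inj (m.ci_mem_U (m.c_mem_dom hx)) hx (m.c_ci (m.c_mem_dom hx))

theorem continuousOn_c : ContinuousOn m.c m.U := by
  unfold c
  refine ContinuousOn.mul ?_ m.continuous_w.continuousOn
  exact Complex.continuous_ofReal.comp_continuousOn
    (m.continuous_t.continuousOn.inv₀ fun x hx => (m.mem_U.1 hx).ne')

theorem continuousOn_ci : ContinuousOn m.ci m.dom := by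
  rw [m.isInducing_v.continuousOn_iff]
  have h0 : ContinuousOn (fun z : ℂ => (√(1 + m.k * Complex.normSq z))⁻¹) m.dom := by
    refine ContinuousOn.inv₀ ?_ fun z hz => (Real.sqrt_pos.2 hz).ne'
    have := Complex.continuous_normSq
    fun_prop
  have : ContinuousOn (fun z : ℂ => ((((√(1 + m.k * Complex.normSq z))⁻¹ : ℝ) : ℂ) * z,
      (√(1 + m.k * Complex.normSq z))⁻¹)) m.dom :=
    ((Complex.continuous_ofReal.comp_continuousOn h0).mul continuousOn_id).prodMk h0
  exact this.congr fun z hz => Prod.ext (m.w_ci hz) (m.t_ci hz)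

/-- The central projection as a chart. -/
noncomputable def ch : OpenPartialHomeomorph X ℂ where
  toFun := m.c
  invFun := m.ci
  source := m.U
  target := m.dom
  map_source' := fun _ hx => m.c_mem_dom hx
  map_target' := fun _ hz => m.ci_mem_U hz
  left_inv' := fun _ hx => m.ci_c hx
  right_inv' := fun _ hz => m.c_ci hz
  open_source := m.isOpen_U
  open_target := m.isOpen_dom
  continuousOn_toFun := m.continuousOn_c
  continuousOn_invFun := m.continuousOn_ci

theorem map_c_nhds {x : X} (hx : x ∈ m.U) : map m.c (nhds x) = nhds (m.c x) :=
  m.ch.map_nhds_eq hx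

theorem map_ci_nhds {z : ℂ} (hz : z ∈ m.dom) : map m.ci (nhds z) = nhds (m.ci z) :=
  m.ch.symm.map_nhds_eq hz

end KModel

namespace KModel
variable (m : KModel X)

theorem norm_w_sq (x : X) : m.k * ‖m.w x‖ ^ 2 + m.t x ^ 2 = 1 := by
  rw [← Complex.normSq_eq_norm_sq]; exact m.mem x

theorem chordSq_inj {k a b : ℝ} (ha : 0 ≤ a) (hb : 0 ≤ b)
    (hp : k = 1 → a ≤ Real.pi ∧ b ≤ Real.pi) (h : chordSq k a = chordSq k b) : a = b := by
  have h1 := chordSq_lt ha hb hp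
  have h2 := chordSq_lt hb ha fun h => (hp h).symm
  rw [h] at h1
  rw [h] at h2
  simp only [lt_self_iff_false, false_iff, not_lt] at h1 h2
  exact le_antisymm h2 h1

/-- Generalised polar coordinates around the base point. -/
theorem polar (x : X) :
    (m.k = 1 ∧ ‖m.w x‖ = Real.sin (dist m.o x) ∧ m.t x = Real.cos (dist m.o x)) ∨
    (m.k = 0 ∧ ‖m.w x‖ = dist m.o x ∧ m.t x = 1) ∨
    (m.k = -1 ∧ ‖m.w x‖ = Real.sinh (dist m.o x) ∧ m.t x = Real.cosh (dist m.o x)) := by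
  have h1 := m.q_eq m.o x
  have h2 := m.norm_w_sq x
  have h3 : 0 ≤ dist m.o x := dist_nonneg
  simp only [chordSq, w_o, t_o, zero_sub, norm_neg, Complex.normSq_eq_norm_sq] at h1
  rcases m.hk with h | h | h
  · left
    simp only [h, if_true, one_mul] at h1 h2
    have h4 : m.t x = Real.cos (dist m.o x) := by linarith
    refine ⟨h, ?_, h4⟩
    rw [← sq_eq_sq₀ (norm_nonneg _) (Real.sin_nonneg_of_nonneg_of_le_pi h3 (m.dist_le_pi h _ _)),
      Real.sin_sq, ← h4]
    linarith
  · right; left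
    have h4 := m.t_of_zero h x
    simp only [h, if_true, zero_ne_one, if_false, zero_mul, add_zero] at h1
    exact ⟨h, (sq_eq_sq₀ (norm_nonneg _) h3).1 h1, h4⟩
  · right; right
    rw [h] at h1 h2
    norm_num at h1
    have h4 : m.t x = Real.cosh (dist m.o x) := by nlinarith
    refine ⟨h, ?_, h4⟩
    rw [← sq_eq_sq₀ (norm_nonneg _) (Real.sinh_nonneg_iff.2 h3), Real.sinh_sq, ← h4]
    linarith

/-- The distance of two points on the same ray. -/
theorem dist_of_ray {x y : X} (h : dot (m.w x) (m.w y) = ‖m.w x‖ * ‖m.w y‖) :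
    dist x y = |dist m.o x - dist m.o y| := by
  have h3 : 0 ≤ dist m.o x := dist_nonneg
  have h4 : 0 ≤ dist m.o y := dist_nonneg
  refine chordSq_inj (k := m.k) dist_nonneg (abs_nonneg _) (fun hk => ⟨m.dist_le_pi hk _ _, ?_⟩) ?_
  · have h5 := m.dist_le_pi hk m.o x
    have h6 := m.dist_le_pi hk m.o y
    rw [abs_le]; constructor <;> linarith
  · rw [← m.q_eq, normSq_sub, h, Complex.normSq_eq_norm_sq, Complex.normSq_eq_norm_sq]
    rcases m.polar x with ⟨hk, h5, h6⟩ | ⟨hk, h5, h6⟩ | ⟨hk, h5, h6⟩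
    · obtain ⟨-, h7, h8⟩ := (m.polar y).resolve_right (by rw [hk]; norm_num)
      rw [hk, h5, h6, h7, h8, chordSq, if_pos rfl, Real.cos_abs, Real.cos_sub]
      linear_combination Real.sin_sq_add_cos_sq (dist m.o x) + Real.sin_sq_add_cos_sq (dist m.o y)
    · obtain ⟨-, h7, h8⟩ := ((m.polar y).resolve_left (by rw [hk]; norm_num)).resolve_right
        (by rw [hk]; norm_num)
      rw [hk, h5, h6, h7, h8, chordSq, if_neg (by norm_num), if_pos rfl, sq_abs]
      ring
    · obtain ⟨-, h7, h8⟩ := ((m.polar y).resolve_left (by rw [hk]; norm_num)).resolve_left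
        (by rw [hk]; norm_num)
      rw [hk, h5, h6, h7, h8, chordSq, if_neg (by norm_num), if_neg (by norm_num), Real.cosh_abs,
        Real.cosh_sub]
      linear_combination -Real.cosh_sq (dist m.o x) - Real.cosh_sq (dist m.o y)

theorem dist_o_le_iff (x y : X) : dist m.o x ≤ dist m.o y ↔
    (m.k = 1 ∧ m.t y ≤ m.t x) ∨ (m.k = 0 ∧ ‖m.w x‖ ≤ ‖m.w y‖) ∨ (m.k = -1 ∧ m.t x ≤ m.t y) := by
  rw [← m.q_le]
  rcases m.hk with h | h | h
  · have h1 := m.t_eq_of_ne (by rw [h]; norm_num) x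
    have h2 := m.t_eq_of_ne (by rw [h]; norm_num) y
    rw [h] at h1 h2 ⊢
    norm_num
    constructor <;> intro <;> linarith
  · rw [q_o, q_o, m.t_of_zero h, m.t_of_zero h, h, Complex.normSq_eq_norm_sq,
      Complex.normSq_eq_norm_sq]
    norm_num
    exact sq_le_sq₀ (norm_nonneg _) (norm_nonneg _)
  · have h1 := m.t_eq_of_ne (by rw [h]; norm_num) x
    have h2 := m.t_eq_of_ne (by rw [h]; norm_num) y
    rw [h] at h1 h2 ⊢
    norm_num
    constructor <;> intro <;> linarith

theorem dist_o_eq_of {x y : X} (h : ‖m.w x‖ = ‖m.w y‖) (ht : m.t x = m.t y) :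
    dist m.o x = dist m.o y := by
  rw [← m.q_inj, q_o, q_o, Complex.normSq_eq_norm_sq, Complex.normSq_eq_norm_sq, h, ht]

theorem eq_of_dot {a b : ℂ} (h : dot a b = ‖a‖ * ‖b‖) (h' : ‖a‖ = ‖b‖) : a = b := by
  rw [← sub_eq_zero, ← Complex.normSq_eq_zero, normSq_sub, h, Complex.normSq_eq_norm_sq,
    Complex.normSq_eq_norm_sq, h']
  ring

theorem dot_real_mul_self {r : ℝ} (hr : 0 ≤ r) (a : ℂ) : dot (r * a) a = ‖(r : ℂ) * a‖ * ‖a‖ := by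
  rw [dot_mul_left, dot_self, norm_mul, Complex.norm_real, Real.norm_of_nonneg hr]; ring

theorem comb_sq {x z : X} {a b : ℝ} (h : m.Comb a m.o b x z) : m.t z = a + b * m.t x ∧
    m.w z = b * m.w x ∧ m.t z ^ 2 - b ^ 2 * m.t x ^ 2 = 1 - b ^ 2 := by
  have h1 := h.1
  have h2 := h.2
  rw [w_o, mul_zero, zero_add] at h1
  rw [t_o, mul_one] at h2
  refine ⟨h2, h1, ?_⟩
  have h3 := m.norm_w_sq z
  have h4 := m.norm_w_sq x
  rw [h1, norm_mul, Complex.norm_real, mul_pow, Real.norm_eq_abs, sq_abs] at h3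
  linear_combination h3 - b ^ 2 * h4

theorem btw_o_of_comb {y z : X} {a b : ℝ} (ha : 0 ≤ a) (hb : 0 ≤ b) (h : m.Comb a m.o b y z) :
    Btw m.o z y := by
  obtain ⟨h1, h2, h3⟩ := m.comb_sq h
  have h4 : dist m.o z ≤ dist m.o y := by
    rw [dist_o_le_iff]
    have h5 := m.norm_w_sq y
    rcases m.hk with h | h | h
    · left
      refine ⟨h, ?_⟩
      rw [h] at h5
      have h6 : m.t y ^ 2 ≤ 1 := by nlinarith [sq_nonneg ‖m.w y‖]
      have h7 : m.t z ^ 2 - m.t y ^ 2 = (1 - m.t y ^ 2) * (1 - b ^ 2) := by linear_combination h3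
      rw [h1] at h7 ⊢
      have e : (1 - b) * (1 + b) = 1 - b ^ 2 := by ring
      by_contra! hlt
      rcases le_total 0 (m.t y) with h0 | h0
      · have h8 : b < 1 := by
          by_contra! h9
          nlinarith
        have h9 : 0 ≤ a + b * m.t y := by positivity
        have h10 : 0 ≤ (1 - m.t y ^ 2) * (1 - b ^ 2) := mul_nonneg (by linarith) (by nlinarith)
        nlinarith
      · have h8 : 1 < b := by
          by_contra! h9
          nlinarith
        have h10 : 0 ≤ (1 - m.t y ^ 2) * (b ^ 2 - 1) := mul_nonneg (by linarith) (by nlinarith)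
        nlinarith
    · right; left
      refine ⟨h, ?_⟩
      have e1 := m.t_of_zero h y
      have e2 := m.t_of_zero h z
      rw [h2, norm_mul, Complex.norm_real, Real.norm_of_nonneg hb]
      have : b ≤ 1 := by rw [e1, e2] at h1; linarith
      exact mul_le_of_le_one_left (norm_nonneg _) this
    · right; right
      refine ⟨h, ?_⟩
      rw [h] at h5
      have h6 : 1 ≤ m.t y ^ 2 := by nlinarith [sq_nonneg ‖m.w y‖]
      have h7 : m.t z ^ 2 - m.t y ^ 2 = (1 - m.t y ^ 2) * (1 - b ^ 2) := by linear_combination h3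
      have h8 := m.pos (by rw [h]; norm_num) y
      have h9 := m.pos (by rw [h]; norm_num) z
      have h10 : b ≤ 1 := by
        by_contra! h10
        have : 0 ≤ a * (b * m.t y) := by positivity
        rw [h1] at h3
        nlinarith [sq_nonneg a]
      have h11 : 0 ≤ (m.t y ^ 2 - 1) * (1 - b ^ 2) := mul_nonneg (by linarith) (by nlinarith)
      nlinarith
  have h5 := m.dist_of_ray (x := z) (y := y) (by rw [h2]; exact dot_real_mul_self hb _)
  rw [abs_of_nonpos (by linarith)] at h5
  unfold Btw
  linarith

theorem ne_zero_of_not_antipodal {y : X} (hy : ¬ m.Comb (-1) m.o 0 m.o y) (hyo : y ≠ m.o) :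
    m.w y ≠ 0 := by
  intro h
  have h1 := m.norm_w_sq y
  rw [h, norm_zero] at h1
  have h2 : (m.t y - 1) * (m.t y + 1) = 0 := by linear_combination h1
  rcases mul_eq_zero.1 h2 with h3 | h3
  · exact hyo (m.eq_o h (by linarith))
  · refine hy ⟨by simp [h, w_o], ?_⟩
    rw [t_o]; linarith

theorem coeff_nonneg {s t b : ℝ} (hb0 : 0 ≤ b) (h9 : 0 < 1 - t ^ 2)
    (h7 : s ^ 2 - b ^ 2 * t ^ 2 = 1 - b ^ 2) (h10 : t ≤ s) : 0 ≤ s - b * t := by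
  have h8 : s ^ 2 - t ^ 2 = (1 - t ^ 2) * (1 - b ^ 2) := by linear_combination h7
  by_contra! h11
  have e : (s - b * t) * (s + b * t) = 1 - b ^ 2 := by linear_combination h7
  have e2 : (1 - b) * (1 + b) = 1 - b ^ 2 := by ring
  rcases le_total b 1 with h12 | h12
  · have : 0 ≤ 1 - b ^ 2 := by rw [← e2]; exact mul_nonneg (by linarith) (by linarith)
    have h13 : s + b * t ≤ 0 := by
      by_contra! h13
      nlinarith
    have h14 : s < 0 := by linarith
    have h15 : t < 0 := by linarith
    have h16 : 0 ≤ (1 - t ^ 2) * (1 - b ^ 2) := mul_nonneg h9.le this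
    have h17 : 0 ≤ (s - t) * (-s) := mul_nonneg (by linarith) (by linarith)
    have h18 : (s - t) * (-t) ≤ 0 := by nlinarith
    have h19 : s - t ≤ 0 := by
      by_contra! h
      have := mul_pos h (neg_pos.2 h15)
      linarith
    have h20 : s = t := by linarith
    rw [h20, sub_self] at h8
    have h21 : 1 - b ^ 2 = 0 := (mul_eq_zero.1 h8.symm).resolve_left h9.ne'
    have h22 : b = 1 := by nlinarith
    rw [h20, h22] at h11
    linarith
  · have : 1 - b ^ 2 ≤ 0 := by rw [← e2]; exact mul_nonpos_of_nonpos_of_nonneg (by linarith) (by linarith)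
    have h13 : 0 ≤ s + b * t := by
      by_contra! h13
      nlinarith
    rcases le_total 0 (t) with h14 | h14
    · have : s ^ 2 ≤ t ^ 2 := by nlinarith
      have : s ≤ t := by
        by_contra! h16
        nlinarith
      have h17 : s = t := le_antisymm this h10
      have h18 : b ^ 2 = 1 := by
        rw [h17, sub_self] at h8
        rcases mul_eq_zero.1 h8.symm with h | h <;> linarith
      have h19 : b = 1 := by nlinarith
      rw [h19, h17] at h11
      linarith
    · have : t < 0 := lt_of_le_of_ne h14 fun h => by rw [h] at h11 h13; linarith
      nlinarith

theorem comb_of_btw_o {y z : X} (hy : ¬ m.Comb (-1) m.o 0 m.o y) (h : Btw m.o z y) :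
    ∃ a b : ℝ, 0 ≤ a ∧ 0 ≤ b ∧ m.Comb a m.o b y z := by
  unfold Btw at h
  by_cases hyo : y = m.o
  · rw [hyo, dist_self] at h
    have : dist m.o z = 0 := by linarith [@dist_nonneg _ _ m.o z, @dist_nonneg _ _ z m.o]
    rw [dist_eq_zero] at this
    exact ⟨1, 0, zero_le_one, le_rfl, by rw [← this]; simp [Comb]⟩
  have hw := m.ne_zero_of_not_antipodal hy hyo
  have hw' : 0 < ‖m.w y‖ := norm_pos_iff.2 hw
  set b := ‖m.w z‖ / ‖m.w y‖ with hb
  have hb0 : 0 ≤ b := by positivity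
  have hb1 : ‖(b : ℂ) * m.w y‖ = ‖m.w z‖ := by
    rw [norm_mul, Complex.norm_real, Real.norm_of_nonneg hb0, hb, div_mul_cancel₀ _ hw'.ne']
  obtain ⟨z', hz1, hz2⟩ := m.surj (b * m.w y) (m.t z) (by
    rw [Complex.normSq_eq_norm_sq, hb1]; exact m.norm_w_sq z) (fun h => m.pos h z)
  have h1 : dist m.o z' = dist m.o z := m.dist_o_eq_of (by rw [hz1, hb1]) hz2
  have h2 := m.dist_of_ray (x := z') (y := y) (by rw [hz1]; exact dot_real_mul_self hb0 _)
  have h3 : dist m.o z ≤ dist m.o y := by linarith [@dist_nonneg _ _ z y]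
  rw [h1, abs_of_nonpos (by linarith)] at h2
  have h4 : m.q z' y = m.q z y := by rw [m.q_inj]; linarith
  have h5 : dot (m.w z) (m.w y) = ‖m.w z‖ * ‖m.w y‖ := by
    have e := dot_real_mul_self hb0 (m.w y)
    rw [hb1] at e
    rw [← e]
    unfold q at h4
    rw [normSq_sub, normSq_sub, hz1, hz2, Complex.normSq_eq_norm_sq, hb1,
      Complex.normSq_eq_norm_sq (m.w z)] at h4
    linarith
  have h6 : m.w z = b * m.w y := by
    refine eq_of_dot ?_ hb1.symm
    rw [dot_mul_right, h5, norm_mul, Complex.norm_real, Real.norm_of_nonneg hb0]; ring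
  refine ⟨m.t z - b * m.t y, b, ?_, hb0, by simp [w_o, h6], by rw [t_o]; ring⟩
  have h7 : m.t z ^ 2 - b ^ 2 * m.t y ^ 2 = 1 - b ^ 2 := by
    have h3 := m.norm_w_sq z
    have h4 := m.norm_w_sq y
    rw [h6, norm_mul, Complex.norm_real, mul_pow, Real.norm_eq_abs, sq_abs] at h3
    linear_combination h3 - b ^ 2 * h4
  have h8 : m.t z ^ 2 - m.t y ^ 2 = (1 - m.t y ^ 2) * (1 - b ^ 2) := by linear_combination h7
  have h9 : 0 < m.k * (1 - m.t y ^ 2) ∨ m.k = 0 := by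
    have h4 := m.norm_w_sq y
    have h5 : 0 < ‖m.w y‖ ^ 2 := by positivity
    by_cases hk : m.k = 0
    · right; exact hk
    · left
      have := m.k_sq hk
      have : m.k * (1 - m.t y ^ 2) = ‖m.w y‖ ^ 2 := by
        linear_combination -m.k * h4 + ‖m.w y‖ ^ 2 * this
      rwa [this]
  rcases (m.dist_o_le_iff z y).1 h3 with ⟨hk, h10⟩ | ⟨hk, h10⟩ | ⟨hk, h10⟩
  · rw [hk] at h9
    have h9 : 0 < 1 - m.t y ^ 2 := by simpa using h9
    exact coeff_nonneg hb0 h9 h7 h10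
  · rw [m.t_of_zero hk, m.t_of_zero hk, hb, mul_one, sub_nonneg, div_le_one hw']
    exact h10
  · rw [hk] at h9
    have h9 : 0 < m.t y ^ 2 - 1 := by
      rcases h9 with h | h
      · linarith
      · norm_num at h
    have p1 := m.pos (by rw [hk]; norm_num) y
    have p2 := m.pos (by rw [hk]; norm_num) z
    have h11 : m.t z ^ 2 ≤ m.t y ^ 2 := pow_le_pow_left₀ p2.le h10 2
    have h12 : 0 ≤ 1 - b ^ 2 := by
      by_contra! h12
      have := mul_pos h9 (neg_pos.2 h12)
      linarith
    have h13 : (b * m.t y) ^ 2 ≤ m.t z ^ 2 := by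
      rw [mul_pow]; linarith
    have := (sq_le_sq₀ (by positivity) p2.le).1 h13
    linarith

/-- Betweenness in terms of the ambient linear structure. -/
theorem btw_iff_comb {x y z : X} (h : ¬ m.Comb (-1) x 0 x y) :
    Btw x z y ↔ ∃ a b : ℝ, 0 ≤ a ∧ 0 ≤ b ∧ m.Comb a x b y z := by
  have h1 : ¬ (m.cen x).Comb (-1) (m.cen x).o 0 (m.cen x).o y := by
    rw [cen_comb, cen_o]; exact h
  constructor
  · intro hz
    obtain ⟨a, b, ha, hb, hc⟩ := (m.cen x).comb_of_btw_o h1 (z := z) (by rw [cen_o]; exact hz)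
    rw [cen_comb, cen_o] at hc
    exact ⟨a, b, ha, hb, hc⟩
  · rintro ⟨a, b, ha, hb, hc⟩
    have := (m.cen x).btw_o_of_comb (y := y) (z := z) ha hb (by rw [cen_comb, cen_o]; exact hc)
    rwa [cen_o] at this

theorem cen_w_self (x : X) : (m.cen x).w x = 0 := by
  have := (m.cen x).w_o
  rwa [cen_o] at this

theorem cen_t_self (x : X) : (m.cen x).t x = 1 := by
  have := (m.cen x).t_o
  rwa [cen_o] at this

theorem uniqueBtwPt_of {x y z : X} (h : ¬ m.Comb (-1) x 0 x y) (hz : Btw x z y) :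
    UniqueBtwPt x z y := by
  refine ⟨hz, fun u hu hd => ?_⟩
  obtain ⟨a, b, ha, hb, hc⟩ := (m.btw_iff_comb h).1 hz
  obtain ⟨a', b', ha', hb', hc'⟩ := (m.btw_iff_comb h).1 hu
  rw [← m.cen_comb x] at hc hc'
  have e1 : (m.cen x).w z = b * (m.cen x).w y := by
    have := hc.1
    rwa [cen_w_self, mul_zero, zero_add] at this
  have e2 : (m.cen x).w u = b' * (m.cen x).w y := by
    have := hc'.1
    rwa [cen_w_self, mul_zero, zero_add] at this
  have := (m.cen x).dist_of_ray (x := u) (y := z) (by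
    rw [e1, e2, dot_mul_left, dot_mul_right, dot_self, norm_mul, norm_mul, Complex.norm_real,
      Complex.norm_real, Real.norm_of_nonneg hb, Real.norm_of_nonneg hb']
    ring)
  rw [cen_o, hd, sub_self, abs_zero] at this
  exact dist_eq_zero.1 this

theorem not_antipodal {x y : X} (hx : x ∈ m.U) (hy : y ∈ m.U) : ¬ m.Comb (-1) x 0 x y := by
  intro h
  have := h.2
  rw [mem_U] at hx hy
  linarith

theorem btw_iff_segment {x y z : X} (hx : x ∈ m.U) (hy : y ∈ m.U) :
    Btw x z y ↔ z ∈ m.U ∧ m.c z ∈ segment ℝ (m.c x) (m.c y) := by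
  rw [m.btw_iff_comb (m.not_antipodal hx hy)]
  have hx' : 0 < m.t x := hx
  have hy' : 0 < m.t y := hy
  constructor
  · rintro ⟨a, b, ha, hb, h1, h2⟩
    have h3 : 0 < m.t z := by
      refine lt_of_le_of_ne (by rw [h2]; positivity) fun h3 => ?_
      have e1 : a * m.t x = 0 := by nlinarith [mul_nonneg ha hx'.le, mul_nonneg hb hy'.le]
      have e2 : b * m.t y = 0 := by nlinarith [mul_nonneg ha hx'.le, mul_nonneg hb hy'.le]
      have e3 : a = 0 := (mul_eq_zero.1 e1).resolve_right hx'.ne'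
      have e4 : b = 0 := (mul_eq_zero.1 e2).resolve_right hy'.ne'
      have h5 := m.mem z
      rw [h1, ← h3, e3, e4] at h5
      simp at h5
    refine ⟨h3, a * m.t x / m.t z, b * m.t y / m.t z, by positivity, by positivity, ?_, ?_⟩
    · rw [← add_div, ← h2, div_self h3.ne']
    · have e : m.c z = ((m.t z)⁻¹ : ℝ) * m.w z := rfl
      rw [e, h1, m.w_eq hx, m.w_eq hy, Complex.real_smul, Complex.real_smul]
      push_cast
      field_simp
  · rintro ⟨hz, a, b, ha, hb, hab, h⟩
    have hz' : 0 < m.t z := hz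
    refine ⟨m.t z * a / m.t x, m.t z * b / m.t y, by positivity, by positivity, ?_, ?_⟩
    · rw [m.w_eq hz, ← h, m.w_eq hx, m.w_eq hy, Complex.real_smul, Complex.real_smul]
      have := Complex.ofReal_ne_zero.2 hx'.ne'
      have := Complex.ofReal_ne_zero.2 hy'.ne'
      push_cast
      field_simp
    · rw [div_mul_cancel₀ _ hx'.ne', div_mul_cancel₀ _ hy'.ne', ← mul_add, hab, mul_one]

theorem GConvex.convex_image {C : Set X} (hC : GConvex C) : Convex ℝ (m.c '' (C ∩ m.U)) := by
  rw [convex_iff_segment_subset]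
  rintro _ ⟨x, ⟨hx, hxU⟩, rfl⟩ _ ⟨y, ⟨hy, hyU⟩, rfl⟩ z hz
  have hzd := m.convex_dom.segment_subset (m.c_mem_dom hxU) (m.c_mem_dom hyU) hz
  have h1 : Btw x (m.ci z) y :=
    (m.btw_iff_segment hxU hyU).2 ⟨m.ci_mem_U hzd, by rw [m.c_ci hzd]; exact hz⟩
  exact ⟨m.ci z, ⟨hC x hx y hy _ (m.uniqueBtwPt_of (m.not_antipodal hxU hyU) h1), m.ci_mem_U hzd⟩,
    m.c_ci hzd⟩

theorem gconvex_of_convex {A : Set ℂ} (hA : Convex ℝ A) : GConvex {x | x ∈ m.U ∧ m.c x ∈ A} := by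
  rintro x ⟨hx, hxA⟩ y ⟨hy, hyA⟩ z hz
  obtain ⟨h1, h2⟩ := (m.btw_iff_segment hx hy).1 hz.1
  exact ⟨h1, hA.segment_subset hxA hyA h2⟩

theorem gconvexHull_eq {A : Set X} (hA : A ⊆ m.U) :
    gconvexHull A = {x | x ∈ m.U ∧ m.c x ∈ convexHull ℝ (m.c '' A)} := by
  refine Subset.antisymm ?_ ?_
  · refine sInter_subset_of_mem ⟨m.gconvex_of_convex (convex_convexHull _ _), fun x hx => ?_⟩
    exact ⟨hA hx, subset_convexHull _ _ (mem_image_of_mem _ hx)⟩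
  · rintro x ⟨hx, hxc⟩ C ⟨hC, hAC⟩
    have := convexHull_min (image_mono (subset_inter hAC hA)) (GConvex.convex_image m hC) hxc
    obtain ⟨y, ⟨hy, hyU⟩, hyx⟩ := this
    rwa [← m.c_inj hyU hx hyx]

theorem subset_gconvexHull (A : Set X) : A ⊆ gconvexHull A := fun _ hx _ hC => hC.2 hx

end KModel

namespace KModel
variable (m : KModel X)

theorem mem_cen_U {s x : X} : x ∈ (m.cen s).U ↔ (IsSphereSpace X 2 → dist x s < Real.pi / 2) := by
  rw [mem_U_iff, cen_o]; rfl

theorem U_eq_univ (h : m.k ≠ 1) : m.U = univ := eq_univ_of_forall fun x => m.pos h x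

theorem self_mem_cen_U (s : X) : s ∈ (m.cen s).U := by
  have := (m.cen s).o_mem_U
  rwa [cen_o] at this

theorem cen_c_self (s : X) : (m.cen s).c s = 0 := by
  have := (m.cen s).c_o
  rwa [cen_o] at this

theorem closedBall_subset_cen_U {s : X} {r : ℝ} (hr : IsSphereSpace X 2 → r < Real.pi / 2) :
    closedBall s r ⊆ (m.cen s).U := fun _ hx =>
  m.mem_cen_U.2 fun h => lt_of_le_of_lt hx (hr h)

/-- Isometries fixing the base point act linearly. -/
theorem exists_c_linear (g : X ≃ᵢ X) (hg : g m.o = m.o) :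
    ∃ A : ℂ ≃ₗᵢ[ℝ] ℂ, (∀ z, m.w (g z) = A (m.w z)) ∧ ∀ z, m.c (g z) = A (m.c z) := by
  obtain ⟨A, hA⟩ := m.exists_linear_of_fix g hg
  refine ⟨A, hA, fun z => ?_⟩
  rw [c, c, hA, m.t_eq_of_fix g hg, ← Complex.real_smul, ← Complex.real_smul, map_smul]

theorem eq_refl_of_w (g : X ≃ᵢ X) (hg : g m.o = m.o) (h : ∀ z, m.w (g z) = m.w z) :
    g = IsometryEquiv.refl X := by
  ext z
  exact m.ext _ _ (h z) (m.t_eq_of_fix g hg z)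

/-- An isometry acts between the charts centred at corresponding points. -/
theorem exists_linear_cen (g : X ≃ᵢ X) (s : X) : ∃ A : ℂ ≃ₗᵢ[ℝ] ℂ,
    (∀ z, (m.cen (g s)).w (g z) = A ((m.cen s).w z)) ∧
    (∀ z, (m.cen (g s)).c (g z) = A ((m.cen s).c z)) ∧
    ∀ z, (m.cen (g s)).t (g z) = (m.cen s).t z := by
  set f₁ := (m.exists_to_o s).choose with h1
  set f₂ := (m.exists_to_o (g s)).choose with h2
  have e1 : f₁ s = m.o := (m.exists_to_o s).choose_spec.2.1
  have e2 : f₂ (g s) = m.o := (m.exists_to_o (g s)).choose_spec.2.1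
  have e3 : ((f₁.symm.trans g).trans f₂) m.o = m.o := by
    have : f₁.symm m.o = s := by rw [← e1]; simp
    show f₂ (g (f₁.symm m.o)) = m.o
    rw [this, e2]
  obtain ⟨A, hA, hA'⟩ := m.exists_c_linear _ e3
  refine ⟨A, fun z => ?_, fun z => ?_, fun z => ?_⟩
  · have := hA (f₁ z)
    simp only [IsometryEquiv.trans_apply, IsometryEquiv.symm_apply_apply] at this
    exact this
  · have := hA' (f₁ z)
    simp only [IsometryEquiv.trans_apply, IsometryEquiv.symm_apply_apply] at this
    exact this
  · have := m.t_eq_of_fix _ e3 (f₁ z)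
    simp only [IsometryEquiv.trans_apply, IsometryEquiv.symm_apply_apply] at this
    exact this

theorem t_sq_norm {x : X} (hx : x ∈ m.U) : m.t x ^ 2 * (1 + m.k * ‖m.c x‖ ^ 2) = 1 := by
  rw [← Complex.normSq_eq_norm_sq]; exact m.t_sq hx

theorem dist_o_le_iff_norm_c {x y : X} (hx : x ∈ m.U) (hy : y ∈ m.U) :
    dist m.o x ≤ dist m.o y ↔ ‖m.c x‖ ≤ ‖m.c y‖ := by
  rw [dist_o_le_iff]
  have h1 := m.t_sq_norm hx
  have h2 := m.t_sq_norm hy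
  have h3 : 0 < m.t x := hx
  have h4 : 0 < m.t y := hy
  rw [← sq_le_sq₀ (norm_nonneg (m.c x)) (norm_nonneg _)]
  rcases m.hk with h | h | h
  · rw [h] at h1 h2 ⊢
    norm_num
    rw [← sq_le_sq₀ h4.le h3.le]
    set u := ‖m.c x‖ ^ 2
    set v := ‖m.c y‖ ^ 2
    have hu : 0 ≤ u := sq_nonneg _
    have hv : 0 ≤ v := sq_nonneg _
    have : m.t x ^ 2 - m.t y ^ 2 = m.t x ^ 2 * m.t y ^ 2 * (v - u) := by
      linear_combination m.t x ^ 2 * (-h2) + m.t y ^ 2 * h1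
    have h5 : 0 < m.t x ^ 2 * m.t y ^ 2 := by positivity
    constructor <;> intro h6
    · by_contra! h7
      have := mul_pos h5 (sub_pos.2 h7)
      linarith
    · have := mul_nonneg h5.le (sub_nonneg.2 h6)
      linarith
  · rw [h]
    norm_num
    rw [c, c, m.t_of_zero h, m.t_of_zero h]
    norm_num
    exact (sq_le_sq₀ (norm_nonneg _) (norm_nonneg _)).symm
  · rw [h] at h1 h2 ⊢
    norm_num
    rw [← sq_le_sq₀ h3.le h4.le]
    set u := ‖m.c x‖ ^ 2
    set v := ‖m.c y‖ ^ 2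
    have : m.t y ^ 2 - m.t x ^ 2 = m.t x ^ 2 * m.t y ^ 2 * (v - u) := by
      linear_combination m.t x ^ 2 * (h2) - m.t y ^ 2 * h1
    have h5 : 0 < m.t x ^ 2 * m.t y ^ 2 := by positivity
    constructor <;> intro h6
    · by_contra! h7
      have := mul_pos h5 (sub_pos.2 h7)
      linarith
    · have := mul_nonneg h5.le (sub_nonneg.2 h6)
      linarith

theorem dist_o_lt_iff_norm_c {x y : X} (hx : x ∈ m.U) (hy : y ∈ m.U) :
    dist m.o x < dist m.o y ↔ ‖m.c x‖ < ‖m.c y‖ := by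
  rw [← not_le, ← not_le, m.dist_o_le_iff_norm_c hy hx]

theorem q_sub_q {p : X} (hp : p ∈ m.U) (z : X) :
    m.q m.o p - m.q z p = 2 * m.t p * (dot (m.w z) (m.c p) - m.q m.o z / 2) := by
  have h1 := m.norm_w_sq z
  have h2 := m.norm_w_sq p
  have e : dot (m.w z) (m.w p) = m.t p * dot (m.w z) (m.c p) := by
    rw [m.w_eq hp, dot_mul_right]
  rw [q_o, q_o, q, normSq_sub, e]
  simp only [Complex.normSq_eq_norm_sq]
  rcases m.hk with h | h | h
  · rw [h] at h1 ⊢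
    linear_combination (-1 + m.t p) * h1
  · rw [h, m.t_of_zero h z, m.t_of_zero h p]
    ring
  · rw [h] at h1 ⊢
    linear_combination (1 - m.t p) * h1

theorem dist_lt_dist_o_iff {p : X} (hp : p ∈ m.U) (z : X) :
    dist z p < dist m.o p ↔ m.q m.o z / 2 < dot (m.w z) (m.c p) := by
  have h0 : 0 < m.t p := hp
  rw [← m.q_lt, ← sub_pos, m.q_sub_q hp, mul_pos_iff_of_pos_left (by linarith), sub_pos]

/-- The discs with the base point on their boundary. -/
theorem dist_le_dist_o_iff {p : X} (hp : p ∈ m.U) (z : X) :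
    dist z p ≤ dist m.o p ↔ m.q m.o z / 2 ≤ dot (m.w z) (m.c p) := by
  have h0 : 0 < m.t p := hp
  rw [← m.q_le, ← sub_nonneg, m.q_sub_q hp, mul_nonneg_iff_of_pos_left (by linarith), sub_nonneg]

theorem q_pos {x y : X} (h : x ≠ y) : 0 < m.q x y := by
  rw [← m.q_self x, m.q_lt, dist_self]
  exact dist_pos.2 h

theorem LinF.exists_affine {m : KModel X} {l : X → ℝ} (h : m.LinF l) :
    ∃ (n : ℂ) (b : ℝ), ∀ z ∈ m.U, l z = m.t z * (dot (m.c z) n + b) := by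
  obtain ⟨n, b, h⟩ := h
  refine ⟨n, b, fun z hz => ?_⟩
  rw [h, m.w_eq hz, dot_mul_left]; ring

theorem isPreconnected_U : IsPreconnected m.U := by
  have := (m.convex_dom.isPreconnected).image m.ci m.continuousOn_ci
  have h : m.ci '' m.dom = m.U := m.ch.symm.image_source_eq_target
  rwa [h] at this

theorem mem_cen_U_iff_B (h : m.k = 1) {s x : X} : x ∈ (m.cen s).U ↔ 0 < m.B s x := by
  rw [mem_U, (m.cen s).t_eq_of_ne (by rw [cen_k, h]; norm_num), cen_o, cen_k]
  have : (m.cen s).q s x = m.q s x := by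
    unfold q; rw [m.q_eq, (m.cen s).q_eq, cen_k]
  rw [this, m.q_eq_B (by rw [h]; norm_num), h]
  constructor <;> intro <;> linarith

theorem preconnectedSpace (m : KModel X) : PreconnectedSpace X := by
  by_cases h : m.k = 1
  · rw [preconnectedSpace_iff_clopen]
    intro C hC
    rcases C.eq_empty_or_nonempty with h0 | ⟨s, hs⟩
    · exact Or.inl h0
    right
    have key : ∀ s ∈ C, (m.cen s).U ⊆ C := fun s hs =>
      (m.cen s).isPreconnected_U.subset_isClopen hC ⟨s, m.self_mem_cen_U s, hs⟩
    refine eq_univ_of_forall fun y => ?_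
    have hk' : (m.cen s).k = 1 := h
    obtain ⟨e, he, hy⟩ : ∃ e : ℂ, ‖e‖ = 1 ∧ (m.cen s).w y = ‖(m.cen s).w y‖ * e := by
      by_cases hw : (m.cen s).w y = 0
      · exact ⟨1, by simp, by simp [hw]⟩
      · have := norm_pos_iff.2 hw
        refine ⟨((‖(m.cen s).w y‖⁻¹ : ℝ) : ℂ) * (m.cen s).w y, ?_, ?_⟩
        · rw [norm_mul, Complex.norm_real, Real.norm_of_nonneg (by positivity)]
          field_simp
        · have : ((‖(m.cen s).w y‖ : ℝ) : ℂ) ≠ 0 := Complex.ofReal_ne_zero.2 this.ne'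
          push_cast
          field_simp
    have hn : Complex.normSq (((4 / 5 : ℝ) : ℂ) * e) = 16 / 25 := by
      rw [map_mul, Complex.normSq_ofReal, Complex.normSq_eq_norm_sq, he]; norm_num
    obtain ⟨s1, h1, h1'⟩ := (m.cen s).surj ((4 / 5 : ℝ) * e) (3 / 5) (by
      rw [hk', hn]; norm_num) (fun h' => absurd hk' h')
    obtain ⟨s2, h2, h2'⟩ := (m.cen s).surj ((4 / 5 : ℝ) * e) (-3 / 5) (by
      rw [hk', hn]; norm_num) (fun h' => absurd hk' h')
    have hs1 : s1 ∈ C := by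
      refine key s hs ?_
      rw [mem_U, h1']; norm_num
    have hs2 : s2 ∈ C := by
      refine key s1 hs1 ?_
      have := (m.cen s).mem_cen_U_iff_B hk' (s := s1) (x := s2)
      have e1 : s2 ∈ ((m.cen s).cen s1).U ↔ s2 ∈ (m.cen s1).U := by
        rw [mem_cen_U, mem_cen_U]
      rw [← e1, this, B, h1, h2, h1', h2', hk', ← normSq_eq_dot, hn]
      norm_num
    by_cases hty : 0 < (m.cen s).t y
    · exact key s hs hty
    · refine key s2 hs2 ?_
      have := (m.cen s).mem_cen_U_iff_B hk' (s := s2) (x := y)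
      have e1 : y ∈ ((m.cen s).cen s2).U ↔ y ∈ (m.cen s2).U := by
        rw [mem_cen_U, mem_cen_U]
      rw [← e1, this, B, h2, h2', hk', hy, dot_mul_left, dot_mul_right, dot_self, he]
      have h3 := (m.cen s).norm_w_sq y
      rw [hk'] at h3
      have h4 : 0 ≤ ‖(m.cen s).w y‖ := norm_nonneg _
      by_contra! h5
      push Not at hty
      have h6 : ‖(m.cen s).w y‖ = 0 := by nlinarith
      have h7 : (m.cen s).t y = 0 := by nlinarith
      rw [h6, h7] at h3
      norm_num at h3
  · have := m.isPreconnected_U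
    rw [m.U_eq_univ h] at this
    exact ⟨this⟩

end KModel

namespace KModel
variable (m : KModel X)

theorem Comb.nonneg {m : KModel X} {a b : ℝ} {x y z : X} (h : m.Comb a x b y z) (ha : 0 ≤ a)
    (hb : 0 ≤ b) {l : X → ℝ} (hl : m.LinF l) (hx : 0 ≤ l x) (hy : 0 ≤ l y) : 0 ≤ l z := by
  rw [h.linF hl]; positivity

theorem gconvex_nonneg {l : X → ℝ} (hl : m.LinF l) : GConvex {z | z ∈ m.U ∧ 0 ≤ l z} := by
  rintro x ⟨hx, hxl⟩ y ⟨hy, hyl⟩ z hz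
  refine ⟨((m.btw_iff_segment hx hy).1 hz.1).1, ?_⟩
  obtain ⟨a, b, ha, hb, h⟩ := (m.btw_iff_comb (m.not_antipodal hx hy)).1 hz.1
  exact h.nonneg ha hb hl hxl hyl

theorem nonneg_on_hull {l : X → ℝ} (hl : m.LinF l) {A : Set X} (hA : A ⊆ m.U)
    (h : ∀ z ∈ A, 0 ≤ l z) : ∀ z ∈ gconvexHull A, 0 ≤ l z := fun _ hz =>
  (hz {z | z ∈ m.U ∧ 0 ≤ l z} ⟨m.gconvex_nonneg hl, fun x hx => ⟨hA hx, h x hx⟩⟩).2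

theorem nonneg_of_local {l : X → ℝ} (hl : m.LinF l) {C : Set X} (hC : GConvex C) (hCU : C ⊆ m.U)
    {a : X} (ha : a ∈ C) (hla : l a = 0) (h : ∀ᶠ z in nhds a, z ∈ C → 0 ≤ l z) :
    ∀ z ∈ C, 0 ≤ l z := by
  intro z hz
  obtain ⟨n, b, hn⟩ := hl.exists_affine
  have haU := hCU ha
  have hzU := hCU hz
  have hconv := GConvex.convex_image m hC
  rw [inter_eq_self_of_subset_left hCU] at hconv
  rw [← m.ci_c haU, ← m.map_ci_nhds (m.c_mem_dom haU), eventually_map] at h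
  have hcont : Tendsto (fun s : ℝ => m.c a + (s : ℂ) * (m.c z - m.c a)) (nhdsWithin 0 (Ioi 0))
      (nhds (m.c a)) := by
    have : Continuous (fun s : ℝ => m.c a + (s : ℂ) * (m.c z - m.c a)) := by fun_prop
    have := this.tendsto 0
    simp only [Complex.ofReal_zero, zero_mul, add_zero] at this
    exact this.mono_left nhdsWithin_le_nhds
  obtain ⟨s, hs1, hs3, hs2⟩ := ((hcont.eventually h).and
    (Ioo_mem_nhdsGT (show (0 : ℝ) < 1 from one_pos))).exists
  obtain ⟨y, hy, hyc⟩ := hconv.add_smul_sub_mem (mem_image_of_mem _ ha) (mem_image_of_mem _ hz)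
    (t := s) ⟨hs3.le, hs2.le⟩
  rw [Complex.real_smul] at hyc
  rw [← hyc, m.ci_c (hCU hy)] at hs1
  have h1 := hs1 hy
  rw [hn y (hCU hy), hyc] at h1
  rw [hn a haU] at hla
  rw [hn z hzU]
  have e1 : 0 < m.t y := hCU hy
  have e2 : 0 < m.t a := haU
  have e3 : 0 < m.t z := hzU
  have h2 : dot (m.c a) n + b = 0 := (mul_eq_zero.1 hla).resolve_left e2.ne'
  rw [dot_add_left, dot_mul_left, dot_sub_left] at h1
  have h3 := nonneg_of_mul_nonneg_right h1 e1
  have h4 : 0 ≤ s * (dot (m.c z) n + b) := by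
    have : s * (dot (m.c z) n + b) =
        dot (m.c a) n + s * (dot (m.c z) n - dot (m.c a) n) + b := by
      linear_combination (s - 1) * h2
    rwa [this]
  exact mul_nonneg e3.le (nonneg_of_mul_nonneg_right h4 hs3)

end KModel

theorem btw_map (f : X ≃ᵢ X) {x z y : X} : Btw (f x) (f z) (f y) ↔ Btw x z y := by
  simp [Btw, f.dist_eq]

theorem uniqueBtwPt_map (f : X ≃ᵢ X) {x z y : X} :
    UniqueBtwPt (f x) (f z) (f y) ↔ UniqueBtwPt x z y := by
  unfold UniqueBtwPt
  rw [btw_map, f.surjective.forall]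
  simp only [btw_map, f.dist_eq, f.injective.eq_iff]

theorem GConvex.image {C : Set X} (h : GConvex C) (f : X ≃ᵢ X) : GConvex (f '' C) := by
  rintro _ ⟨x, hx, rfl⟩ _ ⟨y, hy, rfl⟩ z hz
  obtain ⟨z, rfl⟩ := f.surjective z
  exact mem_image_of_mem _ (h x hx y hy z ((uniqueBtwPt_map f).1 hz))

theorem gconvexHull_gconvex (A : Set X) : GConvex (gconvexHull A) := fun x hx y hy z hz C hC =>
  hC.1 x (hx C hC) y (hy C hC) z hz

theorem image_gconvexHull_subset (f : X ≃ᵢ X) (A : Set X) :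
    f '' gconvexHull A ⊆ gconvexHull (f '' A) := by
  rintro _ ⟨x, hx, rfl⟩ C ⟨hC, hAC⟩
  have := hx (f.symm '' C) ⟨hC.image f.symm, fun a ha =>
    ⟨f a, hAC (mem_image_of_mem _ ha), f.symm_apply_apply a⟩⟩
  obtain ⟨y, hy, rfl⟩ := this
  rwa [f.apply_symm_apply]

theorem image_gconvexHull (f : X ≃ᵢ X) (A : Set X) :
    f '' gconvexHull A = gconvexHull (f '' A) := by
  refine Subset.antisymm (image_gconvexHull_subset f A) fun x hx => ?_
  have h := image_gconvexHull_subset f.symm (f '' A) (mem_image_of_mem _ hx)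
  rw [← image_comp, show (f.symm ∘ f : X → X) = id from funext f.symm_apply_apply, image_id] at h
  exact ⟨_, h, f.apply_symm_apply x⟩

theorem onLine_map (f : X ≃ᵢ X) {a b z : X} : OnLine (f a) (f b) (f z) ↔ OnLine a b z := by
  simp only [OnLine, btw_map]

theorem image_perpDisc (f : X ≃ᵢ X) (a b : X) (ε : ℝ) :
    f '' perpDisc a b ε = perpDisc (f a) (f b) ε := by
  ext x
  obtain ⟨x, rfl⟩ := f.surjective x
  rw [f.injective.mem_set_image]
  unfold perpDisc
  simp only [Set.mem_ofPred_eq, f.dist_eq]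
  refine and_congr_left fun _ => ⟨fun h z hz => ?_, fun h z hz => ?_⟩
  · obtain ⟨z, rfl⟩ := f.surjective z
    rw [f.dist_eq]
    exact h z ((onLine_map f).1 hz)
  · rw [← f.dist_eq x z]
    exact h (f z) ((onLine_map f).2 hz)

theorem image_segCyl (f : X ≃ᵢ X) (a b : X) (ε : ℝ) :
    f '' segCyl a b ε = segCyl (f a) (f b) ε := by
  unfold segCyl
  rw [image_gconvexHull, image_union, image_perpDisc, image_perpDisc]

theorem segCyl_comm (a b : X) (ε : ℝ) : segCyl a b ε = segCyl b a ε := by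
  unfold segCyl
  rw [union_comm]

theorem UniqueDiametral.map_eq {M : Set X} {a b : X} (h : UniqueDiametral M a b) {f : X ≃ᵢ X}
    (hf : f '' M = M) : (f a = a ∧ f b = b) ∨ (f a = b ∧ f b = a) := by
  obtain ⟨ha, hb, -, hd, hu⟩ := h
  refine hu _ (hf ▸ mem_image_of_mem _ ha) _ (hf ▸ mem_image_of_mem _ hb) ?_
  rw [f.dist_eq, hd]

theorem UniqueDiametral.image_inter_segCyl {M : Set X} {a b : X} (h : UniqueDiametral M a b)
    {f : X ≃ᵢ X} (hf : f '' M = M) (ε : ℝ) : f '' (M ∩ segCyl a b ε) = M ∩ segCyl a b ε := by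
  rw [image_inter f.injective, hf, image_segCyl]
  rcases h.map_eq hf with ⟨h1, h2⟩ | ⟨h1, h2⟩
  · rw [h1, h2]
  · rw [h1, h2, segCyl_comm]

theorem AxiallySymmetric.admits {M : Set X} (h : AxiallySymmetric M) :
    AdmitsNontrivialCongruence M := by
  obtain ⟨s, h1, h2⟩ := h
  exact ⟨s, h1.2.1, h2⟩

theorem self_mem_perpDisc (a b : X) {ε : ℝ} (hε : 0 ≤ ε) : a ∈ perpDisc a b ε :=
  ⟨fun z _ => by rw [dist_self]; exact dist_nonneg, by rwa [dist_self]⟩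

namespace KModel

theorem exists_segCyl_subset (m : KModel X) {A : Set X} {s a b : X} (hA : A ⊆ (m.cen s).U)
    (ha : a ∈ A) (hb : b ∈ A) : ∃ ε₀ > 0, ∀ ε < ε₀, segCyl a b ε ⊆ (m.cen s).U := by
  obtain ⟨r, hr, h1⟩ := Metric.isOpen_iff.1 (m.cen s).isOpen_U a (hA ha)
  obtain ⟨r', hr', h2⟩ := Metric.isOpen_iff.1 (m.cen s).isOpen_U b (hA hb)
  refine ⟨min r r', lt_min hr hr', fun ε hε => ?_⟩
  unfold segCyl
  rw [(m.cen s).gconvexHull_eq]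
  · exact fun x hx => hx.1
  · rintro x (hx | hx)
    · exact h1 (mem_ball.2 (hx.2.trans_lt (hε.trans_le (min_le_left _ _))))
    · exact h2 (mem_ball.2 (hx.2.trans_lt (hε.trans_le (min_le_right _ _))))

theorem exists_segCyl_ball (m : KModel X) {A : Set X} {a b : X} (ha : a ∈ A) (hb : b ∈ A)
    (h : IsSphereSpace X 2 → ∃ s : X, A ⊆ ball s (Real.pi / 2)) :
    ∃ ε₀ > 0, ∀ ε < ε₀, IsSphereSpace X 2 → ∃ s : X, A ⊆ ball s (Real.pi / 2) ∧
      segCyl a b ε ⊆ ball s (Real.pi / 2) := by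
  by_cases hS : IsSphereSpace X 2
  · obtain ⟨s, hs⟩ := h hS
    have hU : (m.cen s).U = ball s (Real.pi / 2) := by
      ext x; rw [m.mem_cen_U]; exact ⟨fun h => h hS, fun h _ => h⟩
    obtain ⟨ε₀, h0, h1⟩ := m.exists_segCyl_subset (s := s) (hU ▸ hs) ha hb
    exact ⟨ε₀, h0, fun ε hε _ => ⟨s, hs, hU ▸ h1 ε hε⟩⟩
  · exact ⟨1, one_pos, fun _ _ h => absurd h hS⟩

theorem exists_unit (w : ℂ) : ∃ e : ℂ, ‖e‖ = 1 ∧ w = ‖w‖ * e := by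
  by_cases hw : w = 0
  · exact ⟨1, by simp, by simp [hw]⟩
  · have h := norm_pos_iff.2 hw
    refine ⟨((‖w‖⁻¹ : ℝ) : ℂ) * w, ?_, ?_⟩
    · rw [norm_mul, Complex.norm_real, Real.norm_of_nonneg (by positivity)]
      field_simp
    · have : ((‖w‖ : ℝ) : ℂ) ≠ 0 := Complex.ofReal_ne_zero.2 h.ne'
      push_cast
      field_simp

theorem exists_isReflection_fix_pair (m : KModel X) (x y : X) :
    ∃ s : X ≃ᵢ X, IsReflection s ∧ s x = x ∧ s y = y := by
  obtain ⟨e, he, hy⟩ := exists_unit ((m.cen x).w y)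
  obtain ⟨s, hs, ht, hw⟩ := (m.cen x).exists_lineRefl e (by
    rw [Complex.normSq_eq_norm_sq, he, one_pow])
  refine ⟨s, hs, (m.cen x).ext _ _ ?_ (ht x), (m.cen x).ext _ _ ?_ (ht y)⟩
  · rw [hw, m.cen_w_self]; simp
  · rw [hw, hy, map_mul, Complex.conj_ofReal]
    have h1 : e * (starRingEnd ℂ) e = 1 := by
      rw [Complex.mul_conj, Complex.normSq_eq_norm_sq, he]; norm_num
    linear_combination (‖(m.cen x).w y‖ * e : ℂ) * h1

theorem eq_of_dist_o (m : KModel X) {x y : X} (h : dist m.o x = dist m.o y) :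
    m.t x = m.t y ∧ ‖m.w x‖ = ‖m.w y‖ := by
  rcases m.polar x with ⟨h1, h2, h3⟩ | ⟨h1, h2, h3⟩ | ⟨h1, h2, h3⟩ <;>
  rcases m.polar y with ⟨h4, h5, h6⟩ | ⟨h4, h5, h6⟩ | ⟨h4, h5, h6⟩ <;>
  first | (rw [h2, h3, h5, h6, h]; exact ⟨rfl, rfl⟩) | (rw [h1] at h4; norm_num at h4)

theorem exists_orientationPreserving (m : KModel X) {x p x' p' : X}
    (h : dist x p = dist x' p') :
    ∃ f : X ≃ᵢ X, OrientationPreserving f ∧ f x = x' ∧ f p = p' := by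
  obtain ⟨f₁, ⟨n₁, h₁⟩, e₁, -⟩ := m.exists_to_o x
  obtain ⟨f₂, ⟨n₂, h₂⟩, e₂, -⟩ := m.exists_to_o x'
  have hd : dist m.o (f₁ p) = dist m.o (f₂ p') := by
    rw [← e₁, f₁.dist_eq, e₁, ← e₂, f₂.dist_eq, h]
  obtain ⟨ht, hw⟩ := m.eq_of_dist_o hd
  obtain ⟨u, hu, hu'⟩ := exists_unit (m.w (f₁ p))
  obtain ⟨v, hv, hv'⟩ := exists_unit (m.w (f₂ p'))
  obtain ⟨b, hb⟩ := IsAlgClosed.exists_pow_nat_eq (u * v) two_pos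
  have hb1 : ‖b‖ = 1 := by
    have : ‖b‖ ^ 2 = 1 := by rw [← norm_pow, hb, norm_mul, hu, hv, one_mul]
    exact (pow_eq_one_iff_of_nonneg (norm_nonneg _) two_ne_zero).1 this
  obtain ⟨s, hs, hst, hsw⟩ := m.exists_lineRefl b (by
    rw [Complex.normSq_eq_norm_sq, hb1, one_pow])
  have g0 : RefProd _ ((f₁.trans s).trans f₂.symm) :=
    (h₁.trans (RefProd.single hs)).trans h₂.symm
  set g := (f₁.trans s).trans f₂.symm with hg
  have gx : g x = x' := by
    have : s m.o = m.o := m.ext _ _ (by rw [hsw, m.w_o]; simp) (hst _)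
    show f₂.symm (s (f₁ x)) = x'
    rw [e₁, this, ← e₂, f₂.symm_apply_apply]
  have gp : g p = p' := by
    have : s (f₁ p) = f₂ p' := by
      refine m.ext _ _ ?_ ((hst _).trans ht)
      rw [hsw, hu', hb, map_mul, Complex.conj_ofReal, hw]
      conv_rhs => rw [hv']
      have h1 : u * (starRingEnd ℂ) u = 1 := by
        rw [Complex.mul_conj, Complex.normSq_eq_norm_sq, hu]; norm_num
      linear_combination (‖m.w (f₂ p')‖ * v : ℂ) * h1
    show f₂.symm (s (f₁ p)) = p'
    rw [this, f₂.symm_apply_apply]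
  rcases Nat.even_or_odd (n₁ + 1 + n₂) with he | he
  · exact ⟨g, g0.orientationPreserving he, gx, gp⟩
  · obtain ⟨r, hr, hrx, hrp⟩ := m.exists_isReflection_fix_pair x' p'
    refine ⟨g.trans r, (g0.trans (RefProd.single hr)).orientationPreserving he.add_one, ?_, ?_⟩
    · show r (g x) = x'
      rw [gx, hrx]
    · show r (g p) = p'
      rw [gp, hrp]

theorem cond1_of_cond7 (m : KModel X) {K L : Set X} (h : T8Cond7 K L) : T8Cond1 K L := by
  obtain ⟨p, q, r, s, -, -, -, rfl, rfl⟩ := h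
  intro φ ψ _
  obtain ⟨g, hg, hp, hq⟩ := m.exists_isReflection_fix_pair (φ p) (ψ q)
  refine ⟨g, hg, ?_⟩
  unfold hullUnion
  rw [image_gconvexHull, image_union, φ.image_closedBall, ψ.image_closedBall,
    g.image_closedBall, g.image_closedBall, hp, hq]

theorem cond5_of_cond3 (m : KModel X) {K L : Set X} (hK : IsClosed K) (hL : IsClosed L)
    (h : T8Cond3 K L) : T8Cond5 K L := by
  obtain ⟨δ, hδ, h⟩ := h
  refine ⟨δ, hδ, fun φ ψ hφ x hx y hy hB hU => ?_⟩
  obtain ⟨s, hs, hs'⟩ := h φ ψ hφ x hx y hy hB hU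
  obtain ⟨ε₀, h0, h1⟩ := m.exists_segCyl_ball
    (Or.inl (mem_image_of_mem φ (hK.frontier_subset hx)))
    (Or.inr (mem_image_of_mem ψ (hL.frontier_subset hy))) hφ.2.2
  exact ⟨ε₀, h0, fun ε _ hε => ⟨h1 ε hε, s, hs, hU.image_inter_segCyl hs' ε⟩⟩

theorem cond6_of_cond4 (m : KModel X) {K L : Set X} (hK : IsClosed K) (hL : IsClosed L)
    (h : T8Cond4 K L) : T8Cond6 K L := by
  obtain ⟨δ, hδ, h⟩ := h
  refine ⟨δ, hδ, fun φ ψ hφ x hx y hy hB hU => ?_⟩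
  obtain ⟨s, hs, hs'⟩ := h φ ψ hφ x hx y hy hB hU
  obtain ⟨ε₀, h0, h1⟩ := m.exists_segCyl_ball
    (Or.inl (mem_image_of_mem φ (hK.frontier_subset hx)))
    (Or.inr (mem_image_of_mem ψ (hL.frontier_subset hy))) hφ.2.2
  exact ⟨ε₀, h0, fun ε _ hε => ⟨h1 ε hε, s, hs, hU.image_inter_segCyl hs' ε⟩⟩

end KModel

theorem cond2_of_cond1 {K L : Set X} (h : T8Cond1 K L) : T8Cond2 K L := fun φ ψ hφ =>
  (h φ ψ hφ).admits

theorem cond3_of_cond1 {K L : Set X} (h : T8Cond1 K L) : T8Cond3 K L :=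
  ⟨1, one_pos, fun φ ψ hφ _ _ _ _ _ _ => h φ ψ hφ⟩

theorem cond4_of_cond2 {K L : Set X} (h : T8Cond2 K L) : T8Cond4 K L :=
  ⟨1, one_pos, fun φ ψ hφ _ _ _ _ _ _ => h φ ψ hφ⟩

theorem cond4_of_cond3 {K L : Set X} (h : T8Cond3 K L) : T8Cond4 K L := by
  obtain ⟨δ, hδ, h⟩ := h
  exact ⟨δ, hδ, fun φ ψ hφ x hx y hy hB hU => (h φ ψ hφ x hx y hy hB hU).admits⟩

theorem cond6_of_cond5 {K L : Set X} (h : T8Cond5 K L) : T8Cond6 K L := by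
  obtain ⟨δ, hδ, h⟩ := h
  refine ⟨δ, hδ, fun φ ψ hφ x hx y hy hB hU => ?_⟩
  obtain ⟨ε₀, h0, h1⟩ := h φ ψ hφ x hx y hy hB hU
  exact ⟨ε₀, h0, fun ε e1 e2 => ⟨(h1 ε e1 e2).1, (h1 ε e1 e2).2.admits⟩⟩

/-- The standing assumptions on one of the two bodies. -/
structure Body (C : Set X) : Prop where
  closed : IsClosed C
  conv : GConvex C
  int : (interior C).Nonempty
  ne : C ≠ univ
  supp : SupportingSpheres 2 C

theorem Body.image {C : Set X} (h : Body C) (f : X ≃ᵢ X) : Body (f '' C) where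
  closed := f.toHomeomorph.isClosedMap _ h.closed
  conv := h.conv.image f
  int := by
    have : f '' interior C = interior (f '' C) := f.toHomeomorph.image_interior C
    rw [← this]
    exact h.int.image f
  ne := fun h' => h.ne (by rw [← image_univ_of_surjective f.surjective] at h';
                           exact f.injective.image_injective h')
  supp := by
    have : f '' frontier C = frontier (f '' C) := f.toHomeomorph.image_frontier C
    rw [SupportingSpheres, ← this]
    rintro _ ⟨x, hx, rfl⟩
    obtain ⟨p, R, h1, h2, h3, h4⟩ := h.supp x hx
    refine ⟨f p, R, h1, ?_, ?_, h4⟩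
    · rw [← f.image_closedBall]
      exact image_mono h2
    · rw [mem_sphere, f.dist_eq]
      exact h3

theorem image_frontier' (f : X ≃ᵢ X) (C : Set X) : f '' frontier C = frontier (f '' C) :=
  f.toHomeomorph.image_frontier C

namespace KModel
variable (m : KModel X)

/-- `n` is an inner normal of `C` at `x`. -/
def IsNormal (C : Set X) (x : X) (n : ℂ) : Prop := n ≠ 0 ∧ ∀ z ∈ C, 0 ≤ dot ((m.cen x).w z) n

/-- There is only one inner normal direction at `x`. -/
def SmoothAt (C : Set X) (x : X) : Prop :=
  ∀ n n', m.IsNormal C x n → m.IsNormal C x n' → ∃ r : ℝ, 0 < r ∧ n' = r * n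

/-- `p` is the centre of a disc containing `C` with `x` on its boundary. -/
def IsCentre (C : Set X) (x p : X) : Prop :=
  p ≠ x ∧ p ∈ (m.cen x).U ∧ C ⊆ closedBall p (dist x p)

variable {m}

theorem IsNormal.image {C : Set X} {x : X} {n : ℂ} (h : m.IsNormal C x n) (f : X ≃ᵢ X)
    {A : ℂ ≃ₗᵢ[ℝ] ℂ} (hA : ∀ z, (m.cen (f x)).w (f z) = A ((m.cen x).w z)) :
    m.IsNormal (f '' C) (f x) (A n) := by
  refine ⟨fun h0 => h.1 ((map_eq_zero_iff A A.injective).1 h0), ?_⟩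
  rintro _ ⟨z, hz, rfl⟩
  rw [hA, dot_map]
  exact h.2 z hz

theorem IsNormal.of_image {C : Set X} {x : X} {n : ℂ} (f : X ≃ᵢ X)
    {A : ℂ ≃ₗᵢ[ℝ] ℂ} (hA : ∀ z, (m.cen (f x)).w (f z) = A ((m.cen x).w z))
    (h : m.IsNormal (f '' C) (f x) (A n)) : m.IsNormal C x n := by
  refine ⟨fun h0 => h.1 (by rw [h0, map_zero]), fun z hz => ?_⟩
  have := h.2 (f z) (mem_image_of_mem f hz)
  rwa [hA, dot_map] at this

theorem SmoothAt.image {C : Set X} {x : X} (h : m.SmoothAt C x) (f : X ≃ᵢ X) :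
    m.SmoothAt (f '' C) (f x) := by
  obtain ⟨A, hA, -⟩ := m.exists_linear_cen f x
  intro n n' hn hn'
  rw [← A.apply_symm_apply n] at hn ⊢
  rw [← A.apply_symm_apply n'] at hn' ⊢
  obtain ⟨r, hr, hr'⟩ := h _ _ (hn.of_image f hA) (hn'.of_image f hA)
  refine ⟨r, hr, ?_⟩
  rw [hr', ← Complex.real_smul, map_smul, Complex.real_smul]

theorem IsCentre.image {C : Set X} {x p : X} (h : m.IsCentre C x p) (f : X ≃ᵢ X) :
    m.IsCentre (f '' C) (f x) (f p) := by
  obtain ⟨h1, h2, h3⟩ := h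
  refine ⟨f.injective.ne h1, ?_, ?_⟩
  · rw [mem_cen_U, f.dist_eq]
    exact m.mem_cen_U.1 h2
  · rw [f.dist_eq, ← f.image_closedBall]
    exact image_mono h3

theorem IsCentre.subset_U {C : Set X} {x p : X} (h : m.IsCentre C x p) : C ⊆ (m.cen p).U :=
  h.2.2.trans (m.closedBall_subset_cen_U fun hS => by
    rw [dist_comm]; exact m.mem_cen_U.1 h.2.1 hS)

theorem isCentre_iff {C : Set X} {x p : X} (hpx : p ≠ x) (hp : p ∈ (m.cen x).U) :
    m.IsCentre C x p ↔
      ∀ z ∈ C, (m.cen x).q x z / 2 ≤ dot ((m.cen x).w z) ((m.cen x).c p) := by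
  have key : ∀ z, dist z p ≤ dist x p ↔
      (m.cen x).q x z / 2 ≤ dot ((m.cen x).w z) ((m.cen x).c p) := fun z => by
    have := (m.cen x).dist_le_dist_o_iff hp z
    rwa [cen_o] at this
  constructor
  · exact fun h z hz => (key z).1 (h.2.2 hz)
  · exact fun h => ⟨hpx, hp, fun z hz => (key z).2 (h z hz)⟩

theorem IsCentre.le {C : Set X} {x p : X} (h : m.IsCentre C x p) {z : X} (hz : z ∈ C) :
    (m.cen x).q x z / 2 ≤ dot ((m.cen x).w z) ((m.cen x).c p) :=
  (isCentre_iff h.1 h.2.1).1 h z hz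

theorem IsCentre.c_ne {C : Set X} {x p : X} (h : m.IsCentre C x p) : (m.cen x).c p ≠ 0 := by
  intro h0
  refine h.1 ((m.cen x).c_inj h.2.1 (m.self_mem_cen_U x) ?_)
  rw [h0, cen_c_self]

theorem IsCentre.isNormal {C : Set X} {x p : X} (h : m.IsCentre C x p) :
    m.IsNormal C x ((m.cen x).c p) :=
  ⟨h.c_ne, fun z hz => (div_nonneg ((m.cen x).q_nonneg x z) zero_le_two).trans (h.le hz)⟩

/-- Adding normals to the position of a centre yields a centre. -/
theorem IsCentre.add {C : Set X} {x p : X} (h : m.IsCentre C x p) {n : ℂ}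
    (hn : ∀ z ∈ C, 0 ≤ dot ((m.cen x).w z) n) (h0 : (m.cen x).c p + n ≠ 0)
    (hd : (m.cen x).c p + n ∈ (m.cen x).dom) :
    m.IsCentre C x ((m.cen x).ci ((m.cen x).c p + n)) := by
  rw [isCentre_iff _ ((m.cen x).ci_mem_U hd)]
  · intro z hz
    rw [(m.cen x).c_ci hd, dot_add_right]
    linarith [h.le hz, hn z hz]
  · intro h1
    apply h0
    rw [← (m.cen x).c_ci hd, h1, cen_c_self]

variable (m)

theorem exists_isCentre {C : Set X} (h : Body C) {x : X} (hx : x ∈ frontier C) :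
    ∃ p, m.IsCentre C x p := by
  obtain ⟨p, R, h1, h2, h3, h4⟩ := h.supp x hx
  rw [mem_sphere] at h3
  refine ⟨p, ?_, ?_, h3.symm ▸ h2⟩
  · rintro rfl
    rw [dist_self] at h3
    exact h1.ne h3
  · rw [mem_cen_U, dist_comm, h3]
    exact h4

theorem frontier_nonempty (m : KModel X) {C : Set X} (h : Body C) : (frontier C).Nonempty := by
  have := m.preconnectedSpace
  exact nonempty_frontier_iff.2 ⟨h.int.mono interior_subset, h.ne⟩

theorem exists_subset_U (m : KModel X) {C : Set X} (h : Body C) : ∃ s, C ⊆ (m.cen s).U := by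
  obtain ⟨x, hx⟩ := m.frontier_nonempty h
  obtain ⟨p, hp⟩ := m.exists_isCentre h hx
  exact ⟨p, hp.subset_U⟩

theorem isCompact (m : KModel X) {C : Set X} (h : Body C) : IsCompact C := by
  have := m.properSpace
  obtain ⟨x, hx⟩ := m.frontier_nonempty h
  obtain ⟨p, hp⟩ := m.exists_isCentre h hx
  exact (isCompact_closedBall _ _).of_isClosed_subset h.closed hp.2.2

/-- The shape of a body in a chart containing it. -/
theorem image_c {C : Set X} (h : Body C) (hU : C ⊆ m.U) :
    IsCompact (m.c '' C) ∧ Convex ℝ (m.c '' C) ∧ interior (m.c '' C) = m.c '' interior C := by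
  refine ⟨(m.isCompact h).image_of_continuousOn (m.continuousOn_c.mono hU), ?_, ?_⟩
  · have := GConvex.convex_image m h.conv
    rwa [inter_eq_self_of_subset_left hU] at this
  · refine Subset.antisymm ?_ ?_
    · intro z hz
      obtain ⟨x, hx, rfl⟩ := interior_subset hz
      refine mem_image_of_mem _ (mem_interior_iff_mem_nhds.2 ?_)
      have h1 : ∀ᶠ u in nhds (m.c x), u ∈ m.c '' C := mem_interior_iff_mem_nhds.1 hz
      rw [← m.map_c_nhds (hU hx), eventually_map] at h1
      filter_upwards [h1, m.isOpen_U.mem_nhds (hU hx)] with u ⟨y, hy, hyu⟩ hu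
      rwa [← m.c_inj (hU hy) hu hyu]
    · rintro _ ⟨x, hx, rfl⟩
      rw [mem_interior_iff_mem_nhds, ← m.map_c_nhds (hU (interior_subset hx))]
      exact image_mem_map (mem_interior_iff_mem_nhds.1 hx)

theorem mem_image_c {C : Set X} (hU : C ⊆ m.U) {x : X} (hx : x ∈ m.U) :
    m.c x ∈ m.c '' C ↔ x ∈ C :=
  ⟨fun ⟨_, hy, h⟩ => m.c_inj (hU hy) hx h ▸ hy, fun h => mem_image_of_mem _ h⟩

theorem subset_closure_interior (m : KModel X) {C : Set X} (h : Body C) : C ⊆ closure (interior C) := by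
  obtain ⟨s, hs⟩ := m.exists_subset_U h
  obtain ⟨h1, h2, h3⟩ := (m.cen s).image_c h hs
  intro x hx
  have h4 : (m.cen s).c x ∈ closure (interior ((m.cen s).c '' C)) := by
    rw [h2.closure_interior_eq_closure_of_nonempty_interior]
    · exact subset_closure (mem_image_of_mem _ hx)
    · rw [h3]; exact h.int.image _
  rw [mem_closure_iff_frequently, ← (m.cen s).map_c_nhds (hs hx), frequently_map] at h4
  rw [mem_closure_iff_frequently]
  refine (h4.and_eventually ((m.cen s).isOpen_U.mem_nhds (hs hx))).mono fun y hy => ?_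
  rw [h3] at hy
  obtain ⟨⟨z, hz, hzy⟩, hyU⟩ := hy
  rwa [← (m.cen s).c_inj (hs (interior_subset hz)) hyU hzy]

theorem isNormal_of_local {C : Set X} (h : Body C) {x : X} (hx : x ∈ C) {n : ℂ} (hn : n ≠ 0)
    (hl : ∀ᶠ z in nhds x, z ∈ C → 0 ≤ dot ((m.cen x).w z) n) : m.IsNormal C x n := by
  obtain ⟨s, hs⟩ := m.exists_subset_U h
  have h1 : (m.cen s).LinF fun z => dot ((m.cen x).w z) n :=
    (m.cen_linF_iff s).2 ((m.cen_linF_iff x).1 ((m.cen x).linF_dot_w n))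
  exact ⟨hn, (m.cen s).nonneg_of_local h1 h.conv hs hx (by rw [cen_w_self, dot_zero_left]) hl⟩

theorem tendsto_ray (h : ℂ) :
    Tendsto (fun s : ℝ => (s : ℂ) * h) (nhdsWithin 0 (Ioi 0)) (nhds 0) := by
  have : Continuous (fun s : ℝ => (s : ℂ) * h) := by fun_prop
  have := this.tendsto 0
  simp only [Complex.ofReal_zero, zero_mul] at this
  exact this.mono_left nhdsWithin_le_nhds

theorem zero_mem_dom : (0 : ℂ) ∈ m.dom := by simp [dom]

theorem map_ci_nhds_zero (x : X) : map (m.cen x).ci (nhds 0) = nhds x := by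
  rw [(m.cen x).map_ci_nhds (m.cen x).zero_mem_dom]
  congr 1
  rw [← m.cen_c_self x, (m.cen x).ci_c (m.self_mem_cen_U x)]

theorem eventually_ray {x : X} {p : X → Prop} (hp : ∀ᶠ z in nhds x, p z) (h : ℂ) :
    ∀ᶠ s : ℝ in nhdsWithin 0 (Ioi 0), p ((m.cen x).ci (s * h)) := by
  rw [← m.map_ci_nhds_zero x, eventually_map] at hp
  exact (tendsto_ray h).eventually hp

theorem exists_functional_dot (f : StrongDual ℝ ℂ) : ∃ n : ℂ, ∀ z, f z = dot z n := by
  refine ⟨⟨f 1, f Complex.I⟩, fun z => ?_⟩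
  conv_lhs => rw [← Complex.re_add_im z]
  rw [map_add, show (z.re : ℂ) = z.re • (1 : ℂ) by simp,
    show (z.im : ℂ) * Complex.I = z.im • Complex.I by simp, map_smul, map_smul]
  simp [dot]

/-- At a smooth point all directions in the open tangent half plane point into the interior. -/
theorem SmoothAt.inward {m : KModel X} {C : Set X} (hC : Body C) {x : X} (hx : x ∈ C)
    (hs : m.SmoothAt C x) {n : ℂ} (hn : m.IsNormal C x n) {h : ℂ} (hh : 0 < dot h n) :
    ∀ᶠ s : ℝ in nhdsWithin 0 (Ioi 0), (m.cen x).ci (s * h) ∈ interior C := by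
  set M := m.cen x with hM
  set Q := M.c '' (C ∩ M.U) with hQ
  have hxU : x ∈ M.U := m.self_mem_cen_U x
  have hQc : Convex ℝ Q := GConvex.convex_image M hC.conv
  have h0Q : (0 : ℂ) ∈ Q := ⟨x, ⟨hx, hxU⟩, m.cen_c_self x⟩
  have hinc : ∀ z ∈ M.U, M.c z ∈ interior Q → z ∈ interior C := by
    intro z hz hzi
    have h1 : ∀ᶠ u in nhds (M.c z), u ∈ Q := mem_interior_iff_mem_nhds.1 hzi
    rw [← M.map_c_nhds hz, eventually_map] at h1
    rw [mem_interior_iff_mem_nhds]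
    filter_upwards [h1, M.isOpen_U.mem_nhds hz] with u ⟨y, hy, hyu⟩ hu
    rw [← M.c_inj hy.2 hu hyu]
    exact hy.1
  have hinc' : ∀ z ∈ M.U, z ∈ interior C → M.c z ∈ interior Q := by
    intro z hz hzi
    rw [mem_interior_iff_mem_nhds, ← M.map_c_nhds hz]
    exact image_mem_map (inter_mem (mem_interior_iff_mem_nhds.1 hzi) (M.isOpen_U.mem_nhds hz))
  have hcl : (0 : ℂ) ∈ closure (interior Q) := by
    have h1 := m.subset_closure_interior hC hx
    rw [mem_closure_iff_frequently] at h1 ⊢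
    rw [← m.cen_c_self x, ← hM, ← M.map_c_nhds hxU, frequently_map]
    exact (h1.and_eventually (M.isOpen_U.mem_nhds hxU)).mono fun y hy => hinc' y hy.2 hy.1
  have hex : ∃ s : ℝ, 0 < s ∧ (s : ℂ) * h ∈ interior Q := by
    by_contra! hcon
    set R : Set ℂ := (fun s : ℝ => (s : ℂ) * h) '' Ioi 0 with hR
    have hRc : Convex ℝ R := by
      have : R = (LinearMap.toSpanSingleton ℝ ℂ h) '' Ioi 0 := by
        rw [hR]; congr 1
      rw [this]
      exact (convex_Ioi 0).linear_image _
    obtain ⟨f, u, hf1, hf2⟩ := geometric_hahn_banach_open hQc.interior isOpen_interior hRc (by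
      rw [disjoint_right]
      rintro _ ⟨s, hs, rfl⟩
      exact hcon s hs)
    obtain ⟨n', hn'⟩ := exists_functional_dot f
    have hu0 : u ≤ 0 := by
      have h1 : Tendsto (fun s : ℝ => f ((s : ℂ) * h)) (nhdsWithin 0 (Ioi 0)) (nhds 0) := by
        have := (f.continuous.tendsto 0).comp (tendsto_ray h)
        rwa [map_zero] at this
      exact ge_of_tendsto h1 (eventually_mem_nhdsWithin.mono fun s hs => hf2 _ ⟨s, hs, rfl⟩)
    have hfQ : ∀ z ∈ Q, f z ≤ 0 := by
      intro z hz
      have h1 : z ∈ closure (interior Q) := by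
        rw [hQc.closure_interior_eq_closure_of_nonempty_interior]
        · exact subset_closure hz
        · exact closure_nonempty_iff.1 ⟨_, hcl⟩
      have h2 : closure (interior Q) ⊆ {z | f z ≤ u} :=
        closure_minimal (fun z hz => (hf1 z hz).le) (isClosed_le f.continuous continuous_const)
      exact (h2 h1).trans hu0
    have hn0 : -n' ≠ 0 := by
      intro h0
      obtain ⟨z, hz⟩ := closure_nonempty_iff.1 ⟨_, hcl⟩
      have h1 := hf1 z hz
      have h2 := hf2 _ ⟨1, mem_Ioi.2 one_pos, rfl⟩
      rw [hn', neg_eq_zero.1 h0, dot_zero_right] at h1 h2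
      linarith
    have hN : m.IsNormal C x (-n') := by
      refine m.isNormal_of_local hC hx hn0 ?_
      filter_upwards [M.isOpen_U.mem_nhds hxU] with z hz hzC
      have h1 := hfQ _ (mem_image_of_mem _ ⟨hzC, hz⟩)
      rw [hn'] at h1
      rw [← hM, M.w_eq hz, dot_mul_left, dot_neg_right]
      exact mul_nonneg (le_of_lt hz) (by linarith)
    obtain ⟨r, hr, hr'⟩ := hs n _ hn hN
    have h1 : 0 ≤ dot h n' := by
      have h2 : Tendsto (fun s : ℝ => f ((s : ℂ) * h)) (nhdsWithin 0 (Ioi 0)) (nhds 0) := by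
        have := (f.continuous.tendsto 0).comp (tendsto_ray h)
        rwa [map_zero] at this
      have h3 : 0 ≤ u := by
        have : closure (interior Q) ⊆ {z | f z ≤ u} :=
          closure_minimal (fun z hz => (hf1 z hz).le) (isClosed_le f.continuous continuous_const)
        have := this hcl
        rwa [Set.mem_ofPred_eq, map_zero] at this
      have h4 := hf2 _ ⟨1, mem_Ioi.2 one_pos, rfl⟩
      simp only [Complex.ofReal_one, one_mul] at h4
      rw [hn'] at h4
      linarith
    have h2 : dot h (-n') = r * dot h n := by rw [hr', dot_mul_right]
    rw [dot_neg_right] at h2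
    have := mul_pos hr hh
    linarith
  obtain ⟨s₀, hs0, hs1⟩ := hex
  have hev : ∀ᶠ s : ℝ in nhdsWithin 0 (Ioi 0), (s : ℂ) * h ∈ M.dom :=
    (tendsto_ray h).eventually (M.isOpen_dom.mem_nhds M.zero_mem_dom)
  filter_upwards [hev, Ioo_mem_nhdsGT hs0] with s hsd hs
  refine hinc _ (M.ci_mem_U hsd) ?_
  rw [M.c_ci hsd]
  refine hQc.openSegment_closure_interior_subset_interior (subset_closure h0Q) hs1 ?_
  have h1 : 0 < s / s₀ := div_pos hs.1 hs0
  refine ⟨1 - s / s₀, s / s₀, ?_, h1, by ring, ?_⟩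
  · have : s / s₀ < 1 := (div_lt_one hs0).2 hs.2
    linarith
  · have : (s₀ : ℂ) ≠ 0 := Complex.ofReal_ne_zero.2 hs0.ne'
    rw [smul_zero, zero_add, Complex.real_smul]
    push_cast
    field_simp

end KModel

theorem uniqueDiametral_of {M : Set X} {o a b : X} {D : ℝ} (hD : 0 < D) (ha : a ∈ M) (hb : b ∈ M)
    (hoa : dist o a = D) (hob : dist o b = D) (hab : Btw a o b)
    (h : ∀ z ∈ M, dist o z < D ∨ z = a ∨ z = b) : UniqueDiametral M a b ∧ diam M = 2 * D := by
  have hle : ∀ z ∈ M, dist o z ≤ D := by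
    intro z hz
    rcases h z hz with h1 | rfl | rfl
    exacts [h1.le, hoa.le, hob.le]
  have hd : dist a b = 2 * D := by
    rw [← hab, dist_comm a o]; linarith
  have hle2 : ∀ z ∈ M, ∀ z' ∈ M, dist z z' ≤ 2 * D := by
    intro z hz z' hz'
    linarith [dist_triangle_left z z' o, hle z hz, hle z' hz']
  have hdiam : diam M = 2 * D := by
    refine le_antisymm (diam_le_of_forall_dist_le (by linarith) hle2) ?_
    rw [← hd]
    exact dist_le_diam_of_mem (isBounded_iff.2 ⟨2 * D, fun _ hz _ hz' => hle2 _ hz _ hz'⟩) ha hb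
  refine ⟨⟨ha, hb, ?_, by rw [hd, hdiam], ?_⟩, hdiam⟩
  · rintro rfl
    rw [dist_self] at hd
    linarith
  · intro z hz z' hz' hzz
    rw [hdiam] at hzz
    have h1 : ∀ u ∈ M, dist o u = D → u = a ∨ u = b := fun u hu h2 => by
      rcases h u hu with h3 | h3
      · exact absurd h2 h3.ne
      · exact h3
    have h2 := dist_triangle_left z z' o
    have h3 := hle z hz
    have h4 := hle z' hz'
    have h5 : z ≠ z' := by
      rintro rfl
      rw [dist_self] at hzz
      linarith
    rcases h1 z hz (by linarith) with rfl | rfl <;> rcases h1 z' hz' (by linarith) with rfl | rfl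
    · exact absurd rfl h5
    · exact Or.inl ⟨rfl, rfl⟩
    · exact Or.inr ⟨rfl, rfl⟩
    · exact absurd rfl h5

theorem convex_ball_union_poles (ρ : ℝ) : Convex ℝ {z : ℂ | ‖z‖ < |ρ| ∨ z = -ρ ∨ z = ρ} := by
  rw [convex_iff_pairwise_pos]
  intro x hx y hy hxy a b ha hb hab
  have key : ∀ z ∈ {z : ℂ | ‖z‖ < |ρ| ∨ z = -ρ ∨ z = ρ}, ‖z‖ ≤ |ρ| := by
    rintro z (h | rfl | rfl)
    · exact h.le
    · simp
    · simp
  exact Or.inl (norm_combo_lt_of_ne (key x hx) (key y hy) hxy ha hb hab)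

namespace KModel
variable (m : KModel X)

theorem exists_dist (e : ℂ) (he : ‖e‖ = 1) {D : ℝ} (hD : 0 ≤ D)
    (hS : IsSphereSpace X 2 → D < Real.pi / 2) :
    ∃ a, dist m.o a = D ∧ m.w a = ‖m.w a‖ * e ∧ a ∈ m.U := by
  have hn : ∀ r : ℝ, 0 ≤ r → ‖(r : ℂ) * e‖ = r := fun r hr => by
    rw [norm_mul, he, mul_one, Complex.norm_real, Real.norm_of_nonneg hr]
  have hq : ∀ r : ℝ, Complex.normSq ((r : ℂ) * e) = r ^ 2 := fun r => by
    rw [Complex.normSq_eq_norm_sq, norm_mul, he, mul_one, Complex.norm_real, Real.norm_eq_abs,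
      sq_abs]
  rcases m.hk with hk | hk | hk
  · have hD2 := hS (m.sph.2 hk)
    have hc : 0 < Real.cos D := Real.cos_pos_of_mem_Ioo ⟨by linarith [Real.pi_pos], hD2⟩
    obtain ⟨a, ha1, ha2⟩ := m.surj (Real.sin D * e) (Real.cos D)
      (by rw [hq, hk]; nlinarith [Real.sin_sq_add_cos_sq D]) (fun h => absurd hk h)
    refine ⟨a, ?_, ?_, ?_⟩
    · have h1 := m.cos_dist_o hk a
      rw [ha2] at h1
      exact Real.injOn_cos ⟨dist_nonneg, m.dist_le_pi hk _ _⟩ ⟨hD, by linarith⟩ h1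
    · rw [ha1, hn _ (Real.sin_nonneg_of_nonneg_of_le_pi hD (by linarith))]
    · rw [mem_U, ha2]; exact hc
  · obtain ⟨a, ha1, ha2⟩ := m.surj (D * e) 1 (by rw [hk]; ring) (fun _ => one_pos)
    rcases m.polar a with h | ⟨-, h, -⟩ | h
    · linarith [h.1]
    · refine ⟨a, ?_, ?_, ?_⟩
      · rw [← h, ha1, hn _ hD]
      · rw [ha1, hn _ hD]
      · rw [mem_U, ha2]; exact one_pos
    · linarith [h.1]
  · obtain ⟨a, ha1, ha2⟩ := m.surj (Real.sinh D * e) (Real.cosh D)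
      (by rw [hq, hk]; linarith [Real.cosh_sq D]) (fun _ => Real.cosh_pos D)
    have hs := Real.sinh_nonneg_iff.2 hD
    rcases m.polar a with h | h | ⟨-, h, -⟩
    · linarith [h.1]
    · linarith [h.1]
    · refine ⟨a, ?_, ?_, ?_⟩
      · rw [ha1, hn _ hs] at h
        exact (Real.sinh_injective h).symm
      · rw [ha1, hn _ hs]
      · rw [mem_U, ha2]; exact Real.cosh_pos D

theorem eq_of_mem_closedBall {a p z : X} (ha : a ∈ m.U) (hpo : p ≠ m.o)
    (hp : Btw m.o p a) (hz : dist z p ≤ dist a p) : dist m.o z < dist m.o a ∨ z = a := by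
  have h1 : dist m.o p + dist p a = dist m.o a := hp
  have h2 := dist_triangle m.o p z
  rw [dist_comm z p, dist_comm a p] at hz
  rcases (show dist m.o z ≤ dist m.o a by linarith).lt_or_eq with h3 | h3
  · exact Or.inl h3
  · right
    have hzU : z ∈ m.U := by
      rw [mem_U_iff, mem_ball] at ha ⊢
      rwa [dist_comm, h3, dist_comm]
    have h4 : Btw m.o p z := le_antisymm (by linarith) h2
    rw [m.btw_iff_segment m.o_mem_U ha, c_o] at hp
    rw [m.btw_iff_segment m.o_mem_U hzU, c_o] at h4
    have hc0 : m.c p ≠ 0 := fun h => hpo (m.c_inj hp.1 m.o_mem_U (by rw [h, c_o]))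
    have h5 : ‖m.c z‖ = ‖m.c a‖ :=
      le_antisymm ((m.dist_o_le_iff_norm_c hzU ha).1 h3.le) ((m.dist_o_le_iff_norm_c ha hzU).1 h3.ge)
    obtain ⟨u, v, hu, hv, huv, h6⟩ := hp.2
    obtain ⟨u', v', hu', hv', huv', h7⟩ := h4.2
    rw [smul_zero, zero_add] at h6 h7
    have h8 : v * ‖m.c a‖ = ‖m.c p‖ := by rw [← h6, norm_smul, Real.norm_of_nonneg hv]
    have h9 : v' * ‖m.c z‖ = ‖m.c p‖ := by rw [← h7, norm_smul, Real.norm_of_nonneg hv']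
    rw [h5] at h9
    have h10 : 0 < ‖m.c p‖ := norm_pos_iff.2 hc0
    have h11 : v' = v := by
      have : ‖m.c a‖ ≠ 0 := by rintro h; rw [h] at h8; linarith
      exact mul_right_cancel₀ this (h9.trans h8.symm)
    rw [← h6, h11] at h7
    have h12 : v ≠ 0 := by rintro rfl; linarith
    exact m.c_inj hzU ha (smul_right_injective ℂ h12 h7)

theorem btw_o_of_c {a b : X} {ρ : ℝ} (ha : a ∈ m.U) (hb : b ∈ m.U) (hca : m.c a = -ρ)
    (hcb : m.c b = ρ) : Btw a m.o b := by
  rw [m.btw_iff_segment ha hb, c_o, hca, hcb]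
  refine ⟨m.o_mem_U, 1 / 2, 1 / 2, by norm_num, by norm_num, by norm_num, ?_⟩
  rw [smul_neg, neg_add_cancel]

theorem im_w_of_onLine {a b z : X} {ρ : ℝ} (hρ : ρ ≠ 0) (ha : a ∈ m.U) (hb : b ∈ m.U)
    (hca : m.c a = -ρ) (hcb : m.c b = ρ) (hz : OnLine a b z) : (m.w z).im = 0 := by
  have hwa : (m.w a).im = 0 := by rw [m.w_eq ha, hca]; simp
  have hwb : (m.w b).im = 0 := by rw [m.w_eq hb, hcb]; simp
  have hab : ∀ β : ℝ, ¬ m.Comb 0 z β b a ∧ ¬ m.Comb 0 z β a b := by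
    refine fun β => ⟨fun h => ?_, fun h => ?_⟩
    · have h1 := h.linF m.linF_re
      have h2 := h.linF m.linF_t
      rw [m.w_eq ha, m.w_eq hb, hca, hcb] at h1
      simp only [zero_mul, zero_add] at h1 h2
      rw [h2] at h1
      have := mul_pos_iff.1 (h2 ▸ ha : 0 < β * m.t b)
      have hb' : 0 < m.t b := hb
      simp at h1
      have : β * m.t b * ρ = 0 := by linarith
      rcases mul_eq_zero.1 this with h4 | h4
      · have ha' : 0 < m.t a := ha
        linarith
      · exact hρ h4
    · have h1 := h.linF m.linF_re
      have h2 := h.linF m.linF_t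
      rw [m.w_eq ha, m.w_eq hb, hca, hcb] at h1
      simp only [zero_mul, zero_add] at h1 h2
      rw [h2] at h1
      simp at h1
      have : β * m.t a * ρ = 0 := by linarith
      rcases mul_eq_zero.1 this with h4 | h4
      · have hb' : 0 < m.t b := hb
        linarith
      · exact hρ h4
  rcases hz with h | h | h
  · obtain ⟨u, v, -, -, h1⟩ := (m.btw_iff_comb (m.not_antipodal ha hb)).1 h
    rw [h1.linF m.linF_im, hwa, hwb]; ring
  · by_cases h2 : m.Comb (-1) z 0 z b
    · have := h2.linF m.linF_im
      rw [hwb] at this; linarith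
    · obtain ⟨u, v, -, -, h1⟩ := (m.btw_iff_comb h2).1 h
      have h3 := h1.linF m.linF_im
      rw [hwa, hwb, mul_zero, add_zero] at h3
      rcases mul_eq_zero.1 h3.symm with rfl | h4
      · exact absurd h1 (hab v).1
      · exact h4
  · by_cases h2 : m.Comb (-1) a 0 a z
    · have := h2.linF m.linF_im
      rw [hwa] at this; linarith
    · obtain ⟨u, v, -, -, h1⟩ := (m.btw_iff_comb h2).1 h
      have h3 := h1.linF m.linF_im
      rw [hwa, hwb, mul_zero, zero_add] at h3
      rcases mul_eq_zero.1 h3.symm with rfl | h4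
      · exfalso
        refine (hab u).2 ?_
        rw [m.comb_iff_linF] at h1 ⊢
        intro l hl
        rw [h1 l hl]; ring
      · exact h4

theorem dist_le_of_foot {a z z' : X} {ρ y : ℝ} (ha : a ∈ m.U) (hz : z ∈ m.U) (hca : m.c a = -ρ)
    (hcz : m.c z = -ρ + y * Complex.I) (hz' : (m.w z').im = 0) : dist z a ≤ dist z z' := by
  rw [← m.q_le]
  have hwa := m.w_eq ha
  have hwz := m.w_eq hz
  have ha0 : 0 < m.t a := ha
  have hz0 : 0 < m.t z := hz
  have key : m.q z z' = m.q z a + m.t z / m.t a * m.q a z' := by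
    by_cases hk : m.k = 0
    · have h1 := m.t_of_zero hk
      simp only [q, hk, zero_mul, add_zero, hwa, hwz, h1, hca, hcz, Complex.normSq_apply]
      simp [hz']
      ring
    · rw [m.q_eq_B hk, m.q_eq_B hk, m.q_eq_B hk]
      have h3 : m.B z z' = m.t z / m.t a * m.B a z' := by
        simp only [B, hwa, hwz, hca, hcz, dot]
        simp [hz']
        field_simp
      have h4 : m.B z a = m.t z / m.t a := by
        have h5 := m.mem' a
        rw [eq_div_iff ha0.ne']
        rw [hwa, hca] at h5
        simp only [B, hwa, hwz, hca, hcz, dot]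
        simp at h5 ⊢
        linear_combination m.t z * h5
      rw [h3, h4]; ring
  rw [key]
  have := mul_nonneg (div_pos hz0 ha0).le (m.q_nonneg a z')
  linarith

/-- Near an endpoint of the segment, the slab bounded by the orthogonal lines at its endpoints is
contained in the cylinder. -/
theorem eventually_mem_segCyl {a b : X} {ρ : ℝ} (hρ : ρ ≠ 0) (ha : a ∈ m.U) (hb : b ∈ m.U)
    (hca : m.c a = -ρ) (hcb : m.c b = ρ) {ε : ℝ} (hε : 0 < ε) :
    ∀ᶠ z in nhds a, ‖m.c z‖ ≤ |ρ| → z ∈ segCyl a b ε := by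
  have h1 : ∀ᶠ z in nhds a, z ∈ m.U ∧ dist z a ≤ ε :=
    inter_mem (m.isOpen_U.mem_nhds ha) (closedBall_mem_nhds a hε)
  rw [← m.ci_c ha, ← m.map_ci_nhds (m.c_mem_dom ha), eventually_map] at h1
  rw [m.ci_c ha, hca] at h1
  have hd : ∀ᶠ ζ in nhds (-ρ : ℂ), ζ ∈ m.dom := by
    rw [← hca]; exact m.isOpen_dom.mem_nhds (m.c_mem_dom ha)
  have hcont : Tendsto (fun ζ : ℂ => (-ρ + (ζ.im / (-ζ.re / ρ) : ℝ) * Complex.I : ℂ)) (nhds (-ρ : ℂ))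
      (nhds (-ρ : ℂ)) := by
    have h2 : ContinuousAt (fun ζ : ℂ => (-ρ + (ζ.im / (-ζ.re / ρ) : ℝ) * Complex.I : ℂ)) (-ρ : ℂ) := by
      have : ContinuousAt (fun ζ : ℂ => ζ.im / (-ζ.re / ρ)) (-ρ : ℂ) := by
        refine ContinuousAt.div (by fun_prop) (by fun_prop) ?_
        simp [hρ]
      have h4 : ContinuousAt (fun ζ : ℂ => ((ζ.im / (-ζ.re / ρ) : ℝ) : ℂ)) (-ρ : ℂ) :=
        Complex.continuous_ofReal.continuousAt.comp this
      exact continuousAt_const.add (h4.mul continuousAt_const)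
    have h3 := h2.tendsto
    simpa using h3
  have h2 := hcont.eventually (h1.and hd)
  have hpos : ∀ᶠ ζ in nhds (-ρ : ℂ), 0 < -ζ.re / ρ := by
    have : ContinuousAt (fun ζ : ℂ => -ζ.re / ρ) (-ρ : ℂ) := by fun_prop
    refine this.eventually (lt_mem_nhds ?_)
    simp [hρ]
  have h3 := h2.and hpos
  have hca' : Tendsto m.c (nhds a) (nhds (-ρ : ℂ)) := by
    rw [← hca, ← m.map_c_nhds ha]
    exact tendsto_map
  have h3 := hca'.eventually h3
  filter_upwards [h3, m.isOpen_U.mem_nhds ha] with z ⟨⟨⟨hz2, hz3⟩, hz4⟩, hz5⟩ hz1 hz6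
  set l : ℝ := -(m.c z).re / ρ with hl
  set y : ℝ := (m.c z).im / l with hy
  have hoab := m.btw_o_of_c ha hb hca hcb
  have ho : m.o ∈ segCyl a b ε :=
    gconvexHull_gconvex _ a (subset_gconvexHull _ (Or.inl (self_mem_perpDisc _ _ hε.le))) b
      (subset_gconvexHull _ (Or.inr (self_mem_perpDisc _ _ hε.le))) _
      (m.uniqueBtwPt_of (m.not_antipodal ha hb) hoab)
  have hzy : m.ci (-ρ + y * Complex.I) ∈ segCyl a b ε := by
    refine subset_gconvexHull _ (Or.inl ⟨fun z' hz' => ?_, hz3⟩)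
    exact m.dist_le_of_foot ha hz2 hca (m.c_ci hz4) (m.im_w_of_onLine hρ ha hb hca hcb hz')
  refine gconvexHull_gconvex _ _ ho _ hzy z (m.uniqueBtwPt_of (m.not_antipodal m.o_mem_U hz2) ?_)
  rw [m.btw_iff_segment m.o_mem_U hz2, m.c_ci hz4, c_o]
  refine ⟨hz1, 1 - l, l, ?_, hz5.le, by ring, ?_⟩
  · have h7 : |(m.c z).re| ≤ |ρ| := (Complex.abs_re_le_norm _).trans hz6
    have h8 : |l| ≤ 1 := by
      rw [hl, abs_div, abs_neg]
      exact div_le_one_of_le₀ h7 (abs_nonneg _)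
    linarith [le_abs_self l]
  · rw [smul_zero, zero_add, Complex.real_smul]
    apply Complex.ext
    · simp [hl]
      field_simp
    · simp [hy]
      field_simp

end KModel

namespace KModel

/-- Two bodies `K`, `L` inside a disc around `m.o`, touching its boundary in the opposite points
`a` and `b` of the real axis only; `p` and `q` are centres of supporting discs at these points. -/
structure Placed (m : KModel X) (K L : Set X) (a p b q : X) (ρ : ℝ) : Prop where
  ne0 : ρ ≠ 0
  aU : a ∈ m.U
  bU : b ∈ m.U
  ca : m.c a = -ρ
  cb : m.c b = ρ
  ha : a ∈ K
  hb : b ∈ L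
  cK : m.IsCentre K a p
  cL : m.IsCentre L b q
  po : p ≠ m.o
  qo : q ≠ m.o
  pa : Btw m.o p a
  qb : Btw m.o q b

namespace Placed
variable {m : KModel X} {K L : Set X} {a p b q : X} {ρ : ℝ}

theorem swap (h : m.Placed K L a p b q ρ) : m.Placed L K b q a p (-ρ) where
  ne0 := neg_ne_zero.2 h.ne0
  aU := h.bU
  bU := h.aU
  ca := by rw [h.cb]; simp
  cb := by rw [h.ca]; simp
  ha := h.hb
  hb := h.ha
  cK := h.cL
  cL := h.cK
  po := h.qo
  qo := h.po
  pa := h.qb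
  qb := h.pa

theorem dist_b (h : m.Placed K L a p b q ρ) : dist m.o b = dist m.o a := by
  have h1 : ‖m.c a‖ = ‖m.c b‖ := by rw [h.ca, h.cb, norm_neg]
  exact le_antisymm ((m.dist_o_le_iff_norm_c h.bU h.aU).2 h1.ge)
    ((m.dist_o_le_iff_norm_c h.aU h.bU).2 h1.le)

theorem lt_K (h : m.Placed K L a p b q ρ) {z : X} (hz : z ∈ K) :
    dist m.o z < dist m.o a ∨ z = a :=
  m.eq_of_mem_closedBall h.aU h.po h.pa (h.cK.2.2 hz)

theorem lt_L (h : m.Placed K L a p b q ρ) {z : X} (hz : z ∈ L) :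
    dist m.o z < dist m.o a ∨ z = b := by
  rw [← h.dist_b]
  exact m.eq_of_mem_closedBall h.bU h.qo h.qb (h.cL.2.2 hz)

theorem subset_ball (h : m.Placed K L a p b q ρ) : K ∪ L ⊆ closedBall m.o (dist m.o a) := by
  rintro z (hz | hz)
  · rw [mem_closedBall, dist_comm]
    rcases h.lt_K hz with h1 | rfl
    exacts [h1.le, le_rfl]
  · rw [mem_closedBall, dist_comm]
    rcases h.lt_L hz with h1 | rfl
    exacts [h1.le, h.dist_b.le]

theorem subset_U (h : m.Placed K L a p b q ρ) : K ∪ L ⊆ m.U := by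
  intro z hz
  have h1 := h.subset_ball hz
  have h2 := h.aU
  rw [mem_U_iff, mem_ball, dist_comm] at h2
  rw [mem_U_iff, mem_ball]
  exact fun hS => lt_of_le_of_lt h1 (h2 hS)

theorem hull_subset_U (h : m.Placed K L a p b q ρ) : gconvexHull (K ∪ L) ⊆ m.U := by
  rw [m.gconvexHull_eq h.subset_U]
  exact fun z hz => hz.1

theorem norm_c_lt (h : m.Placed K L a p b q ρ) {z : X} (hz : z ∈ m.U) :
    dist m.o z < dist m.o a ↔ ‖m.c z‖ < |ρ| := by
  rw [m.dist_o_lt_iff_norm_c hz h.aU, h.ca, norm_neg, Complex.norm_real,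
    Real.norm_eq_abs]

theorem lt_hull (h : m.Placed K L a p b q ρ) {z : X} (hz : z ∈ gconvexHull (K ∪ L)) :
    dist m.o z < dist m.o a ∨ z = a ∨ z = b := by
  have hzU := h.hull_subset_U hz
  rw [m.gconvexHull_eq h.subset_U] at hz
  have h1 : m.c '' (K ∪ L) ⊆ {z : ℂ | ‖z‖ < |ρ| ∨ z = -ρ ∨ z = ρ} := by
    rintro _ ⟨u, hu, rfl⟩
    rw [Set.mem_ofPred_eq, ← h.norm_c_lt (h.subset_U hu), ← h.ca, ← h.cb]
    rcases hu with hu | hu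
    · rcases h.lt_K hu with h2 | rfl
      · exact Or.inl h2
      · exact Or.inr (Or.inl rfl)
    · rcases h.lt_L hu with h2 | rfl
      · exact Or.inl h2
      · exact Or.inr (Or.inr rfl)
  rcases convexHull_min h1 (convex_ball_union_poles ρ) hz.2 with h2 | h2 | h2
  · exact Or.inl ((h.norm_c_lt hzU).2 h2)
  · exact Or.inr (Or.inl (m.c_inj hzU h.aU (h2.trans h.ca.symm)))
  · exact Or.inr (Or.inr (m.c_inj hzU h.bU (h2.trans h.cb.symm)))

theorem ne (h : m.Placed K L a p b q ρ) : a ≠ b := by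
  rintro rfl
  have h1 := h.ca.symm.trans h.cb
  have h2 : -ρ = ρ := by exact_mod_cast h1
  exact h.ne0 (by linarith)

theorem dist_pos (h : m.Placed K L a p b q ρ) : 0 < dist m.o a := by
  rw [_root_.dist_pos]
  rintro h1
  have h2 := h.ca
  rw [← h1, c_o] at h2
  have h3 : (0 : ℝ) = -ρ := by exact_mod_cast h2
  exact h.ne0 (by linarith)

theorem mem_a (h : m.Placed K L a p b q ρ) : a ∈ gconvexHull (K ∪ L) :=
  subset_gconvexHull _ (Or.inl h.ha)

theorem mem_b (h : m.Placed K L a p b q ρ) : b ∈ gconvexHull (K ∪ L) :=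
  subset_gconvexHull _ (Or.inr h.hb)

theorem btw (h : m.Placed K L a p b q ρ) : Btw a m.o b := m.btw_o_of_c h.aU h.bU h.ca h.cb

theorem diametral (h : m.Placed K L a p b q ρ) {M : Set X} (ha : a ∈ M) (hb : b ∈ M)
    (hM : M ⊆ gconvexHull (K ∪ L)) : UniqueDiametral M a b ∧ diam M = 2 * dist m.o a :=
  uniqueDiametral_of h.dist_pos ha hb rfl h.dist_b h.btw fun _ hz => h.lt_hull (hM hz)

theorem eventually_cyl (h : m.Placed K L a p b q ρ) {ε : ℝ} (hε : 0 < ε) :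
    (∀ᶠ z in nhds a, z ∈ gconvexHull (K ∪ L) → z ∈ segCyl a b ε) ∧
    ∀ᶠ z in nhds b, z ∈ gconvexHull (K ∪ L) → z ∈ segCyl a b ε := by
  have key : ∀ z ∈ gconvexHull (K ∪ L), ‖m.c z‖ ≤ |ρ| := by
    intro z hz
    rcases h.lt_hull hz with h1 | rfl | rfl
    · exact ((h.norm_c_lt (h.hull_subset_U hz)).1 h1).le
    · rw [h.ca, norm_neg, Complex.norm_real, Real.norm_eq_abs]
    · rw [h.cb, Complex.norm_real, Real.norm_eq_abs]
  constructor
  · filter_upwards [m.eventually_mem_segCyl h.ne0 h.aU h.bU h.ca h.cb hε] with z hz hzM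
    exact hz (key z hzM)
  · rw [segCyl_comm]
    filter_upwards [m.eventually_mem_segCyl (ρ := -ρ) (neg_ne_zero.2 h.ne0) h.bU h.aU
      (by rw [h.cb]; simp) (by rw [h.ca]; simp) hε] with z hz hzM
    exact hz ((key z hzM).trans (abs_neg ρ).ge)

/-- The isometry provided by the sixth condition. -/
structure Symm (m : KModel X) (K L : Set X) (a b : X) (f : X ≃ᵢ X) : Prop where
  ne : f ≠ IsometryEquiv.refl X
  fo : f m.o = m.o
  fab : (f a = a ∧ f b = b) ∨ (f a = b ∧ f b = a)
  at_a : ∀ᶠ z in nhds a, z ∈ gconvexHull (K ∪ L) ↔ f z ∈ gconvexHull (K ∪ L)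
  at_b : ∀ᶠ z in nhds b, z ∈ gconvexHull (K ∪ L) ↔ f z ∈ gconvexHull (K ∪ L)

theorem symm_of_admits (h : m.Placed K L a p b q ρ) {ε : ℝ} (hε : 0 < ε)
    (h6 : AdmitsNontrivialCongruence (gconvexHull (K ∪ L) ∩ segCyl a b ε)) :
    ∃ f, Symm m K L a b f := by
  obtain ⟨f, hf, hfM⟩ := h6
  obtain ⟨hca, hcb⟩ := h.eventually_cyl hε
  have haM := hca.self_of_nhds h.mem_a
  have hbM := hcb.self_of_nhds h.mem_b
  have hfab := (h.diametral (M := gconvexHull (K ∪ L) ∩ segCyl a b ε) ⟨h.mem_a, haM⟩ ⟨h.mem_b, hbM⟩ inter_subset_left).1.map_eq hfM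
  have huniq := m.uniqueBtwPt_of (m.not_antipodal h.aU h.bU) h.btw
  have hfo : f m.o = m.o := by
    have hd : dist a m.o = dist b m.o := by rw [dist_comm, ← h.dist_b, dist_comm]
    have h1 : Btw (f a) (f m.o) (f b) := (btw_map f).2 h.btw
    rcases hfab with ⟨h2, h3⟩ | ⟨h2, h3⟩
    · refine huniq.2 _ (by rwa [h2, h3] at h1) ?_
      conv_lhs => rw [← h2]
      exact f.dist_eq _ _
    · rw [h2, h3] at h1
      refine huniq.2 _ ?_ ?_
      · have : dist b (f m.o) + dist (f m.o) a = dist b a := h1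
        rw [Btw, dist_comm a, dist_comm _ b, dist_comm a b]
        linarith
      · conv_lhs => rw [← h3]
        rw [f.dist_eq, hd]
  have key : ∀ u v, f u = v → (∀ᶠ z in nhds u, z ∈ gconvexHull (K ∪ L) → z ∈ segCyl a b ε) →
      (∀ᶠ z in nhds v, z ∈ gconvexHull (K ∪ L) → z ∈ segCyl a b ε) →
      ∀ᶠ z in nhds u, z ∈ gconvexHull (K ∪ L) ↔ f z ∈ gconvexHull (K ∪ L) := by
    intro u v huv hu hv
    rw [← huv] at hv
    filter_upwards [hu, f.continuous.continuousAt.eventually hv] with z hz hz'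
    constructor
    · intro h1
      have : f z ∈ f '' (gconvexHull (K ∪ L) ∩ segCyl a b ε) := mem_image_of_mem f ⟨h1, hz h1⟩
      rw [hfM] at this
      exact this.1
    · intro h1
      have : f z ∈ f '' (gconvexHull (K ∪ L) ∩ segCyl a b ε) := by rw [hfM]; exact ⟨h1, hz' h1⟩
      exact ((f.injective.mem_set_image).1 this).1
  refine ⟨f, hf, hfo, hfab, ?_, ?_⟩
  · rcases hfab with ⟨h2, -⟩ | ⟨h2, -⟩
    exacts [key _ _ h2 hca hca, key _ _ h2 hca hcb]
  · rcases hfab with ⟨-, h2⟩ | ⟨-, h2⟩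
    exacts [key _ _ h2 hcb hcb, key _ _ h2 hcb hca]

end Placed

variable (m : KModel X)

/-- Placing a pair consisting of a boundary point and a centre on a ray from the origin. -/
theorem exists_place {e : ℂ} (he : ‖e‖ = 1) {x p : X} (hpx : p ≠ x) {D : ℝ} (hD : dist x p < D)
    (hS : IsSphereSpace X 2 → D < Real.pi / 2) :
    ∃ f : X ≃ᵢ X, OrientationPreserving f ∧ f x ∈ m.U ∧ dist m.o (f x) = D ∧
      m.c (f x) = ‖m.c (f x)‖ * e ∧ f p ≠ m.o ∧ Btw m.o (f p) (f x) := by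
  have h0 : 0 < dist x p := by rw [_root_.dist_pos]; exact hpx.symm
  obtain ⟨a, ha, hwa, haU⟩ := m.exists_dist e he (h0.le.trans hD.le) hS
  obtain ⟨p', hp, hwp, hpU⟩ := m.exists_dist e he (D := D - dist x p) (by linarith)
    (fun h => by linarith [hS h])
  have hd : dist a p' = dist x p := by
    rw [m.dist_of_ray, ha, hp, abs_of_nonneg] <;> [ring; linarith; skip]
    rw [hwa, hwp, dot_mul_left, dot_mul_right, dot_self, he]
    simp [he]
  obtain ⟨f, hf, hfx, hfp⟩ := m.exists_orientationPreserving hd.symm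
  refine ⟨f, hf, ?_, ?_, ?_, ?_, ?_⟩
  · rwa [hfx]
  · rw [hfx, ha]
  · rw [hfx]
    have : (0 : ℝ) ≤ (m.t a)⁻¹ := inv_nonneg.2 (le_of_lt haU)
    rw [c, norm_mul, Complex.norm_real, Real.norm_of_nonneg this]
    conv_lhs => rw [hwa]
    push_cast
    ring
  · rw [hfp]
    rintro rfl
    rw [dist_self] at hp
    linarith
  · rw [hfx, hfp, Btw, dist_comm p' a, hd, ha, hp]
    ring

/-- The configurations to which the sixth condition applies. -/
theorem exists_config {K L : Set X} (hK : Body K) (hL : Body L) (h6 : T8Cond6 K L) :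
    ∃ D₀, (IsSphereSpace X 2 → D₀ < Real.pi / 2) ∧ ∀ x ∈ frontier K, ∀ p, m.IsCentre K x p →
      ∀ y ∈ frontier L, ∀ q, m.IsCentre L y q → ∀ D, D₀ < D → dist x p < D → dist y q < D →
      (IsSphereSpace X 2 → D < Real.pi / 2) → ∃ (φ ψ f : X ≃ᵢ X) (ρ : ℝ),
        m.Placed (φ '' K) (ψ '' L) (φ x) (φ p) (ψ y) (ψ q) ρ ∧ dist m.o (φ x) = D ∧
        Placed.Symm m (φ '' K) (ψ '' L) (φ x) (ψ y) f := by
  obtain ⟨δ, hδ, h6⟩ := h6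
  obtain ⟨D₀, hD0, hD1⟩ : ∃ D₀, (IsSphereSpace X 2 → D₀ < Real.pi / 2) ∧
      ∀ D, D₀ < D → (IsSphereSpace X 2 → Real.pi - δ < 2 * D) ∧
        (¬ IsSphereSpace X 2 → 1 / δ < 2 * D) := by
    by_cases hS : IsSphereSpace X 2
    · exact ⟨Real.pi / 2 - δ / 2, fun _ => by linarith,
        fun D hD => ⟨fun _ => by linarith, fun h => absurd hS h⟩⟩
    · exact ⟨1 / δ / 2, fun h => absurd h hS,
        fun D hD => ⟨fun h => absurd h hS, fun _ => by linarith⟩⟩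
  refine ⟨D₀, hD0, fun x hx p hp y hy q hq D hD hxD hyD hSD => ?_⟩
  obtain ⟨φ, hφ, h1, h2, h3, h4, h5⟩ := m.exists_place (e := -1) (by simp) hp.1 hxD hSD
  obtain ⟨ψ, hψ, g1, g2, g3, g4, g5⟩ := m.exists_place (e := 1) (by simp) hq.1 hyD hSD
  have hρ : ‖m.c (φ x)‖ = ‖m.c (ψ y)‖ :=
    le_antisymm ((m.dist_o_le_iff_norm_c h1 g1).1 (h2.trans g2.symm).le)
      ((m.dist_o_le_iff_norm_c g1 h1).1 (g2.trans h2.symm).le)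
  have hP : m.Placed (φ '' K) (ψ '' L) (φ x) (φ p) (ψ y) (ψ q) ‖m.c (φ x)‖ := by
    refine ⟨?_, h1, g1, ?_, ?_, mem_image_of_mem _ (hK.closed.frontier_subset hx),
      mem_image_of_mem _ (hL.closed.frontier_subset hy), hp.image φ, hq.image ψ, h4, g4, h5, g5⟩
    · rw [norm_ne_zero_iff]
      intro h0
      have : φ x = m.o := m.c_inj h1 m.o_mem_U (by rw [h0, c_o])
      rw [this, dist_self] at h2
      linarith [dist_nonneg (x := x) (y := p)]
    · conv_lhs => rw [h3]
      ring
    · conv_lhs => rw [g3]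
      rw [hρ]
      ring
  obtain ⟨hM, hdiam⟩ := hP.diametral hP.mem_a hP.mem_b Subset.rfl
  obtain ⟨ε₀, hε, h7⟩ := h6 φ ψ ⟨hφ, hψ, fun hS => ⟨m.o, hP.subset_ball.trans
    (closedBall_subset_ball (by rw [h2]; exact hSD hS))⟩⟩ x hx y hy
    (by rw [BigDiam, hullUnion, hdiam, h2]; exact hD1 D hD) hM
  obtain ⟨f, hf⟩ := hP.symm_of_admits (half_pos hε) (h7 _ (half_pos hε) (half_lt_self hε)).2
  exact ⟨φ, ψ, f, _, hP, h2, hf⟩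

end KModel

/-- Near a point `a` of `P`, the convex hull of `P ∪ Q` agrees with `P`, if all points of `Q` are
seen from `a` through the interior of `P`. -/
theorem eventually_mem_of_convexHull {P Q : Set ℂ} (hP : Convex ℝ P) (hQ : Convex ℝ Q)
    (hQc : IsCompact Q) {a n : ℂ} (ha : a ∈ P) (hPn : ∀ z ∈ P, 0 ≤ dot (z - a) n)
    (hQn : ∀ z ∈ Q, 0 < dot (z - a) n)
    (hQP : ∀ z ∈ Q, ∃ t : ℝ, 0 < t ∧ t ≤ 1 ∧ a + t • (z - a) ∈ interior P) :
    ∀ᶠ z in nhds a, z ∈ convexHull ℝ (P ∪ Q) → z ∈ P := by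
  rcases Q.eq_empty_or_nonempty with rfl | hne
  · rw [union_empty, hP.convexHull_eq]
    exact Eventually.of_forall fun z hz => hz
  have hstar : ∀ z : ℂ, ∀ t s : ℝ, 0 < s → s ≤ t → a + t • (z - a) ∈ interior P →
      a + s • (z - a) ∈ interior P := by
    intro z t s hs hst ht
    rcases hst.lt_or_eq with hst | rfl
    · refine hP.openSegment_closure_interior_subset_interior (subset_closure ha) ht
        ⟨1 - s / t, s / t, ?_, div_pos hs (hs.trans hst), by ring, ?_⟩
      · have := (div_lt_one (hs.trans hst)).2 hst
        linarith
      · rw [smul_add, smul_smul, div_mul_cancel₀ _ (hs.trans hst).ne', ← add_assoc, ← add_smul,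
          sub_add_cancel, one_smul]
    · exact ht
  obtain ⟨t, ht0, ht1, ht⟩ : ∃ t : ℝ, 0 < t ∧ t ≤ 1 ∧ ∀ z ∈ Q, a + t • (z - a) ∈ interior P := by
    refine hQc.induction_on (p := fun s => ∃ t : ℝ, 0 < t ∧ t ≤ 1 ∧
      ∀ z ∈ s, a + t • (z - a) ∈ interior P) ⟨1, one_pos, le_rfl, fun _ h => h.elim⟩ ?_ ?_ ?_
    · rintro s s' hs ⟨t, h1, h2, h3⟩
      exact ⟨t, h1, h2, fun z hz => h3 z (hs hz)⟩
    · rintro s s' ⟨t, h1, h2, h3⟩ ⟨t', h1', h2', h3'⟩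
      refine ⟨min t t', lt_min h1 h1', (min_le_left _ _).trans h2, ?_⟩
      rintro z (hz | hz)
      · exact hstar z t _ (lt_min h1 h1') (min_le_left _ _) (h3 z hz)
      · exact hstar z t' _ (lt_min h1 h1') (min_le_right _ _) (h3' z hz)
    · intro z hz
      obtain ⟨t, h1, h2, h3⟩ := hQP z hz
      have hc : ContinuousAt (fun z : ℂ => a + t • (z - a)) z := by fun_prop
      exact ⟨_, mem_nhdsWithin_of_mem_nhds (hc.preimage_mem_nhds (isOpen_interior.mem_nhds h3)),
        t, h1, h2, fun _ h => h⟩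
  have hK : IsCompact ((fun z : ℂ => a + t • (z - a)) '' Q) :=
    hQc.image (by fun_prop)
  obtain ⟨η, hη, hthick⟩ := hK.exists_thickening_subset_open isOpen_interior
    (image_subset_iff.2 ht)
  obtain ⟨z₀, hz₀, hmin⟩ := hQc.exists_isMinOn hne
    (f := fun z => dot (z - a) n) (by unfold dot; fun_prop)
  set κ := dot (z₀ - a) n with hκ
  have hκ0 : 0 < κ := hQn z₀ hz₀
  obtain ⟨C, hC⟩ := hQc.isBounded.exists_norm_le
  set C' := C + ‖a‖ with hC'
  have hC0 : 0 ≤ C' := add_nonneg ((norm_nonneg _).trans (hC z₀ hz₀)) (norm_nonneg _)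
  have e1 : ∀ᶠ z in nhds a, dot (z - a) n < κ * min t (1 / 2) := by
    have : Continuous fun z => dot (z - a) n := by unfold dot; fun_prop
    refine this.continuousAt.eventually (gt_mem_nhds ?_)
    show dot (a - a) n < _
    rw [sub_self, dot_zero_left]
    exact mul_pos hκ0 (lt_min ht0 (by norm_num))
  have e2 : ∀ᶠ z in nhds a, 2 * (‖z - a‖ + dot (z - a) n / κ * C') < η := by
    have : Continuous fun z => 2 * (‖z - a‖ + dot (z - a) n / κ * C') := by
      unfold dot; fun_prop
    refine this.continuousAt.eventually (gt_mem_nhds ?_)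
    simpa [dot_zero_left] using hη
  filter_upwards [e1, e2] with z h1 h2 hz
  rw [hP.convexHull_union hQ ⟨a, ha⟩ hne, mem_convexJoin] at hz
  obtain ⟨p, hp, q, hq, u, v, hu, hv, huv, rfl⟩ := hz
  have hu' : u = 1 - v := by linarith
  subst hu'
  have h3 : dot ((1 - v) • p + v • q - a) n = (1 - v) * dot (p - a) n + v * dot (q - a) n := by
    rw [← dot_mul_left, ← dot_mul_left, ← dot_add_left]
    congr 1
    simp only [Complex.real_smul]
    push_cast
    ring
  have hqκ : κ ≤ dot (q - a) n := hmin hq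
  have hvκ : v * κ ≤ dot ((1 - v) • p + v • q - a) n := by
    rw [h3]
    have := mul_nonneg hu (hPn p hp)
    have := mul_le_mul_of_nonneg_left hqκ hv
    linarith
  have hvm : v < min t (1 / 2) := by
    have := hvκ.trans_lt h1
    rw [mul_comm] at this
    exact lt_of_mul_lt_mul_left this hκ0.le
  have hvt : v < t := hvm.trans_le (min_le_left _ _)
  have hv2 : v < 1 / 2 := hvm.trans_le (min_le_right _ _)
  have hpa : ‖p - a‖ < η := by
    have h4 : (1 - v) • (p - a) = ((1 - v) • p + v • q - a) - v • (q - a) := by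
      simp only [Complex.real_smul]
      push_cast
      ring
    have h5 : (1 - v) * ‖p - a‖ ≤ ‖(1 - v) • p + v • q - a‖ + v * C' := by
      have h5 : (1 - v) * ‖p - a‖ = ‖(1 - v) • (p - a)‖ := by
        rw [norm_smul, Real.norm_of_nonneg hu]
      rw [h5, h4]
      refine (norm_sub_le _ _).trans (add_le_add le_rfl ?_)
      rw [norm_smul, Real.norm_of_nonneg hv]
      exact mul_le_mul_of_nonneg_left ((norm_sub_le _ _).trans (by linarith [hC q hq])) hv
    have h6 : v * C' ≤ dot ((1 - v) • p + v • q - a) n / κ * C' :=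
      mul_le_mul_of_nonneg_right ((le_div_iff₀ hκ0).2 hvκ) hC0
    nlinarith [norm_nonneg (p - a)]
  have hr : p + t • (q - p) ∈ P := by
    refine interior_subset (hthick (mem_thickening_iff.2 ⟨_, mem_image_of_mem _ hq, ?_⟩))
    have h4 : p + t • (q - p) - (a + t • (q - a)) = (1 - t) • (p - a) := by
      simp only [Complex.real_smul]
      push_cast
      ring
    rw [dist_eq_norm, h4, norm_smul, Real.norm_of_nonneg (by linarith)]
    exact lt_of_le_of_lt (mul_le_of_le_one_left (norm_nonneg _) (by linarith)) hpa
  have hfin : (1 - v) • p + v • q = (1 - v / t) • p + (v / t) • (p + t • (q - p)) := by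
    have : (t : ℂ) ≠ 0 := Complex.ofReal_ne_zero.2 ht0.ne'
    simp only [Complex.real_smul]
    push_cast
    field_simp
    ring
  rw [hfin]
  exact hP hp hr (by rw [sub_nonneg, div_le_one ht0]; exact hvt.le) (div_nonneg hv ht0.le) (by ring)

namespace KModel
namespace Placed
variable {m : KModel X} {K L : Set X} {a p b q : X} {ρ : ℝ}

theorem isCentre_o (h : m.Placed K L a p b q ρ) {A : Set X} (hA : A ⊆ K ∪ L) :
    m.IsCentre A a m.o := by
  refine ⟨fun h0 => ?_, ?_, ?_⟩
  · have := h.dist_pos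
    rw [h0, dist_self] at this
    exact this.false
  · have := h.aU
    rw [mem_U_iff, mem_ball] at this
    rw [mem_cen_U, dist_comm]
    exact this
  · rw [dist_comm]
    exact hA.trans h.subset_ball

theorem a_notMem (h : m.Placed K L a p b q ρ) : a ∉ L := by
  intro h1
  rcases h.lt_L h1 with h2 | h2
  · exact h2.false
  · exact h.ne h2

/-- The part of the second body is seen from `a` under positive scalar product. -/
theorem dot_pos (h : m.Placed K L a p b q ρ) {z : X} (hz : z ∈ K ∪ L) (hza : z ≠ a) :
    0 < dot ((m.cen a).w z) ((m.cen a).c m.o) := by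
  have h1 := (h.isCentre_o (A := K ∪ L) Subset.rfl).le hz
  have h2 := (m.cen a).q_pos hza.symm
  linarith

theorem exists_interior (h : m.Placed K L a p b q ρ) (hK : Body K) (hs : m.SmoothAt K a) {z : X}
    (hz : z ∈ L) : ∃ t : ℝ, 0 < t ∧ t ≤ 1 ∧ m.c a + t • (m.c z - m.c a) ∈ interior (m.c '' K) := by
  have hza : z ≠ a := fun h0 => h.a_notMem (h0 ▸ hz)
  have hn := (h.isCentre_o (A := K) subset_union_left).isNormal
  have hd := h.dot_pos (Or.inr hz) hza
  have hev := hs.inward hK h.ha hn hd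
  set M := m.cen a with hM
  have h1 : ∀ᶠ s : ℝ in nhdsWithin 0 (Ioi 0), (s : ℂ) * M.w z ∈ M.dom :=
    (tendsto_ray _).eventually (M.isOpen_dom.mem_nhds M.zero_mem_dom)
  have h2 : ∀ᶠ s : ℝ in nhdsWithin 0 (Ioi 0), s * M.t z < 1 := by
    have : Continuous fun s : ℝ => s * M.t z := by fun_prop
    exact (this.continuousAt.eventually (gt_mem_nhds (by simp))).filter_mono nhdsWithin_le_nhds
  obtain ⟨s, ⟨⟨hs1, hs2⟩, hs3⟩, hs0⟩ := (((hev.and h1).and h2).and eventually_mem_nhdsWithin).exists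
  have hs0 : 0 < s := hs0
  set u := M.ci (s * M.w z) with hu
  have huU : u ∈ M.U := M.ci_mem_U hs2
  have hu0 : 0 < M.t u := huU
  have hcomb : M.Comb (M.t u * (1 - s * M.t z)) a (M.t u * s) z u := by
    refine ⟨?_, ?_⟩
    · rw [M.w_eq huU, M.c_ci hs2, m.cen_w_self]
      push_cast
      ring
    · rw [m.cen_t_self]
      ring
  rw [m.cen_comb] at hcomb
  have hzU : z ∈ m.U := h.subset_U (Or.inr hz)
  have hbtw : Btw a u z := (m.btw_iff_comb (m.not_antipodal h.aU hzU)).2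
    ⟨_, _, mul_nonneg hu0.le (by linarith), mul_nonneg hu0.le hs0.le, hcomb⟩
  obtain ⟨-, α, β, hα, hβ, hαβ, hc⟩ := (m.btw_iff_segment h.aU hzU).1 hbtw
  have hcu : m.c u = m.c a + β • (m.c z - m.c a) := by
    have hα' : α = 1 - β := by linarith
    rw [← hc, hα']
    simp only [Complex.real_smul]
    push_cast
    ring
  refine ⟨β, lt_of_le_of_ne hβ ?_, by linarith, ?_⟩
  · rintro rfl
    rw [zero_smul, add_zero] at hcu
    have h3 : u = a := m.c_inj (h.subset_U (Or.inl (interior_subset hs1))) h.aU hcu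
    have h4 : M.c u = 0 := by rw [h3]; exact m.cen_c_self a
    rw [M.c_ci hs2, mul_eq_zero] at h4
    rcases h4 with h4 | h4
    · exact hs0.ne' (Complex.ofReal_eq_zero.1 h4)
    · rw [h4, dot_zero_left] at hd
      exact hd.false
  · rw [← hcu, (m.image_c hK (subset_union_left.trans h.subset_U)).2.2]
    exact mem_image_of_mem _ hs1

/-- At a smooth point the first body determines the shape of the convex hull. -/
theorem eventually_hull_iff (h : m.Placed K L a p b q ρ) (hK : Body K) (hL : Body L)
    (hs : m.SmoothAt K a) : ∀ᶠ z in nhds a, z ∈ gconvexHull (K ∪ L) ↔ z ∈ K := by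
  have hKU : K ⊆ m.U := subset_union_left.trans h.subset_U
  have hLU : L ⊆ m.U := subset_union_right.trans h.subset_U
  obtain ⟨hK1, hK2, hK3⟩ := m.image_c hK hKU
  obtain ⟨hL1, hL2, hL3⟩ := m.image_c hL hLU
  have hre : ∀ z : X, z ∈ K ∪ L → z ≠ a → 0 < dot (m.c z - m.c a) (ρ : ℂ) := by
    intro z hz hza
    have h1 : ‖m.c z‖ ≤ |ρ| := by
      rcases h.lt_hull (subset_gconvexHull _ hz) with h1 | rfl | rfl
      · exact ((h.norm_c_lt (h.subset_U hz)).1 h1).le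
      · rw [h.ca, norm_neg, Complex.norm_real, Real.norm_eq_abs]
      · rw [h.cb, Complex.norm_real, Real.norm_eq_abs]
    have h2 : m.c z ≠ -ρ := fun h0 => hza (m.c_inj (h.subset_U hz) h.aU (h0.trans h.ca.symm))
    have h3 : (m.c z).re ^ 2 + (m.c z).im ^ 2 ≤ ρ ^ 2 := by
      have h4 := mul_self_le_mul_self (norm_nonneg _) h1
      rw [Complex.norm_mul_self_eq_normSq, Complex.normSq_apply, abs_mul_abs_self] at h4
      linarith
    rw [h.ca, sub_neg_eq_add]
    simp only [dot, Complex.add_re, Complex.ofReal_re, Complex.add_im, Complex.ofReal_im,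
      mul_zero, add_zero]
    by_contra! h5
    apply h2
    have h6 : (m.c z).re + ρ = 0 := by
      have := sq_nonneg (m.c z).im
      have h8 : ((m.c z).re + ρ) ^ 2 ≤ 0 := by nlinarith
      exact pow_eq_zero_iff two_ne_zero |>.1 (le_antisymm h8 (sq_nonneg _))
    have h7 : (m.c z).im = 0 := by
      have h8 : (m.c z).re = -ρ := by linarith
      rw [h8] at h3
      nlinarith
    apply Complex.ext
    · simp; linarith
    · simp [h7]
  have key := eventually_mem_of_convexHull hK2 hL2 hL1 (a := m.c a) (n := ρ)
    (mem_image_of_mem _ h.ha) (by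
      rintro _ ⟨z, hz, rfl⟩
      by_cases hza : z = a
      · rw [hza, sub_self, dot_zero_left]
      · exact (hre z (Or.inl hz) hza).le) (by
      rintro _ ⟨z, hz, rfl⟩
      exact hre z (Or.inr hz) fun h0 => h.a_notMem (h0 ▸ hz)) (by
      rintro _ ⟨z, hz, rfl⟩
      exact h.exists_interior hK hs hz)
  rw [← m.map_c_nhds h.aU, eventually_map] at key
  filter_upwards [key, m.isOpen_U.mem_nhds h.aU] with z hz hzU
  refine ⟨fun h1 => ?_, fun h1 => subset_gconvexHull _ (Or.inl h1)⟩
  rw [m.gconvexHull_eq h.subset_U] at h1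
  have h2 := h1.2
  rw [image_union] at h2
  exact (m.mem_image_c hKU hzU).1 (hz h2)

end Placed
end KModel

/-- `C` has a non-trivial local symmetry at `x`. -/
def SymAt (C : Set X) (x : X) : Prop :=
  ∃ σ : X ≃ᵢ X, σ ≠ IsometryEquiv.refl X ∧ σ x = x ∧ ∀ᶠ z in nhds x, z ∈ C ↔ σ z ∈ C

/-- `K` at `x` is locally congruent to `L` at `y`. -/
def CongAt (K L : Set X) (x y : X) : Prop :=
  ∃ g : X ≃ᵢ X, g x = y ∧ ∀ᶠ z in nhds x, z ∈ K ↔ g z ∈ L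

theorem CongAt.symm {K L : Set X} {x y : X} (h : CongAt K L x y) : CongAt L K y x := by
  obtain ⟨g, rfl, h⟩ := h
  refine ⟨g.symm, g.symm_apply_apply x, ?_⟩
  have h1 : Tendsto g.symm (nhds (g x)) (nhds x) := by
    have := g.symm.continuous.tendsto (g x)
    rwa [g.symm_apply_apply] at this
  filter_upwards [h1.eventually h] with z hz
  rw [hz, g.apply_symm_apply]

theorem CongAt.trans {K L M : Set X} {x y z : X} (h : CongAt K L x y) (h' : CongAt L M y z) :
    CongAt K M x z := by
  obtain ⟨g, rfl, h⟩ := h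
  obtain ⟨g', rfl, h'⟩ := h'
  refine ⟨g.trans g', rfl, ?_⟩
  filter_upwards [h, g.continuous.continuousAt.eventually h'] with u h1 h2
  rw [h1, h2]
  rfl

theorem SymAt.of_congAt {K L : Set X} {x y : X} (h : CongAt K L x y) (hs : SymAt L y) :
    SymAt K x := by
  obtain ⟨σ, h1, h2, h3⟩ := hs
  obtain ⟨g, rfl, h⟩ := h
  refine ⟨(g.trans σ).trans g.symm, fun h0 => h1 ?_, ?_, ?_⟩
  · ext z
    have h4 := congrArg (fun f : X ≃ᵢ X => f (g.symm z)) h0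
    have h5 : g.symm (σ (g (g.symm z))) = g.symm z := h4
    rw [g.apply_symm_apply] at h5
    exact g.symm.injective h5
  · show g.symm (σ (g x)) = x
    rw [h2, g.symm_apply_apply]
  · have h4 : Tendsto (fun z => g.symm (σ (g z))) (nhds x) (nhds x) := by
      have := ((g.symm.continuous.comp (σ.continuous.comp g.continuous))).tendsto x
      simpa [Function.comp_def, h2, g.symm_apply_apply] using this
    filter_upwards [h, g.continuous.continuousAt.eventually h3, h4.eventually h] with z e1 e2 e3
    rw [e1, e2, show ((g.trans σ).trans g.symm) z = g.symm (σ (g z)) from rfl, e3,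
      g.apply_symm_apply]

namespace KModel

theorem exists_radius {S : Prop} {M : ℝ} (h : S → M < Real.pi / 2) :
    ∃ D, M < D ∧ (S → D < Real.pi / 2) := by
  by_cases hS : S
  · obtain ⟨D, h1, h2⟩ := exists_between (h hS)
    exact ⟨D, h1, fun _ => h2⟩
  · exact ⟨M + 1, by linarith, fun h => absurd h hS⟩

variable (m : KModel X)

theorem IsCentre.dist_lt {m : KModel X} {C : Set X} {x p : X} (h : m.IsCentre C x p)
    (hS : IsSphereSpace X 2) : dist x p < Real.pi / 2 := by
  rw [dist_comm]
  exact m.mem_cen_U.1 h.2.1 hS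

/-- The local consequence of the symmetry condition at pairs of smooth points. -/
theorem sym_or_cong {K L : Set X} (hK : Body K) (hL : Body L) (h6 : T8Cond6 K L)
    {x y : X} (hx : x ∈ frontier K) (hy : y ∈ frontier L) (hsx : m.SmoothAt K x)
    (hsy : m.SmoothAt L y) : (SymAt K x ∧ SymAt L y) ∨ CongAt K L x y := by
  obtain ⟨p, hp⟩ := m.exists_isCentre hK hx
  obtain ⟨q, hq⟩ := m.exists_isCentre hL hy
  obtain ⟨D₀, hD0, hconf⟩ := m.exists_config hK hL h6
  obtain ⟨D, hD1, hD2⟩ := exists_radius (S := IsSphereSpace X 2)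
    (M := max D₀ (max (dist x p) (dist y q)))
    fun hS => max_lt (hD0 hS) (max_lt (hp.dist_lt hS) (hq.dist_lt hS))
  obtain ⟨h1, h2⟩ := max_lt_iff.1 hD1
  obtain ⟨h2, h3⟩ := max_lt_iff.1 h2
  obtain ⟨φ, ψ, f, ρ, hP, -, hne, hfo, hfab, hfa, hfb⟩ := hconf x hx p hp y hy q hq D h1 h2 h3 hD2
  have ea := hP.eventually_hull_iff (hK.image φ) (hL.image ψ) (hsx.image φ)
  have eb := hP.swap.eventually_hull_iff (hL.image ψ) (hK.image φ) (hsy.image ψ)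
  rw [union_comm] at eb
  have local_symm : ∀ {C A : Set X} {g : X ≃ᵢ X} {u : X}, f (g u) = g u →
      (∀ᶠ z in nhds (g u), z ∈ gconvexHull (φ '' K ∪ ψ '' L) ↔ z ∈ g '' C) →
      (∀ᶠ z in nhds (g u), z ∈ gconvexHull (φ '' K ∪ ψ '' L) ↔
        f z ∈ gconvexHull (φ '' K ∪ ψ '' L)) → SymAt C u := by
    intro C A g u hfu e1 e2
    have hs : SymAt (g '' C) (g u) := by
      refine ⟨f, hne, hfu, ?_⟩
      have h4 : Tendsto f (nhds (g u)) (nhds (g u)) := by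
        have := f.continuous.tendsto (g u)
        rwa [hfu] at this
      filter_upwards [e1, e2, h4.eventually e1] with z i1 i2 i3
      rw [← i1, i2, i3]
    refine SymAt.of_congAt ⟨g, rfl, Eventually.of_forall fun z => ?_⟩ hs
    exact (g.injective.mem_set_image).symm
  rcases hfab with ⟨h4, h5⟩ | ⟨h4, h5⟩
  · exact Or.inl ⟨local_symm (A := K) h4 ea hfa, local_symm (A := L) h5 eb hfb⟩
  · right
    have e1 : CongAt K (φ '' K) x (φ x) := ⟨φ, rfl, Eventually.of_forall fun z =>
      (φ.injective.mem_set_image).symm⟩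
    have e2 : CongAt L (ψ '' L) y (ψ y) := ⟨ψ, rfl, Eventually.of_forall fun z =>
      (ψ.injective.mem_set_image).symm⟩
    have e3 : CongAt (φ '' K) (ψ '' L) (φ x) (ψ y) := by
      refine ⟨f, h4, ?_⟩
      have h6 : Tendsto f (nhds (φ x)) (nhds (ψ y)) := by
        have := f.continuous.tendsto (φ x)
        rwa [h4] at this
      filter_upwards [ea, hfa, h6.eventually eb] with z i1 i2 i3
      rw [← i1, i2, i3]
    exact (e1.trans e3).trans e2.symm

theorem isHalfspace_normal (x : X) {n : ℂ} (hn : n ≠ 0) :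
    IsHalfspace {z | 0 ≤ dot ((m.cen x).w z) n} := by
  set M := m.cen x with hM
  have hn' : (‖n‖ : ℂ) ≠ 0 := by simpa using hn
  have hnn : n * (starRingEnd ℂ) n = (‖n‖ : ℂ) ^ 2 := Complex.mul_conj' n
  have hcn : (starRingEnd ℂ) n ≠ 0 := by simpa using hn
  set b : ℂ := Complex.I * n / ‖n‖ with hb
  have hb1 : Complex.normSq b = 1 := by
    rw [← Complex.sq_norm, hb, norm_div, norm_mul, Complex.norm_I, one_mul, Complex.norm_real,
      norm_norm, div_self (norm_ne_zero_iff.2 hn), one_pow]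
  have hb2 : b ^ 2 = - (n / (starRingEnd ℂ) n) := by
    rw [hb, div_pow, mul_pow, Complex.I_sq, ← hnn]
    field_simp
  obtain ⟨s, hs, hst, hsw⟩ := M.exists_lineRefl b hb1
  have hdot : ∀ z, dot (M.w (s z)) n = - dot (M.w z) n := by
    intro z
    have e : ∀ a c : ℂ, ((dot a c : ℝ) : ℂ) = (a * (starRingEnd ℂ) c + (starRingEnd ℂ) a * c) / 2 := by
      intro a c
      apply Complex.ext
      · simp [dot]
      · simp [dot]; ring
    apply Complex.ofReal_injective
    rw [hsw, hb2, Complex.ofReal_neg, e, e]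
    simp only [map_mul, map_neg, map_div₀, Complex.conj_conj]
    field_simp
    ring
  have hfix : ∀ z, s z = z ↔ dot (M.w z) n = 0 := by
    intro z
    constructor
    · intro h
      have := hdot z
      rw [h] at this
      linarith
    · intro h
      refine M.ext _ _ ?_ (hst z)
      have h1 : M.w z * (starRingEnd ℂ) n + (starRingEnd ℂ) (M.w z) * n = 0 := by
        apply Complex.ext
        · simp [dot] at h ⊢
          linarith
        · simp; ring
      rw [hsw, hb2]
      field_simp
      linear_combination -h1
  have hinv : ∀ z, s (s z) = z := fun z => by
    have := congrArg (fun f : X ≃ᵢ X => f z) hs.1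
    exact this
  have himg : ∀ z, z ∈ s '' {z | 0 ≤ dot (M.w z) n} ↔ dot (M.w z) n ≤ 0 := by
    intro z
    constructor
    · rintro ⟨u, hu, rfl⟩
      have : 0 ≤ dot (M.w u) n := hu
      rw [hdot]
      linarith
    · intro h
      refine ⟨s z, ?_, hinv z⟩
      show 0 ≤ dot (M.w (s z)) n
      rw [hdot]
      linarith
  refine ⟨s, hs, ?_, ?_, ?_⟩
  · exact isClosed_le continuous_const (M.linF_dot_w n).continuous
  · refine eq_univ_of_forall fun z => ?_
    rcases le_total 0 (dot (M.w z) n) with h | h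
    · exact Or.inl h
    · exact Or.inr ((himg z).2 h)
  · ext z
    constructor
    · rintro ⟨h1, h2⟩
      exact (hfix z).2 (le_antisymm ((himg z).1 h2) h1)
    · intro h
      have h1 := (hfix z).1 h
      exact ⟨h1.ge, (himg z).2 h1.le⟩

theorem dot_w_ray (x : X) (h n : ℂ) : ∀ᶠ s : ℝ in nhdsWithin 0 (Ioi 0),
    ∃ r > 0, dot ((m.cen x).w ((m.cen x).ci (s * h))) n = r * dot h n := by
  have h1 := (tendsto_ray h).eventually ((m.cen x).isOpen_dom.mem_nhds (m.cen x).zero_mem_dom)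
  filter_upwards [h1, eventually_mem_nhdsWithin] with s hs hs0
  have hU := (m.cen x).ci_mem_U hs
  refine ⟨(m.cen x).t ((m.cen x).ci (s * h)) * s, mul_pos hU hs0, ?_⟩
  rw [(m.cen x).w_eq hU, (m.cen x).c_ci hs, dot_mul_left, dot_mul_left]
  ring

theorem mem_frontier_normal (x : X) {n : ℂ} (hn : n ≠ 0) :
    x ∈ frontier {z | 0 ≤ dot ((m.cen x).w z) n} := by
  refine ⟨subset_closure ?_, fun h => ?_⟩
  · show 0 ≤ dot ((m.cen x).w x) n
    rw [cen_w_self, dot_zero_left]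
  · have h1 := m.eventually_ray (mem_interior_iff_mem_nhds.1 h) (-n)
    obtain ⟨s, hs, r, hr, h2⟩ := (h1.and (m.dot_w_ray x (-n) n)).exists
    have h3 : 0 ≤ dot ((m.cen x).w ((m.cen x).ci (s * -n))) n := hs
    rw [h2, dot_neg_left, dot_self] at h3
    have : 0 < r * ‖n‖ ^ 2 := mul_pos hr (by positivity)
    linarith

/-- Uniqueness of the supporting half plane gives uniqueness of the normal. -/
theorem smoothAt_of_smoothBody {C : Set X} (h : SmoothBody C) {x : X} (hx : x ∈ frontier C) :
    m.SmoothAt C x := by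
  intro n n' hn hn'
  have heq := (h x hx).unique
    ⟨m.isHalfspace_normal x hn.1, fun z hz => hn.2 z hz, m.mem_frontier_normal x hn.1⟩
    ⟨m.isHalfspace_normal x hn'.1, fun z hz => hn'.2 z hz, m.mem_frontier_normal x hn'.1⟩
  have key : ∀ h, 0 ≤ dot h n ↔ 0 ≤ dot h n' := by
    intro h
    obtain ⟨s, ⟨r, hr, h1⟩, ⟨r', hr', h2⟩⟩ := ((m.dot_w_ray x h n).and (m.dot_w_ray x h n')).exists
    have h3 := Set.ext_iff.1 heq ((m.cen x).ci (s * h))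
    rw [Set.mem_ofPred_eq, Set.mem_ofPred_eq, h1, h2, mul_nonneg_iff_of_pos_left hr,
      mul_nonneg_iff_of_pos_left hr'] at h3
    exact h3
  have e0 : dot (Complex.I * n) n = 0 := by simp [dot]; ring
  have e1 : 0 ≤ dot (Complex.I * n) n' := (key _).1 e0.ge
  have e2 : 0 ≤ dot (-(Complex.I * n)) n' := (key _).1 (by rw [dot_neg_left, e0, neg_zero])
  rw [dot_neg_left] at e2
  have e3 : dot (Complex.I * n) n' = 0 := by linarith
  have hpos : 0 < dot n n := by rw [dot_self]; have := hn.1; positivity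
  have e4 : 0 < dot n n' := by
    have := (not_congr (key (-n))).1 (by rw [dot_neg_left]; linarith)
    rw [dot_neg_left] at this
    linarith
  refine ⟨dot n n' / dot n n, div_pos e4 hpos, ?_⟩
  rw [← mul_right_inj' (Complex.ofReal_ne_zero.2 hpos.ne'), ← mul_assoc, ← Complex.ofReal_mul,
    mul_div_cancel₀ _ hpos.ne']
  simp only [dot, Complex.mul_re, Complex.mul_im, Complex.I_re, Complex.I_im] at e3 ⊢
  apply Complex.ext
  · simp
    linear_combination -n.im * e3
  · simp
    linear_combination n.re * e3

end KModel

theorem exists_pos_mul {e n : ℂ} (he : e ≠ 0) (hn : n ≠ 0)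
    (h : ∀ h, 0 < dot h e → 0 ≤ dot h n) : ∃ r : ℝ, 0 < r ∧ n = r * e := by
  have hpos : 0 < dot e e := by rw [dot_self]; positivity
  have e0 : dot (Complex.I * e) e = 0 := by simp [dot]; ring
  have key : ∀ K : ℝ, 0 ≤ dot e n + K * dot (Complex.I * e) n := by
    intro K
    have := h (e + K * (Complex.I * e)) (by rw [dot_add_left, dot_mul_left, e0]; linarith)
    rwa [dot_add_left, dot_mul_left] at this
  have e1 : dot (Complex.I * e) n = 0 := by
    by_contra hb
    have := key (-(dot e n + 1) / dot (Complex.I * e) n)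
    rw [div_mul_cancel₀ _ hb] at this
    linarith
  have e2 : n = (dot e n / dot e e : ℝ) * e := by
    rw [← mul_right_inj' (Complex.ofReal_ne_zero.2 hpos.ne'), ← mul_assoc, ← Complex.ofReal_mul,
      mul_div_cancel₀ _ hpos.ne']
    simp only [dot, Complex.mul_re, Complex.mul_im, Complex.I_re, Complex.I_im] at e1 ⊢
    apply Complex.ext
    · simp
      linear_combination -e.im * e1
    · simp
      linear_combination e.re * e1
  refine ⟨_, lt_of_le_of_ne (div_nonneg ?_ hpos.le) fun h0 => hn ?_, e2⟩
  · simpa using key 0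
  · rw [e2, ← h0]
    simp

theorem frontier_of_preconnected {Y : Type*} [TopologicalSpace Y] {S C : Set Y}
    (hS : IsPreconnected S) (h1 : (S ∩ interior C).Nonempty) (h2 : ¬ S ⊆ interior C) :
    (S ∩ frontier C).Nonempty := by
  by_contra h
  rw [not_nonempty_iff_eq_empty] at h
  refine h2 (hS.subset_left_of_subset_union isOpen_interior
    (isClosed_closure (s := C)).isOpen_compl ?_ ?_ h1)
  · exact disjoint_compl_right_iff_subset.2 (interior_subset.trans subset_closure)
  · intro z hz
    by_contra h3
    rw [mem_union, not_or, mem_compl_iff, not_not] at h3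
    have : z ∈ S ∩ frontier C := ⟨hz, h3.2, h3.1⟩
    rw [h] at this
    exact this

theorem GoodPair.symm {K L : Set X} {φ ψ : X ≃ᵢ X} (h : GoodPair 2 K L φ ψ) :
    GoodPair 2 L K ψ φ :=
  ⟨h.2.1, h.1, fun hS => by rw [union_comm]; exact h.2.2 hS⟩

theorem hullUnion_comm (K L : Set X) (φ ψ : X ≃ᵢ X) : hullUnion K L φ ψ = hullUnion L K ψ φ := by
  rw [hullUnion, hullUnion, union_comm]

theorem UniqueDiametral.symm {M : Set X} {a b : X} (h : UniqueDiametral M a b) :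
    UniqueDiametral M b a :=
  ⟨h.2.1, h.1, h.2.2.1.symm, by rw [dist_comm]; exact h.2.2.2.1, fun a' ha b' hb hab =>
    (h.2.2.2.2 a' ha b' hb hab).symm⟩

theorem cond6_symm {K L : Set X} (h : T8Cond6 K L) : T8Cond6 L K := by
  obtain ⟨δ, hδ, h⟩ := h
  refine ⟨δ, hδ, fun φ ψ hg x hx y hy hb hu => ?_⟩
  rw [hullUnion_comm] at hb hu ⊢
  obtain ⟨ε, hε, h1⟩ := h ψ φ hg.symm y hy x hx hb hu.symm
  refine ⟨ε, hε, fun ε' h2 h3 => ?_⟩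
  have := h1 ε' h2 h3
  rw [union_comm, segCyl_comm] at this
  exact this

namespace KModel
variable {m : KModel X}

theorem segment_frontier {C : Set X} (s : X) {a b : X} (ha : a ∈ interior C) (haU : a ∈ (m.cen s).U)
    (hbU : b ∈ (m.cen s).U) (hb : b ∉ interior C) :
    ∃ z ∈ frontier C, z ∈ (m.cen s).U ∧
      (m.cen s).c z ∈ segment ℝ ((m.cen s).c a) ((m.cen s).c b) := by
  have hsub : segment ℝ ((m.cen s).c a) ((m.cen s).c b) ⊆ (m.cen s).dom :=
    (m.cen s).convex_dom.segment_subset ((m.cen s).c_mem_dom haU) ((m.cen s).c_mem_dom hbU)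
  have hp : IsPreconnected ((m.cen s).ci '' segment ℝ ((m.cen s).c a) ((m.cen s).c b)) :=
    (convex_segment _ _).isPreconnected.image _ ((m.cen s).continuousOn_ci.mono hsub)
  obtain ⟨_, ⟨z, hz, rfl⟩, hz'⟩ := frontier_of_preconnected (C := C) hp
    ⟨a, ⟨_, left_mem_segment ℝ _ _, (m.cen s).ci_c haU⟩, ha⟩
    fun h => hb (h ⟨_, right_mem_segment ℝ _ _, (m.cen s).ci_c hbU⟩)
  exact ⟨_, hz', (m.cen s).ci_mem_U (hsub hz), by rwa [(m.cen s).c_ci (hsub hz)]⟩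

theorem exists_inball (hk : m.k ≠ 1) {C : Set X} (hC : Body C) :
    ∃ y ∈ frontier C, ∃ z₀, z₀ ≠ y ∧ ∀ z, dist z z₀ < dist y z₀ → z ∈ C := by
  have := m.properSpace
  obtain ⟨z₀, hz⟩ := hC.int
  obtain ⟨y, hy, h1⟩ := isClosed_frontier.exists_infDist_eq_dist (m.frontier_nonempty hC) z₀
  refine ⟨y, hy, z₀, fun h => hy.2 (h ▸ hz), fun z h2 => ?_⟩
  by_contra h3
  have hU : ∀ x, x ∈ (m.cen z₀).U := fun x => by
    rw [(m.cen z₀).U_eq_univ (by rwa [cen_k])]; trivial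
  obtain ⟨u, hu, hu', h4⟩ := segment_frontier z₀ hz (hU _) (hU z) fun h => h3 (interior_subset h)
  have h5 : dist z₀ u ≤ dist z₀ z := by
    have h6 : dist (m.cen z₀).o u ≤ dist (m.cen z₀).o z := by
      rw [(m.cen z₀).dist_o_le_iff_norm_c (hU u) (hU z)]
      rw [cen_c_self] at h4
      obtain ⟨α, β, h7, h8, h9, h10⟩ := h4
      rw [← h10, smul_zero, zero_add, norm_smul, Real.norm_eq_abs, abs_of_nonneg h8]
      exact mul_le_of_le_one_left (norm_nonneg _) (by linarith)
    rwa [cen_o] at h6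
  have h7 := infDist_le_dist_of_mem (x := z₀) hu
  rw [dist_comm z z₀, dist_comm y z₀] at h2
  linarith

theorem exists_smoothAt (hk : m.k ≠ 1) {C : Set X} (hC : Body C) :
    ∃ y ∈ frontier C, m.SmoothAt C y := by
  obtain ⟨y, hy, z₀, hne, h⟩ := exists_inball hk hC
  refine ⟨y, hy, ?_⟩
  have hU : ∀ x, x ∈ (m.cen y).U := fun x => by
    rw [(m.cen y).U_eq_univ (by rwa [cen_k])]; trivial
  set e := (m.cen y).c z₀ with he
  have he0 : e ≠ 0 := fun h0 => hne ((m.cen y).c_inj (hU _) (hU _) (by rw [← he, h0, cen_c_self]))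
  have key : ∀ n, m.IsNormal C y n → ∃ r : ℝ, 0 < r ∧ n = r * e := by
    intro n hn
    refine exists_pos_mul he0 hn.1 fun v hv => ?_
    have e1 := m.eventually_ray (x := y) (p := fun z => (m.cen y).t z < 2)
      ((m.cen y).continuous_t.continuousAt.eventually_lt continuousAt_const (by
        rw [cen_t_self]; norm_num)) v
    have e2 : ∀ᶠ s : ℝ in nhdsWithin 0 (Ioi 0), s * 2 * ‖v‖ ^ 2 < 2 * dot v e := by
      have h0 : Continuous fun s : ℝ => s * 2 * ‖v‖ ^ 2 := by fun_prop
      refine Filter.Eventually.filter_mono nhdsWithin_le_nhds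
        (h0.continuousAt.eventually_lt continuousAt_const ?_)
      simpa using hv
    have e3 := (tendsto_ray v).eventually ((m.cen y).isOpen_dom.mem_nhds (m.cen y).zero_mem_dom)
    obtain ⟨s, ⟨⟨⟨h1, h2⟩, h3⟩, h5, h6, h4⟩, hs⟩ := (((e1.and e2).and e3).and
      (m.dot_w_ray y v n)).and eventually_mem_nhdsWithin |>.exists
    have hs : 0 < s := hs
    set z := (m.cen y).ci (s * v) with hz
    have ht : 0 < (m.cen y).t z := hU z
    have hw : (m.cen y).w z = ((m.cen y).t z * s : ℝ) * v := by
      rw [(m.cen y).w_eq (hU z), hz, (m.cen y).c_ci h3]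
      push_cast
      ring
    have h7 : z ∈ C := by
      apply h
      have := (m.cen y).dist_lt_dist_o_iff (hU z₀) z
      rw [cen_o] at this
      rw [this, ← he, hw, dot_mul_left]
      have hq : (m.cen y).q y z ≤ ((m.cen y).t z * s) ^ 2 * ‖v‖ ^ 2 := by
        have := (m.cen y).q_o z
        rw [cen_o] at this
        rw [this, ← Complex.sq_norm, hw, norm_mul, Complex.norm_real, Real.norm_eq_abs, mul_pow,
          sq_abs]
        have : (m.cen y).k ≤ 0 := by
          rcases (m.cen y).hk with h | h | h
          · exact absurd h (by rwa [cen_k])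
          · exact h.le
          · rw [h]; norm_num
        nlinarith [sq_nonneg (1 - (m.cen y).t z)]
      have h8 : (m.cen y).t z * s * (s * (m.cen y).t z * ‖v‖ ^ 2) ≤
          (m.cen y).t z * s * (s * 2 * ‖v‖ ^ 2) :=
        mul_le_mul_of_nonneg_left (mul_le_mul_of_nonneg_right
          (mul_le_mul_of_nonneg_left h1.le hs.le) (by positivity)) (by positivity)
      have h9 := mul_lt_mul_of_pos_left h2 (mul_pos ht hs)
      nlinarith
    have h8 := hn.2 z h7
    rw [h4] at h8
    exact nonneg_of_mul_nonneg_right h8 h6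
  intro n n' hn hn'
  obtain ⟨r, hr, rfl⟩ := key n hn
  obtain ⟨r', hr', rfl⟩ := key n' hn'
  refine ⟨r' / r, div_pos hr' hr, ?_⟩
  have : (r : ℂ) ≠ 0 := by exact_mod_cast hr.ne'
  push_cast
  field_simp

end KModel

theorem eq_or_map_eq {B : ℂ ≃ₗᵢ[ℝ] ℂ} {E : ℂ} (hE : E ≠ 0) (hB : B E = E) (hne : ∃ z, B z ≠ z)
    {v n : ℂ} (h1 : dot v E = dot n E) (h2 : ‖v‖ = ‖n‖) : v = n ∨ B v = n := by
  have hcE : (starRingEnd ℂ) E ≠ 0 := by simpa using hE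
  obtain ⟨a, rfl | rfl⟩ := linear_isometry_complex B
  · exfalso
    obtain ⟨z, hz⟩ := hne
    rw [rotation_apply] at hB hz
    rw [mul_eq_right₀ hE] at hB
    exact hz (by rw [hB, one_mul])
  · simp only [LinearIsometryEquiv.trans_apply, rotation_apply, Complex.conjLIE_apply] at hB ⊢
    have e1 : (v * (starRingEnd ℂ) E).re = (n * (starRingEnd ℂ) E).re := by
      simpa [dot] using h1
    have e2 : (v * (starRingEnd ℂ) E).im ^ 2 = (n * (starRingEnd ℂ) E).im ^ 2 := by
      have e3 : ‖v * (starRingEnd ℂ) E‖ ^ 2 = ‖n * (starRingEnd ℂ) E‖ ^ 2 := by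
        rw [norm_mul, norm_mul, h2]
      rw [Complex.sq_norm, Complex.sq_norm, Complex.normSq_apply, Complex.normSq_apply, e1] at e3
      linarith
    rcases sq_eq_sq_iff_eq_or_eq_neg.1 e2 with e3 | e3
    · left
      exact mul_right_cancel₀ hcE (Complex.ext e1 e3)
    · right
      have e4 : (starRingEnd ℂ) v * E = n * (starRingEnd ℂ) E := by
        have : (starRingEnd ℂ) v * E = (starRingEnd ℂ) (v * (starRingEnd ℂ) E) := by simp
        rw [this]
        refine Complex.ext ?_ ?_
        · rw [Complex.conj_re, e1]
        · rw [Complex.conj_im, e3, neg_neg]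
      apply mul_right_cancel₀ hcE
      rw [← e4]
      linear_combination (starRingEnd ℂ) v * hB

theorem dot_nonneg_of_cone {u E n : ℂ} {ε : ℝ} (hε : 0 < ε) (hE : E ≠ 0)
    (hu : ‖u‖ ^ 2 * ‖E‖ ^ 2 ≤ (1 + ε) * dot u E ^ 2)
    (hn : ε * (‖n‖ ^ 2 * ‖E‖ ^ 2) ≤ (1 + ε) * dot n E ^ 2) (hu' : 0 ≤ dot u E)
    (hn' : 0 ≤ dot n E) : 0 ≤ dot u n := by
  have lag : ∀ a b : ℂ, ‖a‖ ^ 2 * ‖b‖ ^ 2 = dot a b ^ 2 + (a.re * b.im - a.im * b.re) ^ 2 := by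
    intro a b
    rw [Complex.sq_norm, Complex.sq_norm, Complex.normSq_apply, Complex.normSq_apply, dot]
    ring
  rw [lag] at hu hn
  set cu := u.re * E.im - u.im * E.re with hcu
  set cn := n.re * E.im - n.im * E.re with hcn
  have key : ‖E‖ ^ 2 * dot u n = dot u E * dot n E + cu * cn := by
    rw [Complex.sq_norm, Complex.normSq_apply, dot, dot, dot, hcu, hcn]
    ring
  have h1 : (cu * cn) ^ 2 ≤ (dot u E * dot n E) ^ 2 := by
    have e1 : cu ^ 2 ≤ ε * dot u E ^ 2 := by linarith
    have e2 : ε * cn ^ 2 ≤ dot n E ^ 2 := by linarith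
    have e3 : ε * (cu * cn) ^ 2 ≤ ε * (dot u E * dot n E) ^ 2 := by
      calc ε * (cu * cn) ^ 2 = cu ^ 2 * (ε * cn ^ 2) := by ring
        _ ≤ (ε * dot u E ^ 2) * dot n E ^ 2 := by gcongr
        _ = _ := by ring
    exact le_of_mul_le_mul_left e3 hε
  have h2 := (abs_le_of_sq_le_sq' h1 (mul_nonneg hu' hn')).1
  have h3 : 0 ≤ ‖E‖ ^ 2 * dot u n := by rw [key]; linarith
  exact nonneg_of_mul_nonneg_right h3 (by positivity)

namespace KModel
variable {m : KModel X}

theorem Placed.far (hk : m.k ≠ 1) (R : ℝ) {ε : ℝ} (hε : 0 < ε) :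
    ∃ D₁, ∀ (K L : Set X) (a p b q : X) (ρ : ℝ), m.Placed K L a p b q ρ → dist b q = R →
      D₁ < dist m.o a → ∀ z ∈ L, ‖(m.cen a).w z‖ ^ 2 * ‖(m.cen a).c m.o‖ ^ 2 ≤
        (1 + ε) * dot ((m.cen a).w z) ((m.cen a).c m.o) ^ 2 := by
  refine ⟨2 * (1 + ε) * R / ε + R + 1 + 2 / ε, fun K L a p b q ρ h hR hD z hz => ?_⟩
  have hR0 : 0 ≤ R := hR ▸ dist_nonneg
  have hle := (h.isCentre_o (A := K ∪ L) Subset.rfl).le (Or.inr hz)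
  set D := dist m.o a with hDdef
  set M := m.cen a with hM
  have hMo : M.o = a := m.cen_o a
  have hMk : M.k ≠ 1 := by rwa [hM, cen_k]
  have hd : 2 * D - 2 * R ≤ dist M.o z := by
    rw [hMo]
    have h1 := h.btw
    rw [Btw, dist_comm a, h.dist_b] at h1
    have h2 := h.cL.2.2 hz
    rw [mem_closedBall, hR] at h2
    have h3 := dist_triangle a z b
    have h4 := dist_triangle z q b
    rw [dist_comm q b, hR] at h4
    linarith
  have e1 : 0 ≤ 2 * (1 + ε) * R / ε := by positivity
  have e2 : 0 ≤ 2 / ε := by positivity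
  have hoU : m.o ∈ M.U := by rw [M.U_eq_univ hMk]; trivial
  have hq := M.q_o z
  rw [hMo] at hq
  rw [hq, ← Complex.sq_norm] at hle
  set S := dot (M.w z) (M.c m.o) with hS
  rcases M.polar z with ⟨h1, -⟩ | ⟨h1, h2, h3⟩ | ⟨h1, h2, h3⟩
  · exact absurd h1 hMk
  · have h4 : ‖M.c m.o‖ = D := by
      rw [c, M.t_of_zero h1]
      rcases M.polar m.o with ⟨h5, -⟩ | ⟨-, h5, -⟩ | ⟨h5, -⟩
      · exact absurd h5 hMk
      · rw [hMo, dist_comm] at h5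
        simp [h5, hDdef]
      · rw [h1] at h5; norm_num at h5
    rw [h2, h1, zero_mul, add_zero] at hle
    rw [h2, h4]
    set d := dist M.o z with hd'
    have hDR : 2 * (1 + ε) * R ≤ ε * D := by
      have : 2 * (1 + ε) * R / ε ≤ D := by linarith
      rw [div_le_iff₀ hε] at this
      linarith
    have hD0 : 0 < D - R := by linarith
    have e3 : D ^ 2 ≤ (1 + ε) * (D - R) ^ 2 := by
      nlinarith [mul_nonneg (sub_nonneg.2 hDR) (by linarith : 0 ≤ D), sq_nonneg R]
    have e4 : D ^ 2 ≤ (1 + ε) * (d / 2) ^ 2 := by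
      refine e3.trans ?_
      gcongr
      linarith
    calc d ^ 2 * D ^ 2 ≤ d ^ 2 * ((1 + ε) * (d / 2) ^ 2) := by gcongr
      _ = (1 + ε) * (d ^ 2 / 2) ^ 2 := by ring
      _ ≤ (1 + ε) * S ^ 2 := by gcongr
  · have h4 : ‖M.c m.o‖ ^ 2 ≤ 1 := by
      have h5 : 0 < 1 + M.k * Complex.normSq (M.c m.o) := M.c_mem_dom hoU
      rw [h1, ← Complex.sq_norm] at h5
      linarith
    set d := dist M.o z with hd'
    have hs := Real.cosh_sq d
    have hc : (d + 1) / 2 ≤ Real.cosh d := by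
      rw [Real.cosh_eq]
      have := Real.add_one_le_exp d
      have := Real.exp_pos (-d)
      linarith
    rw [h2, h3, h1] at hle
    have h6 : Real.cosh d - 1 ≤ S := by nlinarith
    have h7 : 2 ≤ ε * (Real.cosh d - 1) := by
      have : ε * (2 / ε) ≤ ε * (Real.cosh d - 1) := by
        gcongr
        linarith
      rwa [mul_div_cancel₀ _ hε.ne'] at this
    have h8 : 0 ≤ Real.cosh d - 1 := by linarith [Real.one_le_cosh d]
    rw [h2]
    calc Real.sinh d ^ 2 * ‖M.c m.o‖ ^ 2 ≤ Real.sinh d ^ 2 * 1 := by gcongr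
      _ = (Real.cosh d - 1) * (Real.cosh d + 1) := by linarith
      _ ≤ (Real.cosh d - 1) * ((1 + ε) * (Real.cosh d - 1)) := by gcongr; linarith
      _ = (1 + ε) * (Real.cosh d - 1) ^ 2 := by ring
      _ ≤ (1 + ε) * S ^ 2 := by gcongr

end KModel

theorem eq_of_dot_of_norm {v n w : ℂ} {r : ℝ} (hn : n = r * w) (h1 : dot v w = dot n w)
    (h2 : ‖v‖ = ‖n‖) : v = n := by
  have h3 : dot v n = dot n n := by
    have : ∀ a, dot a n = r * dot a w := fun a => by rw [hn, dot_mul_right]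
    rw [this, this, h1]
  have h4 := normSq_sub v n
  rw [h3, ← normSq_eq_dot n, ← Complex.sq_norm, ← Complex.sq_norm, ← Complex.sq_norm, h2] at h4
  exact sub_eq_zero.1 (norm_eq_zero.1 (by nlinarith [norm_nonneg (v - n)]))

namespace KModel
variable {m : KModel X}

theorem Placed.direction {K L : Set X} {a p b q : X} {ρ : ℝ} (h : m.Placed K L a p b q ρ) :
    ∃ β : ℝ, 0 < β ∧ (m.cen a).c p = β * (m.cen a).c m.o := by
  have hc := h.isCentre_o (A := K ∪ L) Subset.rfl
  have h1 := (((m.cen a).btw_iff_segment hc.2.1 (m.self_mem_cen_U a)).1 h.pa).2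
  rw [cen_c_self] at h1
  obtain ⟨α, β, h2, h3, h4, h5⟩ := h1
  rw [smul_zero, add_zero] at h5
  refine ⟨α, lt_of_le_of_ne h2 fun h0 => h.cK.c_ne ?_, ?_⟩
  · rw [← h5, ← h0, zero_smul]
  · rw [← h5, Complex.real_smul]

theorem Placed.isNormal_hull {K L : Set X} {a p b q : X} {ρ : ℝ} (h : m.Placed K L a p b q ρ)
    {n : ℂ} (h0 : n ≠ 0) (hK : ∀ z ∈ K, 0 ≤ dot ((m.cen a).w z) n)
    (hL : ∀ z ∈ L, 0 ≤ dot ((m.cen a).w z) n) : m.IsNormal (gconvexHull (K ∪ L)) a n := by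
  refine ⟨h0, m.nonneg_on_hull ((m.cen_linF_iff a).1 ((m.cen a).linF_dot_w n)) h.subset_U ?_⟩
  rintro z (hz | hz)
  exacts [hK z hz, hL z hz]

/-- If a local symmetry exchanges the ends, the normals of the hull at one end
are transported to normals of the other body. -/
theorem Placed.isNormal_swap {K L : Set X} {a p b q : X} {ρ : ℝ} (h : m.Placed K L a p b q ρ)
    (hL : Body L) {f : X ≃ᵢ X} (hf : Placed.Symm m K L a b f) (hab : f a = b) {A : ℂ ≃ₗᵢ[ℝ] ℂ}
    (hA : ∀ z, (m.cen b).w (f z) = A ((m.cen a).w z)) {n : ℂ}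
    (hn : m.IsNormal (gconvexHull (K ∪ L)) a n) : m.IsNormal L b (A n) := by
  refine m.isNormal_of_local hL h.hb (fun h0 => hn.1 ((map_eq_zero_iff A A.injective).1 h0)) ?_
  have h1 : Tendsto f.symm (nhds b) (nhds a) := by
    have := f.symm.continuous.tendsto b
    rwa [← hab, f.symm_apply_apply, hab] at this
  filter_upwards [h1.eventually hf.at_a] with z hz hzL
  rw [f.apply_symm_apply] at hz
  have h2 := hn.2 _ (hz.2 (subset_gconvexHull _ (Or.inr hzL)))
  rw [← dot_map A, ← hA, f.apply_symm_apply] at h2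
  exact h2

/-- The normal cone is symmetric with respect to the direction of a centre. -/
theorem reflect_normal (hk : m.k ≠ 1) {K L : Set X} (hK : Body K) (hL : Body L)
    (h6 : T8Cond6 K L) {y : X} (hy : y ∈ frontier L) (hsy : m.SmoothAt L y) {x : X}
    (hx : x ∈ frontier K) {p : X} (hp : m.IsCentre K x p) {n : ℂ} (hn : m.IsNormal K x n)
    (hnw : 0 < dot n ((m.cen x).c p)) {v : ℂ}
    (h1 : dot v ((m.cen x).c p) = dot n ((m.cen x).c p)) (h2 : ‖v‖ = ‖n‖) : m.IsNormal K x v := by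
  have hS : ¬ IsSphereSpace X 2 := fun h => hk (m.sph.1 h)
  set w := (m.cen x).c p with hw
  have hw0 : w ≠ 0 := hp.c_ne
  by_cases hpar : ∃ r : ℝ, n = r * w
  · obtain ⟨r, hr⟩ := hpar
    rwa [eq_of_dot_of_norm hr h1 h2]
  have hv0 : v ≠ 0 := by
    rw [← norm_ne_zero_iff, h2, norm_ne_zero_iff]
    exact hn.1
  obtain ⟨q, hq⟩ := m.exists_isCentre hL hy
  have hN : 0 < ‖n‖ ^ 2 * ‖w‖ ^ 2 := by
    have := hn.1
    positivity
  set ε := dot n w ^ 2 / (‖n‖ ^ 2 * ‖w‖ ^ 2) with hεdef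
  have hε : 0 < ε := by positivity
  have hεn : ε * (‖n‖ ^ 2 * ‖w‖ ^ 2) ≤ (1 + ε) * dot n w ^ 2 := by
    rw [hεdef, div_mul_cancel₀ _ hN.ne', ← hεdef]
    nlinarith [sq_nonneg (dot n w)]
  obtain ⟨D₀, -, hconf⟩ := m.exists_config hK hL h6
  obtain ⟨D₁, hfar⟩ := Placed.far (m := m) hk (dist y q) hε
  obtain ⟨D, hD⟩ := exists_gt (max (max D₀ D₁) (max (dist x p) (dist y q)))
  simp only [max_lt_iff] at hD
  obtain ⟨⟨d1, d2⟩, d3, d4⟩ := hD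
  obtain ⟨φ, ψ, f, ρ, hP, hdD, hf⟩ := hconf x hx p hp y hy q hq D d1 d3 d4 fun h => absurd h hS
  obtain ⟨A, hA, hAc, -⟩ := m.exists_linear_cen φ x
  set a := φ x with ha
  obtain ⟨β, hβ, hβE⟩ := hP.direction
  set E := (m.cen a).c m.o with hE
  have hAw : A w = β * E := by rw [← hβE, hAc]
  have hAw0 : A w ≠ 0 := fun h0 => hw0 ((map_eq_zero_iff A A.injective).1 h0)
  have hco := hP.isCentre_o (A := φ '' K ∪ ψ '' L) Subset.rfl
  have hcoH : ∀ z ∈ φ '' K ∪ ψ '' L, 0 ≤ dot ((m.cen a).w z) (A w) := fun z hz => by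
    rw [hAw, dot_mul_right]
    exact mul_nonneg hβ.le (hco.isNormal.2 z hz)
  have nw : m.IsNormal (gconvexHull (φ '' K ∪ ψ '' L)) a (A w) :=
    hP.isNormal_hull hAw0 (fun z hz => hcoH z (Or.inl hz)) fun z hz => hcoH z (Or.inr hz)
  have hAn := hn.image φ hA
  have nn : m.IsNormal (gconvexHull (φ '' K ∪ ψ '' L)) a (A n) := by
    refine hP.isNormal_hull hAn.1 hAn.2 fun z hz => ?_
    have e1 := hfar _ _ _ _ _ _ _ hP (ψ.dist_eq y q) (by rw [hdD]; exact d2) z hz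
    refine dot_nonneg_of_cone hε hAw0 ?_ ?_ (hcoH z (Or.inr hz)) ?_
    · rw [hAw, dot_mul_right, norm_mul, Complex.norm_real, Real.norm_eq_abs, mul_pow, sq_abs]
      calc _ = β ^ 2 * (‖(m.cen a).w z‖ ^ 2 * ‖E‖ ^ 2) := by ring
        _ ≤ β ^ 2 * ((1 + ε) * dot ((m.cen a).w z) E ^ 2) := by gcongr
        _ = _ := by ring
    · rwa [A.norm_map, A.norm_map, dot_map]
    · rw [dot_map]
      exact hnw.le
  rcases hf.fab with ⟨fa, -⟩ | ⟨fa, -⟩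
  · obtain ⟨B, hB, hBc, -⟩ := m.exists_linear_cen f a
    rw [fa] at hB hBc
    have hBE : B E = E := by rw [hE, ← hBc, hf.fo]
    have hBw : B (A w) = A w := by
      rw [hAw, ← Complex.real_smul, map_smul, hBE]
    have hBne : ∃ z, B z ≠ z := by
      by_contra h
      push Not at h
      refine hf.ne ((m.cen a).eq_refl_of_w f (by rw [cen_o, fa]) fun z => ?_)
      rw [hB, h]
    rcases eq_or_map_eq (v := A v) (n := A n) hAw0 hBw hBne (by rw [dot_map, dot_map, h1])
      (by rw [A.norm_map, A.norm_map, h2]) with h3 | h3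
    · rw [A.injective h3]
      exact hn
    · refine IsNormal.of_image φ hA (m.isNormal_of_local (hK.image φ) hP.ha
        (fun h0 => hv0 ((map_eq_zero_iff A A.injective).1 h0)) ?_)
      filter_upwards [hf.at_a] with z hz hzK
      have h4 := nn.2 _ (hz.1 (subset_gconvexHull _ (Or.inl hzK)))
      rwa [hB, ← h3, dot_map] at h4
  · exfalso
    obtain ⟨B, hB, -, -⟩ := m.exists_linear_cen f a
    rw [fa] at hB
    obtain ⟨r, -, hr⟩ := (hsy.image ψ) _ _ (hP.isNormal_swap (hL.image ψ) hf fa hB nw)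
      (hP.isNormal_swap (hL.image ψ) hf fa hB nn)
    rw [← Complex.real_smul, ← map_smul, ← map_smul] at hr
    exact hpar ⟨r, by rw [← Complex.real_smul]; exact A.injective (B.injective hr)⟩

end KModel

namespace KModel
variable {m : KModel X}

theorem exists_dot_ne (hk : m.k ≠ 1) {C : Set X} (h : Body C) (x : X) {u : ℂ} (hu : u ≠ 0) :
    ∃ z ∈ C, dot ((m.cen x).w z) u ≠ 0 := by
  have hU : ∀ z, z ∈ (m.cen x).U := fun z => by
    rw [(m.cen x).U_eq_univ (by rwa [cen_k])]; trivial
  obtain ⟨z₀, hz₀⟩ := h.int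
  by_contra hall
  push Not at hall
  have h1 : (m.cen x).c '' C ∈ nhds ((m.cen x).c z₀) := by
    rw [← (m.cen x).map_c_nhds (hU z₀)]
    exact image_mem_map (mem_interior_iff_mem_nhds.1 hz₀)
  have h2 : Tendsto (fun s : ℝ => (m.cen x).c z₀ + s * u) (nhdsWithin 0 (Ioi 0))
      (nhds ((m.cen x).c z₀)) := by
    simpa using (tendsto_ray u).const_add ((m.cen x).c z₀)
  have h3 : ∀ z ∈ (m.cen x).c '' C, dot z u = 0 := by
    rintro _ ⟨z, hz, rfl⟩
    have h4 := hall z hz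
    rw [(m.cen x).w_eq (hU z), dot_mul_left] at h4
    exact (mul_eq_zero.1 h4).resolve_left (ne_of_gt (hU z))
  obtain ⟨s, hs, hs0⟩ := ((h2.eventually h1).and eventually_mem_nhdsWithin).exists
  have h4 := h3 _ hs
  rw [dot_add_left, dot_mul_left, h3 _ (mem_image_of_mem _ (interior_subset hz₀)), zero_add,
    dot_self] at h4
  have : 0 < s * ‖u‖ ^ 2 := mul_pos hs0 (by positivity)
  linarith

/-- A wedge of normals around the direction of a centre cannot be symmetric with respect to
all the directions of centres. -/
theorem no_wedge (hk : m.k ≠ 1) {K L : Set X} (hK : Body K) (hL : Body L)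
    (h6 : T8Cond6 K L) {y : X} (hy : y ∈ frontier L) (hsy : m.SmoothAt L y) {x : X}
    (hx : x ∈ frontier K) {p : X} (hp : m.IsCentre K x p) {u : ℂ}
    (h0 : dot u ((m.cen x).c p) = 0) (hu : ‖u‖ = ‖(m.cen x).c p‖) {τ : ℝ} (hτ : 0 < τ)
    (h1 : ∀ z ∈ K, 0 ≤ dot ((m.cen x).w z) ((m.cen x).c p + τ * u)) : False := by
  set w := (m.cen x).c p with hw
  set N := ‖w‖ ^ 2 with hN
  have hNpos : 0 < N := by
    have : w ≠ 0 := hp.c_ne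
    positivity
  have h0' : dot w u = 0 := by rw [dot_comm, h0]
  have hww : dot w w = N := dot_self w
  have huu : dot u u = N := by rw [dot_self, hu]
  have hu0 : u ≠ 0 := by
    rw [← norm_ne_zero_iff, hu, norm_ne_zero_iff]
    exact hp.c_ne
  have hdw : ∀ a b c d : ℝ, dot ((a : ℂ) * w + b * u) (c * w + d * u) = (a * c + b * d) * N := by
    intro a b c d
    simp only [dot_add_left, dot_add_right, dot_mul_left, dot_mul_right, h0, h0', hww, huu]
    ring
  have hnorm : ∀ a b : ℝ, ‖(a : ℂ) * w + b * u‖ ^ 2 = (a ^ 2 + b ^ 2) * N := fun a b => by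
    rw [← dot_self, hdw]; ring
  have hne : ∀ a b : ℝ, 0 < a ^ 2 + b ^ 2 → (a : ℂ) * w + b * u ≠ 0 := by
    intro a b hab h
    have := hnorm a b
    rw [h, norm_zero] at this
    nlinarith [mul_pos hab hNpos]
  set T : Set ℝ := {τ | ∀ z ∈ K, 0 ≤ dot ((m.cen x).w z) w + τ * dot ((m.cen x).w z) u} with hT
  have hTn : ∀ a b : ℝ, 0 < a → ((∀ z ∈ K, 0 ≤ dot ((m.cen x).w z) ((a : ℂ) * w + b * u)) ↔
      b / a ∈ T) := by
    intro a b ha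
    refine forall₂_congr fun z _ => ?_
    rw [dot_add_right, dot_mul_right, dot_mul_right, ← mul_nonneg_iff_of_pos_left ha
      (b := dot ((m.cen x).w z) w + b / a * dot ((m.cen x).w z) u)]
    rw [mul_add, ← mul_assoc, mul_div_cancel₀ _ ha.ne']
  have hτT : τ ∈ T := by
    have := (hTn 1 τ one_pos).1 (by simpa using h1)
    simpa using this
  have hsym : ∀ t ∈ T, -t ∈ T := by
    intro t ht
    have e1 := (hTn 1 t one_pos).2 (by simpa using ht)
    have e2 := reflect_normal hk hK hL h6 hy hsy hx hp ⟨hne 1 t (by positivity), e1⟩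
      (v := ((1 : ℝ) : ℂ) * w + ((-t : ℝ) : ℂ) * u)
      (by have := hdw 1 t 1 0; simp at this ⊢; rw [this]; exact hNpos)
      (by have e3 := hdw 1 t 1 0; have e4 := hdw 1 (-t) 1 0; simp at e3 e4 ⊢; rw [e3, e4])
      (by rw [← sq_eq_sq₀ (norm_nonneg _) (norm_nonneg _), hnorm, hnorm]; ring)
    simpa using (hTn 1 (-t) one_pos).1 e2.2
  have hcl : IsClosed T := by
    have : T = ⋂ z ∈ K, {τ | 0 ≤ dot ((m.cen x).w z) w + τ * dot ((m.cen x).w z) u} := by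
      ext t
      simp [hT]
    rw [this]
    exact isClosed_biInter fun z _ => isClosed_le continuous_const (by fun_prop)
  have hbdd : BddAbove T := by
    obtain ⟨z, hz, hzu⟩ := exists_dot_ne hk hK x hu0
    refine ⟨dot ((m.cen x).w z) w / |dot ((m.cen x).w z) u|, fun t ht => ?_⟩
    rw [le_div_iff₀ (abs_pos.2 hzu)]
    have e1 := ht z hz
    have e2 := hsym t ht z hz
    rcases abs_cases (dot ((m.cen x).w z) u) with ⟨h, -⟩ | ⟨h, -⟩ <;> rw [h] <;> linarith
  set M := sSup T with hM
  have hMT : M ∈ T := hcl.csSup_mem ⟨τ, hτT⟩ hbdd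
  have hM0 : 0 < M := hτ.trans_le (le_csSup hbdd hτT)
  have hMn := (hTn 1 M one_pos).2 (by simpa using hMT)
  have hMn' := (hTn 1 (-M) one_pos).2 (by simpa using hsym _ hMT)
  obtain ⟨μ, ⟨⟨hd, hσ1⟩, hσ2⟩, hμ⟩ : ∃ μ : ℝ, ((w + μ * (((1 : ℝ) : ℂ) * w + M * u) ∈ (m.cen x).dom ∧
      0 < 1 - M * (μ * M / (1 + μ))) ∧
      0 < 1 - (μ * M / (1 + μ)) ^ 2 - 2 * M * (μ * M / (1 + μ))) ∧ 0 < μ := by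
    have c0 : ContinuousAt (fun μ : ℝ => μ * M / (1 + μ)) 0 :=
      ContinuousAt.div (by fun_prop) (by fun_prop) (by norm_num)
    have c1 : ∀ᶠ μ : ℝ in nhds 0, w + μ * (((1 : ℝ) : ℂ) * w + M * u) ∈ (m.cen x).dom := by
      have c2 : Continuous fun μ : ℝ => w + μ * (((1 : ℝ) : ℂ) * w + M * u) := by fun_prop
      refine c2.continuousAt.eventually ((m.cen x).isOpen_dom.mem_nhds ?_)
      simpa using (m.cen x).c_mem_dom hp.2.1
    have c3 : ∀ᶠ μ : ℝ in nhds 0, 0 < 1 - M * (μ * M / (1 + μ)) :=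
      continuousAt_const.eventually_lt (continuousAt_const.sub (continuousAt_const.mul c0))
        (by norm_num)
    have c4 : ∀ᶠ μ : ℝ in nhds 0,
        0 < 1 - (μ * M / (1 + μ)) ^ 2 - 2 * M * (μ * M / (1 + μ)) :=
      continuousAt_const.eventually_lt
        ((continuousAt_const.sub (c0.pow 2)).sub (continuousAt_const.mul c0)) (by norm_num)
    exact ((((c1.and c3).and c4).filter_mono nhdsWithin_le_nhds).and
      (eventually_mem_nhdsWithin (a := (0 : ℝ)) (s := Ioi 0))).exists
  set σ := μ * M / (1 + μ) with hσ
  have h1μ : 0 < 1 + μ := by linarith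
  have hσ0 : 0 < σ := by positivity
  have hdir : w + μ * (((1 : ℝ) : ℂ) * w + M * u) =
      ((1 + μ : ℝ) : ℂ) * w + (((1 + μ) * σ : ℝ) : ℂ) * u := by
    rw [hσ, mul_div_cancel₀ _ h1μ.ne']
    push_cast
    ring
  have hp' := hp.add (n := μ * (((1 : ℝ) : ℂ) * w + M * u)) (fun z hz => by
    rw [dot_mul_right]
    exact mul_nonneg hμ.le (hMn z hz)) (by
    rw [← hw, hdir]
    exact hne _ _ (by positivity)) hd
  rw [← hw, hdir] at hp'
  rw [hdir] at hd
  have hs0 : 0 < 1 + σ ^ 2 := by positivity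
  set A := (1 - σ ^ 2 - 2 * M * σ) / (1 + σ ^ 2) with hA
  set B := (2 * σ + M * (1 - σ ^ 2)) / (1 + σ ^ 2) with hB
  have hApos : 0 < A := div_pos hσ2 hs0
  have e2 := reflect_normal hk hK hL h6 hy hsy hx hp' ⟨hne 1 (-M) (by positivity), hMn'⟩
    (v := (A : ℂ) * w + (B : ℂ) * u)
    (by rw [(m.cen x).c_ci hd, hdw]
        have : 0 < (1 + μ) * (1 - M * σ) := by positivity
        exact mul_pos (by linarith) hNpos)
    (by rw [(m.cen x).c_ci hd, hdw, hdw]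
        congr 1
        rw [hA, hB]
        field_simp
        ring)
    (by rw [← sq_eq_sq₀ (norm_nonneg _) (norm_nonneg _), hnorm, hnorm]
        congr 1
        rw [hA, hB]
        field_simp
        ring)
  have e3 := le_csSup hbdd ((hTn A B hApos).1 e2.2)
  rw [← hM, hA, hB, div_div_div_cancel_right₀ hs0.ne', div_le_iff₀ hσ2] at e3
  nlinarith [mul_pos hσ0 hM0, mul_pos (mul_pos hσ0 hM0) hM0]

theorem smoothAt_of_cond6 (hk : m.k ≠ 1) {K L : Set X} (hK : Body K) (hL : Body L)
    (h6 : T8Cond6 K L) {x : X} (hx : x ∈ frontier K) : m.SmoothAt K x := by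
  obtain ⟨y, hy, hsy⟩ := exists_smoothAt hk hL
  obtain ⟨p, hp⟩ := m.exists_isCentre hK hx
  set w := (m.cen x).c p with hw
  have hw0 : w ≠ 0 := hp.c_ne
  have key : ∀ n, m.IsNormal K x n → dot n (Complex.I * w) = 0 := by
    intro n hn
    by_contra hne
    have hNpos : 0 < ‖w‖ ^ 2 := by positivity
    set α := dot n w / ‖w‖ ^ 2 with hα
    have hdec : ∀ s : ℝ, s ^ 2 = 1 → n = α * w +
        ((s * dot n (Complex.I * w) / ‖w‖ ^ 2 : ℝ) : ℂ) * (s * (Complex.I * w)) := by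
      intro s hs
      rw [← mul_right_inj' (Complex.ofReal_ne_zero.2 hNpos.ne'), mul_add, ← mul_assoc,
        ← mul_assoc, ← Complex.ofReal_mul, ← Complex.ofReal_mul, hα, mul_div_cancel₀ _ hNpos.ne',
        mul_div_cancel₀ _ hNpos.ne', ← mul_assoc, ← Complex.ofReal_mul,
        show s * dot n (Complex.I * w) * s = dot n (Complex.I * w) * s ^ 2 by ring, hs, mul_one,
        Complex.sq_norm, Complex.normSq_apply]
      apply Complex.ext <;> simp [dot] <;> ring
    obtain ⟨s, hs, hspos⟩ : ∃ s : ℝ, s ^ 2 = 1 ∧ 0 < s * dot n (Complex.I * w) := by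
      rcases lt_or_gt_of_ne hne with h | h
      · exact ⟨-1, by norm_num, by linarith⟩
      · exact ⟨1, by norm_num, by linarith⟩
    set β := s * dot n (Complex.I * w) / ‖w‖ ^ 2 with hβ
    have hβ0 : 0 < β := div_pos hspos hNpos
    have hn' := hdec s hs
    set u := (s : ℂ) * (Complex.I * w) with hu
    have hcomb : ∃ μ : ℝ, 0 < μ ∧ 0 < 1 + μ * α := by
      refine ⟨1 / (1 + |α|), by positivity, ?_⟩
      rw [one_div_mul_eq_div, ← sub_neg_eq_add, sub_pos, ← neg_div, div_lt_one (by positivity)]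
      linarith [neg_le_abs α]
    obtain ⟨μ, hμ, hμα⟩ := hcomb
    refine no_wedge hk hK hL h6 hy hsy hx hp (u := u) (τ := μ * β / (1 + μ * α)) ?_ ?_
      (by positivity) ?_
    · rw [hu, dot_mul_left]
      simp only [dot, Complex.mul_re, Complex.mul_im, Complex.I_re, Complex.I_im]
      ring
    · rw [hu, norm_mul, norm_mul, Complex.norm_I, one_mul, Complex.norm_real, Real.norm_eq_abs]
      have : |s| = 1 := by
        rw [← sq_eq_sq₀ (abs_nonneg _) zero_le_one, sq_abs, hs, one_pow]
      rw [this, one_mul]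
    · intro z hz
      have e1 := hp.isNormal.2 z hz
      have e2 := hn.2 z hz
      rw [← hw] at e1 ⊢
      rw [hn', dot_add_right, dot_mul_right, dot_mul_right] at e2
      rw [dot_add_right, dot_mul_right]
      have e3 : 0 ≤ (1 + μ * α) * (dot ((m.cen x).w z) w +
          μ * β / (1 + μ * α) * dot ((m.cen x).w z) u) := by
        rw [mul_add, ← mul_assoc, mul_div_cancel₀ _ hμα.ne']
        nlinarith [mul_nonneg hμ.le e2]
      exact nonneg_of_mul_nonneg_right e3 hμα
  have hz : ∃ z ∈ K, 0 < dot ((m.cen x).w z) w := by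
    obtain ⟨z, hz, h⟩ := exists_dot_ne hk hK x hw0
    exact ⟨z, hz, lt_of_le_of_ne (hp.isNormal.2 z hz) h.symm⟩
  obtain ⟨z, hz, hzw⟩ := hz
  have key2 : ∀ n, m.IsNormal K x n → ∃ r : ℝ, 0 < r ∧ n = r * w := by
    intro n hn
    have hNpos : 0 < ‖w‖ ^ 2 := by positivity
    have e1 := key n hn
    have e2 : n = (dot n w / ‖w‖ ^ 2 : ℝ) * w := by
      rw [← mul_right_inj' (Complex.ofReal_ne_zero.2 hNpos.ne'), ← mul_assoc,
        ← Complex.ofReal_mul, mul_div_cancel₀ _ hNpos.ne', Complex.sq_norm, Complex.normSq_apply]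
      simp only [dot, Complex.mul_re, Complex.mul_im, Complex.I_re, Complex.I_im] at e1 ⊢
      apply Complex.ext
      · simp
        linear_combination -w.im * e1
      · simp
        linear_combination w.re * e1
    have e3 := hn.2 z hz
    refine ⟨_, lt_of_le_of_ne ?_ fun h => hn.1 (by rw [e2, ← h]; simp), e2⟩
    rw [e2, dot_mul_right] at e3
    exact nonneg_of_mul_nonneg_left e3 hzw
  intro n n' hn hn'
  obtain ⟨r, hr, rfl⟩ := key2 n hn
  obtain ⟨r', hr', rfl⟩ := key2 n' hn'
  refine ⟨r' / r, div_pos hr' hr, ?_⟩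
  have : (r : ℂ) ≠ 0 := by exact_mod_cast hr.ne'
  push_cast
  field_simp

end KModel

section Planar

variable {P P' : Set ℂ}

theorem continuous_radial (hc : Convex ℝ P) (h0 : (0 : ℂ) ∈ interior P) :
    Continuous fun t : ℝ => gauge P (Complex.exp (t * Complex.I)) :=
  (continuous_gauge hc (mem_interior_iff_mem_nhds.1 h0)).comp (by fun_prop)

theorem radial_pos (hP : IsCompact P) (h0 : (0 : ℂ) ∈ interior P) (t : ℝ) :
    0 < gauge P (Complex.exp (t * Complex.I)) :=
  (gauge_pos (absorbent_nhds_zero (mem_interior_iff_mem_nhds.1 h0))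
    ((NormedSpace.isVonNBounded_iff ℝ).2 hP.isBounded)).2 (Complex.exp_ne_zero _)

theorem mem_iff_gauge (hP : IsCompact P) (hc : Convex ℝ P) (h0 : (0 : ℂ) ∈ interior P) (z : ℂ) :
    z ∈ P ↔ gauge P z ≤ 1 := by
  rw [gauge_le_one_iff_mem_closure hc (mem_interior_iff_mem_nhds.1 h0), hP.isClosed.closure_eq]

theorem gauge_polar (P : Set ℂ) (z : ℂ) {t : ℝ} (h : z = ‖z‖ * Complex.exp (t * Complex.I)) :
    gauge P z = ‖z‖ * gauge P (Complex.exp (t * Complex.I)) := by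
  conv_lhs => rw [h, ← Complex.real_smul, gauge_smul_of_nonneg (norm_nonneg z), smul_eq_mul]

theorem radial_le (hP : IsCompact P) (hc : Convex ℝ P) (h0 : (0 : ℂ) ∈ interior P)
    (hP' : IsCompact P') (hc' : Convex ℝ P') (h0' : (0 : ℂ) ∈ interior P') (t₀ : ℝ)
    (h : ∀ᶠ z in nhds ((gauge P (Complex.exp (t₀ * Complex.I)))⁻¹ • Complex.exp (t₀ * Complex.I)),
      z ∈ P ↔ z ∈ P') :
    ∀ᶠ t : ℝ in nhds t₀, gauge P' (Complex.exp (t * Complex.I)) ≤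
      gauge P (Complex.exp (t * Complex.I)) := by
  have h1 : ContinuousAt (fun t : ℝ => (gauge P (Complex.exp (t * Complex.I)))⁻¹ •
      Complex.exp (t * Complex.I)) t₀ :=
    ((continuous_radial hc h0).continuousAt.inv₀ (radial_pos hP h0 t₀).ne').smul (by fun_prop)
  filter_upwards [h1.eventually h] with t ht
  have hpos := radial_pos hP h0 t
  have h2 : ∀ Q : Set ℂ, gauge Q ((gauge P (Complex.exp (t * Complex.I)))⁻¹ •
      Complex.exp (t * Complex.I)) = (gauge P (Complex.exp (t * Complex.I)))⁻¹ *
      gauge Q (Complex.exp (t * Complex.I)) := fun Q => by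
    rw [gauge_smul_of_nonneg (inv_nonneg.2 hpos.le), smul_eq_mul]
  rw [mem_iff_gauge hP hc h0, mem_iff_gauge hP' hc' h0', h2, h2, inv_mul_cancel₀ hpos.ne'] at ht
  have h3 := ht.1 le_rfl
  rwa [inv_mul_le_iff₀ hpos, mul_one] at h3

theorem radial_eq (hP : IsCompact P) (hc : Convex ℝ P) (h0 : (0 : ℂ) ∈ interior P)
    (hP' : IsCompact P') (hc' : Convex ℝ P') (h0' : (0 : ℂ) ∈ interior P') (t₀ : ℝ)
    (heq : gauge P (Complex.exp (t₀ * Complex.I)) = gauge P' (Complex.exp (t₀ * Complex.I)))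
    (h : ∀ᶠ z in nhds ((gauge P (Complex.exp (t₀ * Complex.I)))⁻¹ • Complex.exp (t₀ * Complex.I)),
      z ∈ P ↔ z ∈ P') :
    ∀ᶠ t : ℝ in nhds t₀, gauge P (Complex.exp (t * Complex.I)) =
      gauge P' (Complex.exp (t * Complex.I)) := by
  have h' := h.mono fun z hz => hz.symm
  have h2 := radial_le hP hc h0 hP' hc' h0' t₀ h
  rw [heq] at h'
  filter_upwards [h2, radial_le hP' hc' h0' hP hc h0 t₀ h'] with t i1 i2
  exact le_antisymm i2 i1

theorem left_agree (hP : IsCompact P) (hc : Convex ℝ P) (h0 : (0 : ℂ) ∈ interior P)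
    (hP' : IsCompact P') (hc' : Convex ℝ P') (h0' : (0 : ℂ) ∈ interior P') {t₁ t₀ : ℝ} (ht : t₁ < t₀)
    {ρ : ℝ} (hρ : 0 < ρ)
    (h : ∀ t ∈ Ico t₁ t₀, gauge P (Complex.exp (t * Complex.I)) =
      gauge P' (Complex.exp (t * Complex.I))) :
    ∀ᶠ z in nhds (ρ • Complex.exp (t₀ * Complex.I)),
      (z * (starRingEnd ℂ) (ρ • Complex.exp (t₀ * Complex.I))).im < 0 → (z ∈ P ↔ z ∈ P') := by
  set v := ρ • Complex.exp (t₀ * Complex.I) with hv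
  have hvv : v * (starRingEnd ℂ) v = (ρ ^ 2 : ℝ) := by
    rw [Complex.mul_conj, ← Complex.sq_norm, hv, norm_smul, Complex.norm_exp_ofReal_mul_I, mul_one,
      Real.norm_eq_abs, sq_abs]
  have h1 : Tendsto (fun z => Complex.arg (z * (starRingEnd ℂ) v)) (nhds v) (nhds 0) := by
    have h2 : ContinuousAt Complex.arg (v * (starRingEnd ℂ) v) :=
      Complex.continuousAt_arg (by rw [hvv]; exact Or.inl (by rw [Complex.ofReal_re]; positivity))
    have h3 : ContinuousAt (fun z => z * (starRingEnd ℂ) v) v := by fun_prop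
    have h4 := ContinuousAt.comp (f := fun z => z * (starRingEnd ℂ) v) (x := v) h2 h3
    have h5 : Complex.arg (v * (starRingEnd ℂ) v) = 0 := by
      rw [hvv]
      exact Complex.arg_ofReal_of_nonneg (by positivity)
    have h6 := h4.tendsto
    simp only [Function.comp_def, h5] at h6
    exact h6
  filter_upwards [h1.eventually (lt_mem_nhds (show t₁ - t₀ < 0 by linarith))] with z hz him
  set u := z * (starRingEnd ℂ) v with hu
  have hu1 : Complex.arg u < 0 := Complex.arg_neg_iff.2 him
  have hpol : z = ‖z‖ * Complex.exp ((t₀ + Complex.arg u : ℝ) * Complex.I) := by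
    have e1 := Complex.norm_mul_exp_arg_mul_I u
    have e2 : ‖u‖ = ‖z‖ * ρ := by
      rw [hu, norm_mul, RCLike.norm_conj, hv, norm_smul, Complex.norm_exp_ofReal_mul_I, mul_one,
        Real.norm_eq_abs, abs_of_pos hρ]
    have e3 : ((ρ ^ 2 : ℝ) : ℂ) ≠ 0 := by exact_mod_cast (by positivity : ρ ^ 2 ≠ 0)
    apply mul_right_cancel₀ e3
    rw [← hvv]
    calc z * (v * (starRingEnd ℂ) v) = u * v := by rw [hu]; ring
      _ = (‖u‖ * Complex.exp (Complex.arg u * Complex.I)) * v := by rw [e1]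
      _ = _ := by
        rw [hvv, e2, hv, Complex.real_smul]
        push_cast
        rw [add_mul, Complex.exp_add]
        ring
  rw [mem_iff_gauge hP hc h0, mem_iff_gauge hP' hc' h0', gauge_polar P z hpol,
    gauge_polar P' z hpol, h _ ⟨by linarith, by linarith⟩]

theorem eq_of_agree₀ (hP : IsCompact P) (hc : Convex ℝ P) (h0 : (0 : ℂ) ∈ interior P)
    (hP' : IsCompact P') (hc' : Convex ℝ P') (h0' : (0 : ℂ) ∈ interior P')
    (hl : ∀ v ∈ frontier P, v ∈ frontier P' →
      (∀ᶠ z in nhds v, (z * (starRingEnd ℂ) v).im < 0 → (z ∈ P ↔ z ∈ P')) →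
      ∀ᶠ z in nhds v, z ∈ P ↔ z ∈ P')
    {v₀ : ℂ} (hv : v₀ ∈ frontier P) (hv' : v₀ ∈ frontier P')
    (h : ∀ᶠ z in nhds v₀, z ∈ P ↔ z ∈ P') : P = P' := by
  have hn := mem_interior_iff_mem_nhds.1 h0
  have hn' := mem_interior_iff_mem_nhds.1 h0'
  set G := fun t : ℝ => gauge P (Complex.exp (t * Complex.I)) with hG
  set G' := fun t : ℝ => gauge P' (Complex.exp (t * Complex.I)) with hG'
  have hGc : Continuous G := continuous_radial hc h0
  have hGc' : Continuous G' := continuous_radial hc' h0'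
  have hpol : ∀ z : ℂ, z = ‖z‖ * Complex.exp (Complex.arg z * Complex.I) := fun z =>
    (Complex.norm_mul_exp_arg_mul_I z).symm
  set θ := Complex.arg v₀ with hθ
  have g1 : ‖v₀‖ * G θ = 1 := by
    rw [hG, ← gauge_polar P v₀ (hpol v₀)]
    exact (gauge_eq_one_iff_mem_frontier hc hn).2 hv
  have g2 : ‖v₀‖ * G' θ = 1 := by
    rw [hG', ← gauge_polar P' v₀ (hpol v₀)]
    exact (gauge_eq_one_iff_mem_frontier hc' hn').2 hv'
  have hv0 : ‖v₀‖ ≠ 0 := left_ne_zero_of_mul_eq_one g1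
  have heq : G θ = G' θ := mul_left_cancel₀ hv0 (g1.trans g2.symm)
  have hev : ∀ᶠ t : ℝ in nhds θ, G t = G' t := by
    refine radial_eq hP hc h0 hP' hc' h0' θ heq ?_
    have : (G θ)⁻¹ • Complex.exp (θ * Complex.I) = v₀ := by
      rw [← eq_inv_of_mul_eq_one_left g1, Complex.real_smul, ← hpol]
    rwa [this]
  obtain ⟨η, hη, hηe⟩ := Metric.eventually_nhds_iff.1 hev
  set t₁ := θ - η / 2 with ht₁
  set S : Set ℝ := {x | ∀ t ∈ Ico t₁ x, G t = G' t} with hS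
  have hcl : IsClosed S := by
    refine isClosed_of_closure_subset fun x hx t ht => ?_
    obtain ⟨y, hy, hyS⟩ := mem_closure_iff_nhds.1 hx (Ioi t) (Ioi_mem_nhds ht.2)
    exact hyS t ⟨ht.1, hy⟩
  have hθS : θ ∈ S := fun t ht => hηe (by
    rw [Real.dist_eq, abs_lt]
    constructor <;> linarith [ht.1, ht.2])
  have hall : ∀ b, θ ≤ b → b ∈ S := by
    intro b hb
    refine (hcl.inter isClosed_Icc).mem_of_ge_of_forall_exists_gt hθS hb ?_
    rintro x ⟨hxS, hx1, hx2⟩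
    have hlt : t₁ < x := by linarith
    have hxe : G x = G' x := by
      have e1 : Tendsto G (nhdsWithin x (Iio x)) (nhds (G x)) := hGc.continuousWithinAt
      have e2 : Tendsto G' (nhdsWithin x (Iio x)) (nhds (G' x)) := hGc'.continuousWithinAt
      refine tendsto_nhds_unique (e1.congr' ?_) e2
      filter_upwards [Ico_mem_nhdsLT hlt] with t ht using hxS t ht
    have hGx : 0 < G x := radial_pos hP h0 x
    set v := (G x)⁻¹ • Complex.exp (x * Complex.I) with hv
    have f1 : v ∈ frontier P := by
      rw [← gauge_eq_one_iff_mem_frontier hc hn, hv, gauge_smul_of_nonneg (inv_nonneg.2 hGx.le)]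
      exact inv_mul_cancel₀ hGx.ne'
    have f2 : v ∈ frontier P' := by
      rw [← gauge_eq_one_iff_mem_frontier hc' hn', hv, hxe, gauge_smul_of_nonneg (inv_nonneg.2 (hxe ▸ hGx.le))]
      exact inv_mul_cancel₀ (hxe ▸ hGx.ne')
    have f3 := radial_eq hP hc h0 hP' hc' h0' x hxe
      (hl v f1 f2 (left_agree hP hc h0 hP' hc' h0' hlt (inv_pos.2 hGx) hxS))
    obtain ⟨δ, hδ, hδe⟩ := Metric.eventually_nhds_iff.1 f3
    refine ⟨min (x + δ) b, fun t ht => ?_, lt_min (by linarith) hx2, min_le_right _ _⟩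
    rcases lt_or_ge t x with h | h
    · exact hxS t ⟨ht.1, h⟩
    · refine hδe ?_
      rw [Real.dist_eq, abs_of_nonneg (by linarith)]
      linarith [lt_of_lt_of_le ht.2 (min_le_left _ _)]
  have hfin : ∀ t : ℝ, G t = G' t := by
    intro t
    obtain ⟨n, hn⟩ := exists_nat_gt ((t₁ - t) / (2 * Real.pi))
    rw [div_lt_iff₀ (by positivity)] at hn
    have e : Complex.exp (((t + n * (2 * Real.pi) : ℝ) : ℂ) * Complex.I) =
        Complex.exp (t * Complex.I) := by
      push_cast
      rw [add_mul, Complex.exp_add, mul_assoc, Complex.exp_nat_mul,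
        Complex.exp_two_pi_mul_I, one_pow, mul_one]
    have h3 : G (t + n * (2 * Real.pi)) = G' (t + n * (2 * Real.pi)) :=
      hall (max θ (t + n * (2 * Real.pi) + 1)) (le_max_left _ _) _
        ⟨by linarith, lt_of_lt_of_le (lt_add_one _) (le_max_right _ _)⟩
    simp only [hG, hG', e] at h3
    exact h3
  ext z
  rw [mem_iff_gauge hP hc h0, mem_iff_gauge hP' hc' h0', gauge_polar P z (hpol z),
    gauge_polar P' z (hpol z)]
  have := hfin (Complex.arg z)
  simp only [hG, hG'] at this
  rw [this]

/-- Two planar convex bodies which agree near a common boundary point are equal, if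
one-sided agreement at common boundary points always propagates to the other side. -/
theorem eq_of_agree (hP : IsCompact P) (hc : Convex ℝ P) {O : ℂ} (h0 : O ∈ interior P)
    (hP' : IsCompact P') (hc' : Convex ℝ P') (h0' : O ∈ interior P')
    (hl : ∀ v ∈ frontier P, v ∈ frontier P' →
      (∀ᶠ z in nhds v, ((z - O) * (starRingEnd ℂ) (v - O)).im < 0 → (z ∈ P ↔ z ∈ P')) →
      ∀ᶠ z in nhds v, z ∈ P ↔ z ∈ P')
    {v₀ : ℂ} (hv : v₀ ∈ frontier P) (hv' : v₀ ∈ frontier P')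
    (h : ∀ᶠ z in nhds v₀, z ∈ P ↔ z ∈ P') : P = P' := by
  set f := Homeomorph.addRight O with hf
  have hfz : ∀ z, f z = z + O := fun z => rfl
  have hm : ∀ (v : ℂ) (p : ℂ → Prop), (∀ᶠ z in nhds (v + O), p z) ↔ ∀ᶠ z in nhds v, p (z + O) := fun v p => by
    rw [← hfz, ← f.map_nhds_eq, eventually_map]
    rfl
  have hconv : ∀ {Q : Set ℂ}, Convex ℝ Q → Convex ℝ (f ⁻¹' Q) := fun hQ =>
    hQ.translate_preimage_left O
  refine f.surjective.preimage_injective (eq_of_agree₀ (f.isCompact_preimage.2 hP) (hconv hc) ?_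
    (f.isCompact_preimage.2 hP') (hconv hc') ?_ ?_ (v₀ := v₀ - O) ?_ ?_ ?_)
  · rw [← f.preimage_interior, mem_preimage, hfz, zero_add]
    exact h0
  · rw [← f.preimage_interior, mem_preimage, hfz, zero_add]
    exact h0'
  · intro v h1 h2 h3
    rw [← f.preimage_frontier, mem_preimage, hfz] at h1 h2
    refine (hm v (fun z => z ∈ P ↔ z ∈ P')).1 (hl _ h1 h2 ((hm _ _).2 ?_))
    simp only [add_sub_cancel_right]
    exact h3
  · rw [← f.preimage_frontier, mem_preimage, hfz, sub_add_cancel]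
    exact hv
  · rw [← f.preimage_frontier, mem_preimage, hfz, sub_add_cancel]
    exact hv'
  · refine (hm _ (fun z => z ∈ P ↔ z ∈ P')).1 ?_
    rwa [sub_add_cancel]

end Planar

theorem dot_I_mul_self (N : ℂ) : dot N (Complex.I * N) = 0 := by
  simp [dot]; ring

theorem dot_I_mul_I_mul (N : ℂ) : dot (Complex.I * N) (Complex.I * N) = dot N N := by
  simp [dot]; ring

theorem smul_eq_dot_add (N w : ℂ) :
    ((dot N N : ℝ) : ℂ) * w = (dot w N : ℝ) * N + (dot w (Complex.I * N) : ℝ) * (Complex.I * N) := by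
  apply Complex.ext <;> simp [dot] <;> ring

theorem eq_of_dot_I {N u v : ℂ} (hN : N ≠ 0) (h1 : dot u N = dot v N)
    (h2 : dot u (Complex.I * N) = dot v (Complex.I * N)) : u = v := by
  have h3 : ((dot N N : ℝ) : ℂ) ≠ 0 := by
    rw [dot_self]; exact_mod_cast (by positivity : ‖N‖ ^ 2 ≠ 0)
  apply mul_left_cancel₀ h3
  rw [smul_eq_dot_add, smul_eq_dot_add N v, h1, h2]

theorem eq_self_or_reflect {N : ℂ} (hN : N ≠ 0) (A : ℂ ≃ₗᵢ[ℝ] ℂ) (hA : A N = N) :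
    (∀ w, A w = w) ∨ ∀ w, dot (A w) (Complex.I * N) = -dot w (Complex.I * N) := by
  have h0 : ∀ w, dot (A w) N = dot w N := fun w => by
    conv_lhs => rw [← hA]
    rw [dot_map]
  have hpos : 0 < dot N N := by rw [dot_self]; positivity
  have h1 : dot (A (Complex.I * N)) (Complex.I * N) ^ 2 = dot N N ^ 2 := by
    have e1 : ∀ w, dot w N ^ 2 + dot w (Complex.I * N) ^ 2 = dot w w * dot N N := fun w => by
      simp [dot]; ring
    have e2 := e1 (A (Complex.I * N))
    rw [h0, dot_map, dot_comm, dot_I_mul_self, dot_I_mul_I_mul] at e2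
    linarith
  rcases sq_eq_sq_iff_eq_or_eq_neg.1 h1 with h | h
  · left
    have h2 : A (Complex.I * N) = Complex.I * N := eq_of_dot_I hN (h0 _) (by
      rw [h, dot_I_mul_I_mul])
    intro w
    refine eq_of_dot_I hN (h0 w) ?_
    conv_lhs => rw [← h2]
    rw [dot_map]
  · right
    have h2 : A (Complex.I * N) = -(Complex.I * N) := eq_of_dot_I hN (by
      rw [h0, dot_neg_left, dot_comm, dot_I_mul_self, neg_zero]) (by
      rw [h, dot_neg_left, dot_I_mul_I_mul])
    intro w
    rw [← neg_eq_iff_eq_neg, ← dot_neg_right, ← h2, dot_map]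

namespace KModel
variable {m : KModel X}

/-- A smooth body contains the small points of each cone in the open tangent half plane. -/
theorem SmoothAt.cone {C : Set X} (hC : Body C) {x : X} (hx : x ∈ C) (hs : m.SmoothAt C x) {n : ℂ}
    (hn : m.IsNormal C x n) {h₁ h₂ : ℂ} (hh₁ : 0 < dot h₁ n) (hh₂ : 0 < dot h₂ n) :
    ∀ᶠ z in nhds x, (∃ a b : ℝ, 0 ≤ a ∧ 0 ≤ b ∧ (m.cen x).w z = a * h₁ + b * h₂) → z ∈ C := by
  set M := m.cen x with hM
  have hxU : x ∈ M.U := m.self_mem_cen_U x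
  have hQc : Convex ℝ (M.c '' (C ∩ M.U)) := GConvex.convex_image M hC.conv
  have h0Q : (0 : ℂ) ∈ M.c '' (C ∩ M.U) := ⟨x, ⟨hx, hxU⟩, m.cen_c_self x⟩
  have hdom : ∀ h : ℂ, ∀ᶠ s : ℝ in nhdsWithin 0 (Ioi 0), (s : ℂ) * h ∈ M.dom := fun h =>
    (tendsto_ray h).eventually (M.isOpen_dom.mem_nhds M.zero_mem_dom)
  obtain ⟨s, ⟨⟨s1, s2⟩, s3, s4⟩, s0⟩ := (((hs.inward hC hx hn hh₁).and (hdom h₁)).and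
    ((hs.inward hC hx hn hh₂).and (hdom h₂)) |>.and eventually_mem_nhdsWithin).exists
  have s0 : 0 < s := s0
  have q1 : (s : ℂ) * h₁ ∈ M.c '' (C ∩ M.U) :=
    ⟨_, ⟨interior_subset s1, M.ci_mem_U s2⟩, M.c_ci s2⟩
  have q2 : (s : ℂ) * h₂ ∈ M.c '' (C ∩ M.U) :=
    ⟨_, ⟨interior_subset s3, M.ci_mem_U s4⟩, M.c_ci s4⟩
  set d := min (dot h₁ n) (dot h₂ n) with hd
  have hd0 : 0 < d := lt_min hh₁ hh₂
  have hc : ∀ᶠ z in nhds x, dot (M.c z) n < s * d := by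
    have h1 : ContinuousAt M.c x := M.continuousOn_c.continuousAt (M.isOpen_U.mem_nhds hxU)
    have h2 : ContinuousAt (fun z => dot (M.c z) n) x := by
      have h3 : Continuous fun u : ℂ => dot u n := by unfold dot; fun_prop
      exact h3.continuousAt.comp h1
    refine h2.eventually_lt continuousAt_const ?_
    rw [hM, m.cen_c_self, dot_zero_left]
    positivity
  filter_upwards [hc, M.isOpen_U.mem_nhds hxU] with z hz hzU ⟨a, b, ha, hb, hab⟩
  have hzU : z ∈ M.U := hzU
  suffices M.c z ∈ M.c '' (C ∩ M.U) by
    obtain ⟨y, hy, hyz⟩ := this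
    rw [← M.c_inj hy.2 hzU hyz]
    exact hy.1
  have ht : 0 < M.t z := M.mem_U.1 hzU
  set a' := (M.t z)⁻¹ * a with ha'
  set b' := (M.t z)⁻¹ * b with hb'
  have a0 : 0 ≤ a' := by positivity
  have b0 : 0 ≤ b' := by positivity
  have hcz : M.c z = a' * h₁ + b' * h₂ := by
    rw [KModel.c, hab, ha', hb']; push_cast; ring
  rw [hcz, dot_add_left, dot_mul_left, dot_mul_left] at hz
  have hs1 : (a' + b') * d < s * d := by
    nlinarith [mul_le_mul_of_nonneg_left (min_le_left (dot h₁ n) (dot h₂ n)) a0,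
      mul_le_mul_of_nonneg_left (min_le_right (dot h₁ n) (dot h₂ n)) b0]
  have hs2 : a' + b' < s := lt_of_mul_lt_mul_right hs1 hd0.le
  rcases (add_nonneg a0 b0).eq_or_lt with h0 | h0
  · have e1 : a' = 0 := by linarith
    have e2 : b' = 0 := by linarith
    rw [hcz, e1, e2]
    simpa using h0Q
  · have h3 := hQc q1 q2 (a := a' / (a' + b')) (b := b' / (a' + b')) (by positivity) (by positivity)
      (by field_simp)
    have h4 := hQc.smul_mem_of_zero_mem h0Q h3 (t := (a' + b') / s)
      ⟨by positivity, (div_le_one s0).2 hs2.le⟩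
    convert h4 using 1
    rw [hcz]
    have e1 : (s : ℂ) ≠ 0 := Complex.ofReal_ne_zero.2 s0.ne'
    have e2 : (a' : ℂ) + b' ≠ 0 := by exact_mod_cast h0.ne'
    simp only [Complex.real_smul]
    push_cast
    field_simp

theorem SmoothAt.mem_iff_of_dot {C : Set X} (hC : Body C) {x : X} (hx : x ∈ C) (hs : m.SmoothAt C x)
    {n : ℂ} (hn : m.IsNormal C x n) (α : ℝ) {β : ℝ} (hβ : β ≠ 0) :
    ∀ᶠ z in nhds x,
      α * dot ((m.cen x).w z) n + β * dot ((m.cen x).w z) (Complex.I * n) < 0 ∨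
      α * dot ((m.cen x).w z) n - β * dot ((m.cen x).w z) (Complex.I * n) < 0 ∨
      (z ∈ C ↔ 0 ≤ dot ((m.cen x).w z) n) := by
  have hpos : 0 < dot n n := by
    have := hn.1
    rw [dot_self]; positivity
  set K := |α| / |β| + 1 with hK
  have hβ' : 0 < |β| := abs_pos.2 hβ
  have hK0 : 0 < K := by positivity
  have hd : ∀ r : ℝ, dot (n + r * (Complex.I * n)) n = dot n n := fun r => by
    rw [dot_add_left, dot_mul_left, dot_comm (Complex.I * n), dot_I_mul_self, mul_zero, add_zero]
  filter_upwards [hs.cone hC hx hn (h₁ := n + (K : ℝ) * (Complex.I * n))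
    (h₂ := n + ((-K : ℝ) : ℂ) * (Complex.I * n)) (by rwa [hd]) (by rwa [hd])] with z hz
  by_contra! hcon
  obtain ⟨h1, h2, h3⟩ := hcon
  set W := (m.cen x).w z with hW
  have h4 : z ∈ C → 0 ≤ dot W n := hn.2 z
  have h5 : 0 ≤ dot W n ∧ z ∉ C := by
    rcases h3 with h | h
    · exact absurd (h4 h.1) (not_le.2 h.2)
    · exact ⟨h.2, h.1⟩
  apply h5.2
  apply hz
  have h6 : |dot W (Complex.I * n)| ≤ K * dot W n := by
    have e1 : |β * dot W (Complex.I * n)| ≤ α * dot W n := abs_le.2 ⟨by linarith, by linarith⟩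
    rw [abs_mul] at e1
    have e2 : |β| * |dot W (Complex.I * n)| ≤ |β| * (K * dot W n) := by
      refine e1.trans ?_
      have : |β| * K = |α| + |β| := by rw [hK]; field_simp
      rw [← mul_assoc, this]
      nlinarith [le_abs_self α, h5.1, mul_nonneg hβ'.le h5.1]
    exact le_of_mul_le_mul_left e2 hβ'
  obtain ⟨h7, h8⟩ := abs_le.1 h6
  refine ⟨(K * dot W n + dot W (Complex.I * n)) / (2 * K * dot n n),
    (K * dot W n - dot W (Complex.I * n)) / (2 * K * dot n n),
    div_nonneg (by linarith) (by positivity), div_nonneg (by linarith) (by positivity), ?_⟩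
  have e3 : ((dot n n : ℝ) : ℂ) ≠ 0 := Complex.ofReal_ne_zero.2 hpos.ne'
  have e4 : (K : ℂ) ≠ 0 := Complex.ofReal_ne_zero.2 hK0.ne'
  apply mul_left_cancel₀ e3
  rw [smul_eq_dot_add]
  push_cast
  field_simp
  ring

theorem normal_of_agree {C C' : Set X} (hC : Body C) {x : X} (hx : x ∈ C)
    (hs : m.SmoothAt C x) {n n' : ℂ} (hn : m.IsNormal C x n) (hn' : m.IsNormal C' x n') {e h : ℂ}
    (hl : ∀ᶠ z in nhds x, dot ((m.cen x).w z) e < 0 → (z ∈ C ↔ z ∈ C'))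
    (hhe : dot h e < 0) (hhn : 0 < dot h n) : 0 ≤ dot h n' := by
  obtain ⟨s, ⟨⟨h1, h2⟩, r, hr, h3⟩, r', hr', h4⟩ := ((((hs.inward hC hx hn hhn).and
    (m.eventually_ray hl h))).and (m.dot_w_ray x h e) |>.and (m.dot_w_ray x h n')).exists
  have h5 := hn'.2 _ ((h2 (by rw [h3]; exact mul_neg_of_pos_of_neg hr hhe)).1 (interior_subset h1))
  rw [h4] at h5
  exact nonneg_of_mul_nonneg_right h5 hr'

theorem normal_eq_of_agree {C C' : Set X} (hC : Body C) (hC' : Body C') {x : X} (hx : x ∈ C)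
    (hx' : x ∈ C') (hs : m.SmoothAt C x) (hs' : m.SmoothAt C' x) {n n' : ℂ}
    (hn : m.IsNormal C x n) (hn' : m.IsNormal C' x n') {e h : ℂ} (he : e ≠ 0)
    (hl : ∀ᶠ z in nhds x, dot ((m.cen x).w z) e < 0 → (z ∈ C ↔ z ∈ C'))
    (hhe : dot h e = 0) (hhn : 0 < dot h n) (hhn' : 0 < dot h n') :
    ∃ r : ℝ, 0 < r ∧ n' = r * n := by
  have hpos : 0 < dot e e := by rw [dot_self]; positivity
  have key : ∀ {C C' : Set X} {n n' : ℂ}, Body C → x ∈ C → m.SmoothAt C x → m.IsNormal C x n →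
      m.IsNormal C' x n' → (∀ᶠ z in nhds x, dot ((m.cen x).w z) e < 0 → (z ∈ C ↔ z ∈ C')) →
      0 < dot h n → 0 < dot h n' → dot e n' * dot h n ≤ dot e n * dot h n' := by
    intro C C' n n' hC hx hs hn hn' hl hhn hhn'
    by_contra! hlt
    have h1 : dot e n / dot h n < dot e n' / dot h n' := by
      rw [div_lt_div_iff₀ hhn hhn']
      exact hlt
    obtain ⟨r, hr1, hr2⟩ := exists_between h1
    rw [div_lt_iff₀ hhn] at hr1
    rw [lt_div_iff₀ hhn'] at hr2
    have h2 := normal_of_agree hC hx hs hn hn' hl (h := r * h - e)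
      (by rw [dot_sub_left, dot_mul_left, hhe]; linarith)
      (by rw [dot_sub_left, dot_mul_left]; linarith)
    rw [dot_sub_left, dot_mul_left] at h2
    linarith
  have h1 := key hC hx hs hn hn' hl hhn hhn'
  have h2 := key hC' hx' hs' hn' hn (hl.mono fun z hz h => (hz h).symm) hhn' hhn
  refine ⟨dot h n' / dot h n, div_pos hhn' hhn, ?_⟩
  have h3 : dot e n' = dot h n' / dot h n * dot e n := by
    field_simp
    linarith
  have h4 : dot h n' = dot h n' / dot h n * dot h n := by field_simp
  have hh0 : h ≠ 0 := by rintro rfl; exact absurd hhn (by simp [dot])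
  set u := n' - (dot h n' / dot h n : ℝ) * n with hu
  have u1 : dot e u = 0 := by rw [hu, dot_sub_right, dot_mul_right]; linarith
  have u2 : dot h u = 0 := by rw [hu, dot_sub_right, dot_mul_right]; linarith
  have h5 : dot e h ^ 2 + dot (Complex.I * e) h ^ 2 = dot e e * dot h h := by simp [dot]; ring
  have hh1 : 0 < dot h h := by rw [dot_self]; positivity
  have h6 : dot (Complex.I * e) h ≠ 0 := by
    intro h0
    rw [h0, dot_comm, hhe] at h5
    nlinarith [mul_pos hpos hh1]
  have h7 : ((dot (Complex.I * e) h : ℝ) : ℂ) * u = (dot h u : ℝ) * (Complex.I * e) - (dot e u : ℝ) * (Complex.I * h) := by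
    apply Complex.ext <;> simp [dot] <;> ring
  rw [u1, u2] at h7
  have h8 : u = 0 := by
    have : ((dot (Complex.I * e) h : ℝ) : ℂ) ≠ 0 := Complex.ofReal_ne_zero.2 h6
    simpa [this] using h7
  exact sub_eq_zero.1 h8

end KModel

namespace KModel
variable {m : KModel X}

theorem linear_of_local {C C' : Set X} (hC' : Body C') {x : X} (hx' : x ∈ C')
    (hs' : m.SmoothAt C' x) {n : ℂ} (hn : m.IsNormal C x n) (hn' : m.IsNormal C' x n)
    (g : X ≃ᵢ X) (hg : g x = x) (hl : ∀ᶠ z in nhds x, z ∈ C ↔ g z ∈ C') :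
    ∃ A : ℂ ≃ₗᵢ[ℝ] ℂ, (∀ z, (m.cen x).w (g z) = A ((m.cen x).w z)) ∧ A n = n := by
  obtain ⟨A, hA⟩ := (m.cen x).exists_linear_of_fix g (by rw [cen_o]; exact hg)
  refine ⟨A, hA, ?_⟩
  have h1 : m.IsNormal C' x (A n) := by
    refine m.isNormal_of_local hC' hx' (fun h0 => hn.1 ((map_eq_zero_iff A A.injective).1 h0)) ?_
    have h2 : Tendsto g.symm (nhds x) (nhds x) := by
      have h3 := g.symm.continuous.tendsto x
      rwa [show g.symm x = x by rw [IsometryEquiv.symm_apply_eq, hg]] at h3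
    filter_upwards [h2.eventually hl] with z hz hzC
    rw [g.apply_symm_apply] at hz
    have h4 := hn.2 _ (hz.2 hzC)
    rwa [← dot_map A, ← hA, g.apply_symm_apply] at h4
  obtain ⟨r, hr, h2⟩ := hs' n _ hn' h1
  have h3 : ‖A n‖ = ‖n‖ := A.norm_map n
  rw [h2, norm_mul, Complex.norm_real, Real.norm_of_nonneg hr.le] at h3
  have h4 : r = 1 := by
    have := norm_pos_iff.2 hn.1
    nlinarith
  rw [h2, h4, Complex.ofReal_one, one_mul]

theorem refl_or_reflect {x : X} {n : ℂ} (hn : n ≠ 0) (g : X ≃ᵢ X) (hg : g x = x)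
    {A : ℂ ≃ₗᵢ[ℝ] ℂ} (hA : ∀ z, (m.cen x).w (g z) = A ((m.cen x).w z)) (hAn : A n = n) :
    g = IsometryEquiv.refl X ∨
    ∀ z, dot ((m.cen x).w (g z)) n = dot ((m.cen x).w z) n ∧
      dot ((m.cen x).w (g z)) (Complex.I * n) = -dot ((m.cen x).w z) (Complex.I * n) := by
  have hg' : g (m.cen x).o = (m.cen x).o := by rw [cen_o]; exact hg
  rcases eq_self_or_reflect hn A hAn with h | h
  · exact Or.inl ((m.cen x).eq_refl_of_w g hg' fun z => by rw [hA, h])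
  · refine Or.inr fun z => ⟨?_, by rw [hA, h]⟩
    conv_lhs => rw [hA, ← hAn]
    rw [dot_map]

theorem eq_of_reflect {x : X} {n : ℂ} (hn : n ≠ 0) (g g' : X ≃ᵢ X) (hg : g x = x) (hg' : g' x = x)
    (h : ∀ z, dot ((m.cen x).w (g z)) n = dot ((m.cen x).w z) n ∧
      dot ((m.cen x).w (g z)) (Complex.I * n) = -dot ((m.cen x).w z) (Complex.I * n))
    (h' : ∀ z, dot ((m.cen x).w (g' z)) n = dot ((m.cen x).w z) n ∧
      dot ((m.cen x).w (g' z)) (Complex.I * n) = -dot ((m.cen x).w z) (Complex.I * n)) (z : X) :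
    g z = g' z := by
  refine (m.cen x).ext _ _ (eq_of_dot_I hn ((h z).1.trans (h' z).1.symm)
    ((h z).2.trans (h' z).2.symm)) ?_
  rw [(m.cen x).t_eq_of_fix g (by rw [cen_o]; exact hg),
    (m.cen x).t_eq_of_fix g' (by rw [cen_o]; exact hg')]

theorem tendsto_of_fix {x : X} (g : X ≃ᵢ X) (hg : g x = x) : Tendsto g (nhds x) (nhds x) := by
  have := g.continuous.tendsto x
  rwa [hg] at this

/-- One-sided agreement of two bodies at a common smooth boundary point propagates to the other
side of the point. -/
theorem agree_at {C C' : Set X} (hC : Body C) (hC' : Body C') {x : X} (hx : x ∈ frontier C)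
    (hx' : x ∈ frontier C') (hs : m.SmoothAt C x) (hs' : m.SmoothAt C' x)
    (hloc : (SymAt C x ∧ SymAt C' x) ∨ (CongAt C C' x x ∧ ¬ SymAt C x))
    {e : ℂ} (he : e ≠ 0) {u : X} (hu : u ∈ C) (hu' : u ∈ C') (hux : u ≠ x)
    (hue : dot ((m.cen x).w u) e = 0)
    (hl : ∀ᶠ z in nhds x, dot ((m.cen x).w z) e < 0 → (z ∈ C ↔ z ∈ C')) :
    ∀ᶠ z in nhds x, z ∈ C ↔ z ∈ C' := by
  have hxC : x ∈ C := hC.closed.frontier_subset hx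
  have hxC' : x ∈ C' := hC'.closed.frontier_subset hx'
  obtain ⟨p, hp⟩ := m.exists_isCentre hC hx
  obtain ⟨p', hp'⟩ := m.exists_isCentre hC' hx'
  set n := (m.cen x).c p with hn
  have hq : 0 < (m.cen x).q x u := (m.cen x).q_pos hux.symm
  have hun : 0 < dot ((m.cen x).w u) n := lt_of_lt_of_le (half_pos hq) (hp.le hu)
  have hun' : 0 < dot ((m.cen x).w u) ((m.cen x).c p') :=
    lt_of_lt_of_le (half_pos hq) (hp'.le hu')
  have hN := hp.isNormal
  have hn0 : n ≠ 0 := hN.1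
  obtain ⟨r, hr, hr'⟩ := normal_eq_of_agree hC hC' hxC hxC' hs hs' hN hp'.isNormal he hl hue hun hun'
  have hN' : m.IsNormal C' x n := ⟨hN.1, fun z hz => by
    have h1 := hp'.isNormal.2 z hz
    rw [hr', dot_mul_right] at h1
    exact nonneg_of_mul_nonneg_right h1 hr⟩
  have hpos : 0 < dot n n := by rw [dot_self]; positivity
  have hdec : ∀ w, dot n n * dot w e =
      dot e n * dot w n + dot e (Complex.I * n) * dot w (Complex.I * n) := fun w => by
    simp [dot]; ring
  set α := dot e n with hα
  set β := dot e (Complex.I * n) with hβ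
  have hneg : ∀ w, α * dot w n + β * dot w (Complex.I * n) < 0 → dot w e < 0 := fun w h => by
    rw [← hdec] at h
    exact neg_of_mul_neg_right h hpos.le
  have hβ0 : β ≠ 0 := by
    intro h0
    have h1 := hdec ((m.cen x).w u)
    rw [hue, h0, zero_mul, add_zero, mul_zero] at h1
    have h2 : α = 0 := by
      rcases mul_eq_zero.1 h1.symm with h | h
      · exact h
      · exact absurd h hun.ne'
    exact he (eq_of_dot_I hn0 (by rw [← hα, h2, dot_zero_left]) (by rw [← hβ, h0, dot_zero_left]))
  have hD := hs.mem_iff_of_dot hC hxC hN α hβ0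
  have hD' := hs'.mem_iff_of_dot hC' hxC' hN' α hβ0
  rcases hloc with ⟨⟨σ, hσ1, hσx, hσ⟩, τ, hτ1, hτx, hτ⟩ | ⟨⟨g, hgx, hg⟩, hns⟩
  · obtain ⟨A, hA, hAn⟩ := linear_of_local hC hxC hs hN hN σ hσx hσ
    obtain ⟨B, hB, hBn⟩ := linear_of_local hC' hxC' hs' hN' hN' τ hτx hτ
    have hA' := (refl_or_reflect hn0 σ hσx hA hAn).resolve_left hσ1
    have hB' := (refl_or_reflect hn0 τ hτx hB hBn).resolve_left hτ1
    have hστ := eq_of_reflect hn0 σ τ hσx hτx hA' hB'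
    filter_upwards [hD, hD', hl, (tendsto_of_fix σ hσx).eventually hl, hσ, hτ]
      with z h1 h2 h3 h4 h5 h6
    rcases h1 with h | h | h
    · exact h3 (hneg _ h)
    · rw [h5, h6, ← hστ]
      refine h4 (hneg _ ?_)
      rw [(hA' z).1, (hA' z).2]
      linarith
    · rcases h2 with h' | h' | h'
      · exact h3 (hneg _ h')
      · rw [h5, h6, ← hστ]
        refine h4 (hneg _ ?_)
        rw [(hA' z).1, (hA' z).2]
        linarith
      · rw [h, h']
  · by_cases hg1 : g = IsometryEquiv.refl X
    · rw [hg1] at hg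
      exact hg
    refine absurd ⟨g, hg1, hgx, ?_⟩ hns
    obtain ⟨A, hA, hAn⟩ := linear_of_local hC' hxC' hs' hN hN' g hgx hg
    have hA' := (refl_or_reflect hn0 g hgx hA hAn).resolve_left hg1
    have hgg : ∀ z, g (g z) = z := fun z =>
      (m.cen x).ext _ _ (eq_of_dot_I hn0 ((hA' _).1.trans (hA' _).1)
        (by rw [(hA' _).2, (hA' _).2, neg_neg])) (by
        rw [(m.cen x).t_eq_of_fix g (by rw [cen_o]; exact hgx),
          (m.cen x).t_eq_of_fix g (by rw [cen_o]; exact hgx)])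
    have hT := tendsto_of_fix g hgx
    filter_upwards [hD, hT.eventually hD, hl, hT.eventually hl, hg, hT.eventually hg]
      with z h1 h2 h3 h4 h5 h6
    have c1 : α * dot ((m.cen x).w z) n + β * dot ((m.cen x).w z) (Complex.I * n) < 0 →
        (z ∈ C ↔ g z ∈ C) := fun h => by
      rw [h6, hgg]
      exact h3 (hneg _ h)
    have c2 : α * dot ((m.cen x).w z) n - β * dot ((m.cen x).w z) (Complex.I * n) < 0 →
        (z ∈ C ↔ g z ∈ C) := fun h => by
      rw [h5]
      refine (h4 (hneg _ ?_)).symm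
      rw [(hA' z).1, (hA' z).2]
      linarith
    rw [(hA' z).1, (hA' z).2, mul_neg, sub_neg_eq_add, ← sub_eq_add_neg] at h2
    rcases h1 with h | h | h
    · exact c1 h
    · exact c2 h
    · rcases h2 with h' | h' | h'
      · exact c2 h'
      · exact c1 h'
      · rw [h, h']

end KModel

namespace KModel
variable {m : KModel X}

theorem eventually_c {x : X} (hx : x ∈ m.U) {p : ℂ → Prop} :
    (∀ᶠ z in nhds (m.c x), p z) ↔ ∀ᶠ y in nhds x, p (m.c y) := by
  rw [← m.map_c_nhds hx, eventually_map]

theorem frontier_image_c {C : Set X} (h : Body C) (hU : C ⊆ m.U) :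
    frontier (m.c '' C) = m.c '' frontier C := by
  obtain ⟨h1, -, h3⟩ := m.image_c h hU
  rw [h1.isClosed.frontier_eq, h3, h.closed.frontier_eq]
  ext z
  constructor
  · rintro ⟨⟨x, hx, rfl⟩, hz⟩
    exact ⟨x, ⟨hx, fun hi => hz (mem_image_of_mem _ hi)⟩, rfl⟩
  · rintro ⟨x, ⟨hx, hi⟩, rfl⟩
    refine ⟨mem_image_of_mem _ hx, ?_⟩
    rintro ⟨y, hy, hyx⟩
    exact hi (m.c_inj (hU (interior_subset hy)) (hU hx) hyx ▸ hy)

theorem mem_frontier_of_agree {C C' : Set X} {x : X} (hx : x ∈ frontier C)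
    (hl : ∀ᶠ z in nhds x, z ∈ C ↔ z ∈ C') : x ∈ frontier C' := by
  have h1 : nhdsWithin x C = nhdsWithin x C' := by
    rw [nhdsWithin_eq_iff_eventuallyEq]
    filter_upwards [hl] with z hz using propext hz
  refine ⟨?_, fun hi => hx.2 ?_⟩
  · rw [mem_closure_iff_nhdsWithin_neBot, ← h1, ← mem_closure_iff_nhdsWithin_neBot]
    exact hx.1
  · rw [mem_interior_iff_mem_nhds] at hi ⊢
    filter_upwards [hi, hl] with z hz hzl using hzl.2 hz

theorem IsCentre.of_smul_le {C : Set X} {x p p' : X} (h : m.IsCentre C x p)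
    (h' : p' ∈ (m.cen x).U) {r : ℝ} (hr : 1 ≤ r) (hp : (m.cen x).c p' = r * (m.cen x).c p) :
    m.IsCentre C x p' := by
  have h1 : (m.cen x).c p + ((r - 1 : ℝ) : ℂ) * (m.cen x).c p = (m.cen x).c p' := by
    rw [hp]; push_cast; ring
  have h2 := h.add (n := ((r - 1 : ℝ) : ℂ) * (m.cen x).c p) (fun z hz => by
    rw [dot_mul_right]
    exact mul_nonneg (by linarith) (h.isNormal.2 z hz)) (by
    rw [h1, hp]
    exact mul_ne_zero (Complex.ofReal_ne_zero.2 (by linarith)) h.c_ne) (by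
    rw [h1]
    exact (m.cen x).c_mem_dom h')
  rwa [h1, (m.cen x).ci_c h'] at h2

theorem exists_common_U {C C' : Set X} (hC : Body C) (hC' : Body C') {x : X}
    (hx : x ∈ frontier C) (hx' : x ∈ frontier C') (hs' : m.SmoothAt C' x)
    (hl : ∀ᶠ z in nhds x, z ∈ C ↔ z ∈ C') : ∃ p, C ⊆ (m.cen p).U ∧ C' ⊆ (m.cen p).U := by
  obtain ⟨p, hp⟩ := m.exists_isCentre hC hx
  obtain ⟨p', hp'⟩ := m.exists_isCentre hC' hx'
  have h1 : m.IsNormal C' x ((m.cen x).c p) := by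
    refine m.isNormal_of_local hC' (hC'.closed.frontier_subset hx') hp.c_ne ?_
    filter_upwards [hl] with z hz hzC using hp.isNormal.2 z (hz.2 hzC)
  obtain ⟨r, hr, hr'⟩ := hs' _ _ h1 hp'.isNormal
  rcases le_total 1 r with h | h
  · exact ⟨p', (hp.of_smul_le hp'.2.1 h hr').subset_U, hp'.subset_U⟩
  · refine ⟨p, hp.subset_U, (hp'.of_smul_le (r := r⁻¹) hp.2.1 ?_ ?_).subset_U⟩
    · exact (one_le_inv₀ hr).2 h
    · rw [hr', ← mul_assoc, ← Complex.ofReal_mul, inv_mul_cancel₀ hr.ne', Complex.ofReal_one,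
        one_mul]

theorem exists_line_functional (p : X) {y u : X} (hy : y ∈ (m.cen p).U) :
    ∃ e : ℂ, (u ∈ (m.cen p).U → dot ((m.cen y).w u) e = 0) ∧
      ∀ z ∈ (m.cen p).U, dot ((m.cen y).w z) e = (m.cen p).t z * (((m.cen p).c z -
        (m.cen p).c u) * (starRingEnd ℂ) ((m.cen p).c y - (m.cen p).c u)).im := by
  set M := m.cen p with hM
  set d := M.c y - M.c u with hd
  set l : X → ℝ := fun z => dot (M.w z) (Complex.I * d) + -dot (M.c u) (Complex.I * d) * M.t z
    with hl
  have h1 : M.LinF l := ⟨_, _, fun z => rfl⟩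
  have h2 : ∀ z ∈ M.U, l z = M.t z * ((M.c z - M.c u) * (starRingEnd ℂ) d).im := fun z hz => by
    simp only [hl]
    rw [M.w_eq hz, dot_mul_left]
    simp [dot]; ring
  obtain ⟨e, b, h3⟩ := (m.cen_linF_iff y).2 ((m.cen_linF_iff p).1 h1)
  have h4 : b = 0 := by
    have h5 := h2 y hy
    rw [h3, cen_w_self, dot_zero_left, cen_t_self, Complex.mul_conj] at h5
    simpa using h5
  simp only [h4, zero_mul, add_zero] at h3
  refine ⟨e, fun hu => ?_, fun z hz => ?_⟩
  · rw [← h3, h2 u hu, sub_self, zero_mul, Complex.zero_im, mul_zero]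
  · rw [← h3, h2 z hz]

/-- Two smooth bodies which agree near a common boundary point coincide, provided that at all
common boundary points they are locally symmetric, or locally congruent and not symmetric. -/
theorem eq_of_agree_near {C C' : Set X} (hC : Body C) (hC' : Body C')
    (hs : ∀ x ∈ frontier C, m.SmoothAt C x) (hs' : ∀ x ∈ frontier C', m.SmoothAt C' x)
    (hloc : ∀ x ∈ frontier C, x ∈ frontier C' →
      (SymAt C x ∧ SymAt C' x) ∨ (CongAt C C' x x ∧ ¬ SymAt C x))
    {x : X} (hx : x ∈ frontier C) (hl : ∀ᶠ z in nhds x, z ∈ C ↔ z ∈ C') : C = C' := by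
  have hx' := mem_frontier_of_agree hx hl
  obtain ⟨p, hU, hU'⟩ := exists_common_U hC hC' hx hx' (hs' x hx') hl
  obtain ⟨u, hu, hue⟩ := ((mem_closure_iff_frequently.1
    (m.subset_closure_interior hC (hC.closed.frontier_subset hx))).and_eventually
      (eventually_eventually_nhds.2 hl)).exists
  have hu' : u ∈ interior C' := by
    rw [mem_interior_iff_mem_nhds] at hu ⊢
    filter_upwards [hu, hue] with z hz hzl using hzl.1 hz
  set M := m.cen p with hM
  obtain ⟨a1, a2, a3⟩ := M.image_c hC hU
  obtain ⟨b1, b2, b3⟩ := M.image_c hC' hU'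
  have huU : u ∈ M.U := hU (interior_subset hu)
  have hiff : ∀ {y : X}, y ∈ M.U → ∀ {q : ℂ → Prop},
      (∀ᶠ z in nhds (M.c y), q z → (z ∈ M.c '' C ↔ z ∈ M.c '' C')) ↔
      ∀ᶠ z in nhds y, q (M.c z) → (z ∈ C ↔ z ∈ C') := by
    intro y hy q
    rw [M.eventually_c hy]
    refine eventually_congr ?_
    filter_upwards [M.isOpen_U.mem_nhds hy] with z hz
    rw [M.mem_image_c hU hz, M.mem_image_c hU' hz]
  have hinj : M.c '' C = M.c '' C' := by
    refine eq_of_agree a1 a2 (O := M.c u) (a3 ▸ mem_image_of_mem _ hu) b1 b2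
      (b3 ▸ mem_image_of_mem _ hu') ?_ (v₀ := M.c x)
      (by rw [M.frontier_image_c hC hU]; exact mem_image_of_mem _ hx)
      (by rw [M.frontier_image_c hC' hU']; exact mem_image_of_mem _ hx') ?_
    · intro v hv hv' hleft
      rw [M.frontier_image_c hC hU] at hv
      rw [M.frontier_image_c hC' hU'] at hv'
      obtain ⟨y, hy, rfl⟩ := hv
      obtain ⟨y', hy', hyy⟩ := hv'
      have hyU : y ∈ M.U := hU (hC.closed.frontier_subset hy)
      have hyy' := M.c_inj (hU' (hC'.closed.frontier_subset hy')) hyU hyy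
      rw [hyy'] at hy'
      have huy : u ≠ y := fun h => hy.2 (h ▸ hu)
      obtain ⟨e, he1, he2⟩ := exists_line_functional (m := m) p (u := u) hyU
      replace he1 := he1 huU
      have he0 : e ≠ 0 := by
        rintro rfl
        set d := M.c y - M.c u with hd
        have hd0 : d ≠ 0 := sub_ne_zero.2 fun h => huy (M.c_inj huU hyU h.symm)
        have h1 : Tendsto (fun s : ℝ => M.c u + (s : ℂ) * (Complex.I * d)) (nhdsWithin 0 (Ioi 0))
            (nhds (M.c u + 0)) := tendsto_const_nhds.add (tendsto_ray _)
        rw [add_zero] at h1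
        obtain ⟨s, hs1, hs0⟩ := ((h1.eventually (mem_interior_iff_mem_nhds.1
          (a3 ▸ mem_image_of_mem M.c hu : M.c u ∈ interior (M.c '' C)))).and
          eventually_mem_nhdsWithin).exists
        have hs0 : 0 < s := hs0
        obtain ⟨z, hz, hzc⟩ := hs1
        have h2 := he2 z (hU hz)
        rw [dot_zero_right, hzc, add_sub_cancel_left, mul_assoc, mul_assoc, Complex.mul_conj] at h2
        have h3 : 0 < M.t z := M.mem_U.1 (hU hz)
        have h4 : 0 < Complex.normSq d := Complex.normSq_pos.2 hd0
        have h5 : 0 < M.t z * (s * Complex.normSq d) := by positivity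
        simp at h2
        rcases h2 with h2 | h2 | h2
        · exact h3.ne' h2
        · exact hs0.ne' h2
        · exact hd0 h2
      have h1 := agree_at (m := m) hC hC' hy hy' (hs y hy) (hs' y hy') (hloc y hy hy') he0
        (interior_subset hu) (interior_subset hu') huy he1 (by
          filter_upwards [(hiff hyU).1 hleft, M.isOpen_U.mem_nhds hyU] with z hz hzU hze
          refine hz ?_
          rw [he2 z hzU] at hze
          exact neg_of_mul_neg_right hze (M.mem_U.1 hzU).le)
      have := (hiff hyU (q := fun _ => True)).2 (by simpa using h1)
      simpa using this
    · have := (hiff (hU (hC.closed.frontier_subset hx)) (q := fun _ => True)).2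
        (by simpa using hl)
      simpa using this
  ext z
  constructor
  · intro hz
    exact (M.mem_image_c hU' (hU hz)).1 (hinj ▸ mem_image_of_mem _ hz)
  · intro hz
    exact (M.mem_image_c hU (hU' hz)).1 (hinj ▸ mem_image_of_mem _ hz)

end KModel

theorem congAt_image (f : X ≃ᵢ X) (C : Set X) (x : X) : CongAt C (f '' C) x (f x) :=
  ⟨f, rfl, .of_forall fun _ => (f.injective.mem_set_image).symm⟩

/-- `C` has the same local behaviour everywhere: either it is locally symmetric at all boundary
points, or nowhere, and then it looks the same at all of them. -/
def LocallyUniform (C : Set X) : Prop :=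
  (∀ x ∈ frontier C, SymAt C x) ∨
    ((∀ x ∈ frontier C, ¬ SymAt C x) ∧ ∀ x ∈ frontier C, ∀ y ∈ frontier C, CongAt C C x y)

/-- `C` has many congruences: a symmetry fixing any boundary point, or a congruence between any two
boundary points. -/
def ManyCongruences (C : Set X) : Prop :=
  (∀ x ∈ frontier C, ∃ σ : X ≃ᵢ X, σ ≠ IsometryEquiv.refl X ∧ σ x = x ∧ σ '' C = C) ∨
    ∀ x ∈ frontier C, ∀ y ∈ frontier C, ∃ g : X ≃ᵢ X, g x = y ∧ g '' C = C

namespace KModel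
variable {m : KModel X}

theorem image_eq_of_local {C : Set X} (hC : Body C) (hs : ∀ x ∈ frontier C, m.SmoothAt C x)
    (hu : LocallyUniform C) {g : X ≃ᵢ X} {x : X} (hx : x ∈ frontier C)
    (hl : ∀ᶠ z in nhds x, z ∈ C ↔ g z ∈ C) : g '' C = C := by
  have hmem : ∀ z, z ∈ g.symm '' C ↔ g z ∈ C := fun z => by
    constructor
    · rintro ⟨y, hy, rfl⟩
      rwa [g.apply_symm_apply]
    · intro h
      exact ⟨g z, h, g.symm_apply_apply z⟩
  have hfr : ∀ y ∈ frontier (g.symm '' C), g y ∈ frontier C := fun y hy => by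
    rw [← image_frontier'] at hy
    obtain ⟨z, hz, rfl⟩ := hy
    rwa [g.apply_symm_apply]
  have hcong : ∀ y, CongAt C (g.symm '' C) (g y) y := fun y => by
    simpa using congAt_image g.symm C (g y)
  have h1 : C = g.symm '' C := by
    refine eq_of_agree_near (m := m) hC (hC.image g.symm) hs ?_ ?_ hx ?_
    · intro y hy
      have := (hs _ (hfr y hy)).image g.symm
      rwa [g.symm_apply_apply] at this
    · intro y hy hy'
      rcases hu with h | ⟨h, h'⟩
      · exact .inl ⟨h y hy, (h _ (hfr y hy')).of_congAt (hcong y).symm⟩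
      · exact .inr ⟨(h' y hy _ (hfr y hy')).trans (hcong y), h y hy⟩
    · filter_upwards [hl] with z hz
      rw [hz, hmem]
  ext z
  constructor
  · rintro ⟨y, hy, rfl⟩
    rw [h1] at hy
    exact (hmem y).1 hy
  · intro hz
    refine ⟨g.symm z, ?_, g.apply_symm_apply z⟩
    rw [h1]
    exact mem_image_of_mem _ hz

theorem manyCongruences_of {C : Set X} (hC : Body C) (hs : ∀ x ∈ frontier C, m.SmoothAt C x)
    (hu : LocallyUniform C) : ManyCongruences C := by
  have h := hu
  rcases h with h | ⟨-, h⟩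
  · refine .inl fun x hx => ?_
    obtain ⟨σ, h1, h2, h3⟩ := h x hx
    exact ⟨σ, h1, h2, image_eq_of_local hC hs hu hx h3⟩
  · refine .inr fun x hx y hy => ?_
    obtain ⟨g, h1, h2⟩ := h x hx y hy
    exact ⟨g, h1, image_eq_of_local hC hs hu hx h2⟩

theorem locallyUniform_of_cond6 {K L : Set X} (hK : Body K) (hL : Body L) (h6 : T8Cond6 K L)
    (hsK : ∀ x ∈ frontier K, m.SmoothAt K x) (hsL : ∀ x ∈ frontier L, m.SmoothAt L x) :
    LocallyUniform K := by
  by_cases h : ∀ x ∈ frontier K, SymAt K x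
  · exact .inl h
  · push Not at h
    obtain ⟨x₀, hx0, hns⟩ := h
    have h1 : ∀ y ∈ frontier L, ¬ SymAt L y := fun y hy hsy => by
      rcases m.sym_or_cong hK hL h6 hx0 hy (hsK _ hx0) (hsL _ hy) with h | h
      · exact hns h.1
      · exact hns (hsy.of_congAt h)
    have h2 : ∀ x ∈ frontier K, ∀ y ∈ frontier L, CongAt K L x y := fun x hx y hy =>
      (m.sym_or_cong hK hL h6 hx hy (hsK _ hx) (hsL _ hy)).resolve_left fun h => h1 y hy h.2
    obtain ⟨y, hy⟩ := m.frontier_nonempty hL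
    exact .inr ⟨fun x hx hsx => h1 y hy (hsx.of_congAt (h2 x hx y hy).symm),
      fun x hx x' hx' => (h2 x hx y hy).trans (h2 x' hx' y hy).symm⟩

theorem manyCongruences_of_cond6 (m : KModel X) {K L : Set X} (hK : Body K) (hL : Body L) (h6 : T8Cond6 K L)
    (hsm : IsSphereSpace X 2 → SmoothBody K ∧ SmoothBody L) : ManyCongruences K := by
  have h : (∀ x ∈ frontier K, m.SmoothAt K x) ∧ ∀ x ∈ frontier L, m.SmoothAt L x := by
    by_cases hk : m.k = 1
    · exact ⟨fun x hx => m.smoothAt_of_smoothBody (hsm (m.sph.2 hk)).1 hx,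
        fun x hx => m.smoothAt_of_smoothBody (hsm (m.sph.2 hk)).2 hx⟩
    · exact ⟨fun x hx => smoothAt_of_cond6 hk hK hL h6 hx,
        fun x hx => smoothAt_of_cond6 hk hL hK (cond6_symm h6) hx⟩
  exact manyCongruences_of hK h.1 (locallyUniform_of_cond6 hK hL h6 h.1 h.2)

end KModel

section Planar
variable {P : Set ℂ}

theorem eq_closedBall_of_frontier_subset (hP : IsCompact P) (hi : (interior P).Nonempty) {ρ : ℝ}
    (h : frontier P ⊆ sphere 0 ρ) : P = closedBall 0 ρ := by
  have h1 : P ⊆ closedBall 0 ρ := by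
    obtain ⟨v, hv, hmax⟩ := hP.exists_isMaxOn (hi.mono interior_subset) continuous_norm.continuousOn
    have h2 : v ∈ frontier P := by
      rw [hP.isClosed.frontier_eq]
      refine ⟨hv, fun hvi => ?_⟩
      have h3 : P ⊆ closedBall 0 ‖v‖ := fun z hz => by
        rw [mem_closedBall_zero_iff]; exact hmax hz
      have h4 := interior_mono h3 hvi
      rw [interior_closedBall', mem_ball_zero_iff] at h4
      exact lt_irrefl _ h4
    intro z hz
    rw [mem_closedBall_zero_iff, ← mem_sphere_zero_iff_norm.1 (h h2)]
    exact hmax hz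
  refine Subset.antisymm h1 ?_
  obtain ⟨z, hz⟩ := hi
  have h2 : z ∈ ball 0 ρ := by
    rw [← interior_closedBall']
    exact interior_mono h1 hz
  have h3 : ball 0 ρ ⊆ interior P := by
    by_contra hb
    obtain ⟨y, hy, hyf⟩ := frontier_of_preconnected (convex_ball (0 : ℂ) ρ).isPreconnected
      ⟨z, h2, hz⟩ hb
    exact (mem_ball_zero_iff.1 hy).ne (mem_sphere_zero_iff_norm.1 (h hyf))
  have h4 : ρ ≠ 0 := (pos_of_mem_ball h2).ne'
  rw [← closure_ball _ h4]
  exact closure_minimal (h3.trans interior_subset) hP.isClosed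

theorem exists_frontier_ray (hP : IsCompact P) {z : ℂ} (hz : z ∈ interior P) (hz0 : z ≠ 0) :
    ∃ s : ℝ, 0 < s ∧ (s : ℂ) * z ∈ frontier P := by
  obtain ⟨R, hR⟩ := hP.isBounded.exists_norm_le
  have hzn : 0 < ‖z‖ := norm_pos_iff.2 hz0
  have h1 := hR z (interior_subset hz)
  have h2 : 0 < (R + 1) / ‖z‖ := by
    have : 0 < R + 1 := by linarith
    positivity
  have hpc : IsPreconnected ((fun s : ℝ => (s : ℂ) * z) '' Ioi 0) :=
    isPreconnected_Ioi.image _ (by fun_prop)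
  obtain ⟨_, ⟨s, hs, rfl⟩, hsf⟩ := frontier_of_preconnected hpc
    ⟨z, ⟨1, by simp, by simp⟩, hz⟩ (fun h => by
      have h3 := hR _ (interior_subset (h ⟨(R + 1) / ‖z‖, h2, rfl⟩))
      rw [norm_mul, Complex.norm_real, Real.norm_of_nonneg h2.le, div_mul_cancel₀ _ hzn.ne'] at h3
      linarith)
  exact ⟨s, hs, hsf⟩

/-- A planar convex body which is symmetric in all lines joining `0` to its boundary points is a
disc. -/
theorem exists_eq_closedBall (hP : IsCompact P) (hc : Convex ℝ P) (hi : (interior P).Nonempty)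
    (h : ∀ v ∈ frontier P, v ≠ 0 → ∀ z ∈ P, v / (starRingEnd ℂ) v * (starRingEnd ℂ) z ∈ P) :
    ∃ v ∈ P, P = closedBall 0 ‖v‖ := by
  have hrefl : ∀ u ∈ interior P, u ≠ 0 → ∀ z ∈ P,
      u / (starRingEnd ℂ) u * (starRingEnd ℂ) z ∈ P := by
    intro u hu hu0 z hz
    obtain ⟨s, hs, hsf⟩ := exists_frontier_ray hP hu hu0
    have hs0 : (s : ℂ) ≠ 0 := Complex.ofReal_ne_zero.2 hs.ne'
    have := h _ hsf (mul_ne_zero hs0 hu0) z hz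
    rwa [map_mul, Complex.conj_ofReal, mul_div_mul_left _ _ hs0] at this
  obtain ⟨u, hu, hu0⟩ : ∃ u ∈ interior P, u ≠ 0 := by
    by_contra hcon
    push Not at hcon
    have h1 : interior P ⊆ {0} := fun z hz => hcon z hz
    have h2 := interior_mono h1
    rw [interior_interior, interior_singleton] at h2
    exact hi.ne_empty (subset_empty_iff.1 h2)
  have hcu : (starRingEnd ℂ) u ≠ 0 := (map_ne_zero _).2 hu0
  have hev : ∀ᶠ a : ℝ in nhds 0, Complex.exp (a * Complex.I) * u ∈ interior P := by
    have h1 : Continuous fun a : ℝ => Complex.exp (a * Complex.I) * u := by fun_prop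
    have h2 := h1.tendsto 0
    simp only [Complex.ofReal_zero, zero_mul, Complex.exp_zero, one_mul] at h2
    exact h2.eventually (isOpen_interior.mem_nhds hu)
  have hrot : ∀ᶠ a : ℝ in nhds 0, ∀ z ∈ P, Complex.exp (a * Complex.I) * z ∈ P := by
    have h1 : Tendsto (fun a : ℝ => a / 2) (nhds 0) (nhds 0) := by
      have : Continuous fun a : ℝ => a / 2 := by fun_prop
      simpa using this.tendsto 0
    filter_upwards [h1.eventually hev] with a ha z hz
    have h2 := hrefl _ ha (mul_ne_zero (Complex.exp_ne_zero _) hu0) _ (hrefl u hu hu0 z hz)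
    convert h2 using 1
    have h3 : Complex.exp (a * Complex.I) =
        Complex.exp ((a / 2 : ℝ) * Complex.I) * Complex.exp ((a / 2 : ℝ) * Complex.I) := by
      rw [← Complex.exp_add]
      congr 1
      push_cast
      ring
    have h4 : (starRingEnd ℂ) (Complex.exp ((a / 2 : ℝ) * Complex.I)) =
        (Complex.exp ((a / 2 : ℝ) * Complex.I))⁻¹ := by
      rw [← Complex.exp_conj, map_mul, Complex.conj_ofReal, Complex.conj_I, ← Complex.exp_neg]
      congr 1
      ring
    have h5 := Complex.exp_ne_zero ((a / 2 : ℝ) * Complex.I)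
    rw [map_mul, map_mul, map_div₀, Complex.conj_conj, Complex.conj_conj, h3, h4]
    field_simp
  have hall : ∀ a : ℝ, ∀ z ∈ P, Complex.exp (a * Complex.I) * z ∈ P := by
    intro a
    have h1 : Tendsto (fun n : ℕ => a / n) atTop (nhds 0) := tendsto_const_div_atTop_nhds_zero_nat a
    obtain ⟨n, hn, hn0⟩ := ((h1.eventually hrot).and (eventually_gt_atTop 0)).exists
    have h2 : ∀ j : ℕ, ∀ z ∈ P, Complex.exp ((j * (a / n) : ℝ) * Complex.I) * z ∈ P := by
      intro j
      induction j with
      | zero => intro z hz; simpa using hz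
      | succ j ih =>
        intro z hz
        have h3 := ih _ (hn z hz)
        rw [← mul_assoc, ← Complex.exp_add] at h3
        convert h3 using 3
        push_cast
        ring
    have h3 := h2 n
    rwa [mul_div_cancel₀ _ (Nat.cast_ne_zero.2 hn0.ne')] at h3
  obtain ⟨v, hv, hmax⟩ := hP.exists_isMaxOn (hi.mono interior_subset) continuous_norm.continuousOn
  refine ⟨v, hv, Subset.antisymm (fun z hz => ?_) ?_⟩
  · rw [mem_closedBall_zero_iff]
    exact hmax hz
  · rw [← convexHull_sphere_eq_closedBall _ (norm_nonneg v)]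
    refine convexHull_min (fun z hz => ?_) hc
    rw [mem_sphere_zero_iff_norm] at hz
    by_cases hv0 : v = 0
    · rw [hv0, norm_zero, norm_eq_zero] at hz
      rwa [hz, ← hv0]
    · have h1 : ‖z / v‖ = 1 := by
        rw [norm_div, hz, div_self (norm_ne_zero_iff.2 hv0)]
      have h2 := hall (Complex.arg (z / v)) v hv
      have h3 := Complex.norm_mul_exp_arg_mul_I (z / v)
      rw [h1, Complex.ofReal_one, one_mul] at h3
      rwa [h3, div_mul_cancel₀ _ hv0] at h2

end Planar

namespace KModel
variable {m : KModel X}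

/-- The midpoint of `m.o` and `p` is closer to a point than the average, in terms of `q`. -/
theorem exists_mid {p z₀ : X} (hne : p ≠ m.o) (h0 : m.k = 1 → m.q m.o z₀ < 2 ∧ m.q p z₀ < 2) :
    ∃ c, ∀ z, (m.k = 1 → m.q m.o z < 2 ∧ m.q p z < 2) → 2 * m.q c z < m.q m.o z + m.q p z := by
  have hp := m.mem p
  have ht : 0 < 1 + m.t p := by
    by_cases hk : m.k = 1
    · obtain ⟨h1, h2⟩ := h0 hk
      have hz := m.mem z₀
      rw [q_o, hk] at h1
      rw [q, normSq_sub, hk] at h2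
      rw [hk] at hp hz
      have h3 := Complex.normSq_nonneg (m.w p)
      by_contra hcon
      have h4 : m.t p = -1 := by nlinarith
      have h5 : m.w p = 0 := by
        rw [← Complex.normSq_eq_zero]; rw [h4] at hp; linarith
      rw [h5, h4, dot_zero_left, map_zero] at h2
      nlinarith
    · linarith [m.pos hk p]
  set s := Real.sqrt (2 * (1 + m.t p)) with hs
  have hs0 : 0 < s := Real.sqrt_pos.2 (by linarith)
  have hs2 : s ^ 2 = 2 * (1 + m.t p) := Real.sq_sqrt (by linarith)
  set a := s⁻¹ with ha
  have ha0 : 0 < a := inv_pos.2 hs0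
  have ha2 : a ^ 2 * (2 * (1 + m.t p)) = 1 := by
    rw [← hs2, ha]; field_simp
  have hmem : m.k * Complex.normSq (a * m.w p) + (a * (1 + m.t p)) ^ 2 = 1 := by
    rw [Complex.normSq_mul, Complex.normSq_ofReal]
    linear_combination ha2 + a ^ 2 * hp
  obtain ⟨c, hcw, hct⟩ := m.surj _ _ hmem fun _ => by positivity
  refine ⟨c, fun z hz => ?_⟩
  have hpq : 0 < m.q m.o p := m.q_pos hne.symm
  have hzm := m.mem z
  rw [q_o] at hpq hz ⊢
  rw [q, normSq_sub] at hz ⊢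
  rw [q, normSq_sub, hcw, hct, Complex.normSq_mul, Complex.normSq_ofReal, dot_mul_left]
  set d := dot (m.w p) (m.w z)
  set n := Complex.normSq (m.w p)
  set n' := Complex.normSq (m.w z)
  set T := m.t p
  set S := m.t z
  rcases m.hk with hk | hk | hk
  · obtain ⟨h1, h2⟩ := hz hk
    rw [hk] at hp hpq hzm h1 h2 ⊢
    have hB1 : 0 < S := by nlinarith
    have hB2 : 0 < d + T * S := by nlinarith
    have hT : T < 1 := by nlinarith
    have h2a : 1 < 2 * a := by
      by_contra hcon
      have h6 : (2 * a) ^ 2 ≤ 1 := pow_le_one₀ (by positivity) (not_lt.1 hcon)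
      nlinarith
    nlinarith [mul_pos (sub_pos.2 h2a) (add_pos hB1 hB2)]
  · rw [hk] at hp hpq hzm ⊢
    have hS : S = 1 := m.t_of_zero hk z
    have hT : T = 1 := m.t_of_zero hk p
    have hn : 0 < n := by nlinarith
    have h4 : a = 1 / 2 := by rw [hT] at ha2; nlinarith
    rw [h4, hS, hT]
    nlinarith
  · rw [hk] at hp hpq hzm ⊢
    have hT0 : 0 < T := m.pos (by rw [hk]; norm_num) p
    have hS0 : 0 < S := m.pos (by rw [hk]; norm_num) z
    have hT : 1 < T := by nlinarith
    have h2a : 2 * a < 1 := by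
      by_contra hcon
      have h6 : 1 ≤ (2 * a) ^ 2 := one_le_pow₀ (not_lt.1 hcon)
      nlinarith
    have hB : 0 < T * S - d := by
      have h5 : 0 ≤ m.q p z := m.q_nonneg p z
      rw [q, normSq_sub, hk] at h5
      nlinarith
    nlinarith [mul_pos (sub_pos.2 h2a) (add_pos hS0 hB)]

end KModel

namespace KModel

theorem q_lt_two (m : KModel X) {x y : X} (hk : m.k = 1) (h : dist x y < Real.pi / 2) :
    m.q x y < 2 := by
  rw [q, m.q_eq, chordSq, if_pos hk]
  have : 0 < Real.cos (dist x y) :=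
    Real.cos_pos_of_mem_Ioo ⟨by linarith [dist_nonneg (x := x) (y := y), Real.pi_pos], h⟩
  linarith

/-- Every body has a unique circumscribed disc. -/
theorem exists_circumdisc (m : KModel X) {C : Set X} (hC : Body C) :
    ∃ O R, (IsSphereSpace X 2 → R < Real.pi / 2) ∧ C ⊆ closedBall O R ∧
      ∀ O', C ⊆ closedBall O' R → O' = O := by
  have := m.properSpace
  obtain ⟨x, hx⟩ := m.frontier_nonempty hC
  obtain ⟨p, hp⟩ := m.exists_isCentre hC hx
  have hxC := hC.closed.frontier_subset hx
  have hR0 : IsSphereSpace X 2 → dist x p < Real.pi / 2 := fun h => by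
    rw [dist_comm]
    exact m.mem_cen_U.1 hp.2.1 h
  set A : Set (X × ℝ) := {a | C ⊆ closedBall a.1 a.2 ∧ a.2 ≤ dist x p} with hA
  have hAc : IsClosed A := by
    have : A = (⋂ z ∈ C, {a : X × ℝ | dist z a.1 ≤ a.2}) ∩ {a : X × ℝ | a.2 ≤ dist x p} := by
      ext a
      simp [hA, subset_def]
    rw [this]
    refine (isClosed_biInter fun z _ => ?_).inter ?_
    · exact isClosed_le (by fun_prop) (by fun_prop)
    · exact isClosed_le (by fun_prop) (by fun_prop)
  have hAk : IsCompact A := by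
    refine ((isCompact_closedBall x (dist x p)).prod
      (isCompact_Icc (a := 0) (b := dist x p))).of_isClosed_subset hAc ?_
    rintro ⟨a, r⟩ ⟨h1, h2⟩
    have h3 : dist x a ≤ r := h1 hxC
    refine ⟨?_, dist_nonneg.trans h3, h2⟩
    rw [mem_closedBall, dist_comm]
    exact h3.trans h2
  obtain ⟨⟨O, R⟩, ⟨h1, h2⟩, hmin⟩ := hAk.exists_isMinOn ⟨(p, dist x p), hp.2.2, le_rfl⟩
    continuous_snd.continuousOn
  simp only at h1 h2
  have hRS : IsSphereSpace X 2 → R < Real.pi / 2 := fun h => lt_of_le_of_lt h2 (hR0 h)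
  refine ⟨O, R, hRS, h1, fun O' h3 => ?_⟩
  by_contra hne
  have hlt : ∀ z ∈ C, (m.cen O).k = 1 →
      (m.cen O).q (m.cen O).o z < 2 ∧ (m.cen O).q O' z < 2 := fun z hz hk => by
    have hS := (m.cen O).sph.2 hk
    refine ⟨(m.cen O).q_lt_two hk ?_, (m.cen O).q_lt_two hk ?_⟩
    · rw [cen_o, dist_comm]
      exact lt_of_le_of_lt (h1 hz) (hRS hS)
    · rw [dist_comm]
      exact lt_of_le_of_lt (h3 hz) (hRS hS)
  obtain ⟨c, hc⟩ := (m.cen O).exists_mid (p := O') (by rwa [cen_o]) (hlt x hxC)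
  obtain ⟨z, hz, hzmax⟩ := (m.isCompact hC).exists_isMaxOn ⟨x, hxC⟩
    (f := fun y => dist y c) (by fun_prop)
  have h4 : dist z c < R := by
    have h5 := hc z (hlt z hz)
    rw [cen_o] at h5
    by_contra hcon
    push Not at hcon
    have h6 : (m.cen O).q O z ≤ (m.cen O).q c z := (m.cen O).q_le.2 (by
      rw [dist_comm O, dist_comm c]; exact le_trans (h1 hz) hcon)
    have h7 : (m.cen O).q O' z ≤ (m.cen O).q c z := (m.cen O).q_le.2 (by
      rw [dist_comm O', dist_comm c]; exact le_trans (h3 hz) hcon)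
    linarith
  have h5 : (c, dist z c) ∈ A := ⟨fun y hy => mem_closedBall.2 (hzmax hy), h4.le.trans h2⟩
  exact absurd (hmin h5) (not_le.2 h4)

/-- Isometries preserving a chart domain centre which act as a reflection fixing a given vector. -/
theorem c_eq_reflect (m : KModel X) {σ : X ≃ᵢ X} (hσ : σ ≠ IsometryEquiv.refl X)
    (h0 : σ m.o = m.o) {x : X} (hx : σ x = x) (hc : m.c x ≠ 0) (z : X) :
    m.c (σ z) = m.c x / (starRingEnd ℂ) (m.c x) * (starRingEnd ℂ) (m.c z) := by
  obtain ⟨a, -, h | h⟩ := m.exists_unit_of_fix σ h0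
  · refine absurd (m.eq_refl_of_w σ h0 fun z => ?_) hσ
    have h1 := h x
    rw [hx] at h1
    have h2 : m.w x ≠ 0 := fun h2 => hc (by rw [c, h2, mul_zero])
    have h3 : a = 1 := by
      have : (a - 1) * m.w x = 0 := by rw [sub_mul, one_mul, ← h1, sub_self]
      rcases mul_eq_zero.1 this with h | h
      · exact sub_eq_zero.1 h
      · exact absurd h h2
    rw [h, h3, one_mul]
  · have key : ∀ y, m.c (σ y) = a * (starRingEnd ℂ) (m.c y) := fun y => by
      rw [c, c, m.t_eq_of_fix σ h0, h, map_mul, Complex.conj_ofReal]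
      ring
    have h1 := key x
    rw [hx] at h1
    have h2 : (starRingEnd ℂ) (m.c x) ≠ 0 := (map_ne_zero _).2 hc
    rw [key z, eq_div_of_mul_eq h2 h1.symm]

/-- A body with many congruences is a disc. -/
theorem eq_closedBall_of_manyCongruences (m : KModel X) {C : Set X} (hC : Body C)
    (h : ManyCongruences C) :
    ∃ p r, 0 < r ∧ (IsSphereSpace X 2 → r < Real.pi / 2) ∧ C = closedBall p r := by
  obtain ⟨O, R, hR, hCR, huniq⟩ := m.exists_circumdisc hC
  have hfix : ∀ g : X ≃ᵢ X, g '' C = C → g O = O := fun g hg => by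
    refine huniq _ ?_
    rw [← hg, ← g.image_closedBall]
    exact image_mono hCR
  set M := m.cen O with hM
  have hMo : M.o = O := m.cen_o O
  have hU : C ⊆ M.U := hCR.trans (m.closedBall_subset_cen_U hR)
  obtain ⟨a1, a2, a3⟩ := M.image_c hC hU
  have hi : (interior (M.c '' C)).Nonempty := by rw [a3]; exact hC.int.image _
  have hfr := M.frontier_image_c hC hU
  obtain ⟨v, hv, hP⟩ : ∃ v ∈ M.c '' C, M.c '' C = closedBall 0 ‖v‖ := by
    rcases h with h | h
    · refine exists_eq_closedBall a1 a2 hi ?_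
      rw [hfr]
      rintro _ ⟨x, hx, rfl⟩ hx0 _ ⟨z, hz, rfl⟩
      obtain ⟨σ, h1, h2, h3⟩ := h x hx
      rw [← M.c_eq_reflect h1 (by rw [hMo]; exact hfix σ h3) h2 hx0]
      refine mem_image_of_mem _ ?_
      rw [← h3]
      exact mem_image_of_mem _ hz
    · obtain ⟨x, hx⟩ := m.frontier_nonempty hC
      refine ⟨M.c x, mem_image_of_mem _ (hC.closed.frontier_subset hx),
        eq_closedBall_of_frontier_subset a1 hi ?_⟩
      rw [hfr]
      rintro _ ⟨y, hy, rfl⟩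
      obtain ⟨g, h1, h2⟩ := h x hx y hy
      obtain ⟨A, -, hA⟩ := M.exists_c_linear g (by rw [hMo]; exact hfix g h2)
      rw [mem_sphere_zero_iff_norm, ← h1, hA, A.norm_map]
  obtain ⟨x, hx, rfl⟩ := hv
  have hxR : IsSphereSpace X 2 → dist O x < Real.pi / 2 := fun hS => by
    rw [dist_comm]; exact lt_of_le_of_lt (hCR hx) (hR hS)
  have hCx : C = closedBall O (dist O x) := by
    ext z
    rw [mem_closedBall, dist_comm z O]
    constructor
    · intro hz
      have h1 : M.c z ∈ M.c '' C := mem_image_of_mem _ hz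
      rw [hP, mem_closedBall_zero_iff] at h1
      rw [← hMo]
      exact (M.dist_o_le_iff_norm_c (hU hz) (hU hx)).2 h1
    · intro hz
      have hzU : z ∈ M.U := m.closedBall_subset_cen_U hxR (by rwa [mem_closedBall, dist_comm])
      rw [← hMo] at hz
      rw [← M.mem_image_c hU hzU, hP, mem_closedBall_zero_iff]
      exact (M.dist_o_le_iff_norm_c hzU (hU hx)).1 hz
  refine ⟨O, dist O x, ?_, hxR, hCx⟩
  refine lt_of_le_of_ne dist_nonneg fun h0 => ?_
  rw [hP, interior_closedBall'] at hi
  have hxO : x = O := (dist_eq_zero.1 h0.symm).symm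
  rw [hxO, ← hMo, M.c_o, norm_zero, ball_zero] at hi
  exact Set.not_nonempty_empty hi

end KModel

theorem dist_le_pi_of_sphere (h : IsSphereSpace X 2) (x y : X) : dist x y ≤ Real.pi := by
  obtain ⟨e, -, -, h⟩ := h
  rw [h]
  exact Real.arccos_le_pi _

theorem exists_kModel_of_sphere (h : IsSphereSpace X 2) : Nonempty (KModel X) := by
  have h' := h
  obtain ⟨e, hinj, hr, hd⟩ := h'
  have hin : ∀ u v : EuclideanSpace ℝ (Fin (2 + 1)),
      inner ℝ u v = u 0 * v 0 + u 1 * v 1 + u 2 * v 2 := fun u v => by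
    simp only [PiLp.inner_apply, RCLike.inner_apply, conj_trivial]
    rw [Fin.sum_univ_three]
    ring
  have hn : ∀ x, e x 0 * e x 0 + e x 1 * e x 1 + e x 2 * e x 2 = 1 := fun x => by
    have h1 : e x ∈ sphere (0 : EuclideanSpace ℝ (Fin (2 + 1))) 1 := hr ▸ mem_range_self x
    rw [mem_sphere_zero_iff_norm] at h1
    rw [← hin, real_inner_self_eq_norm_sq, h1, one_pow]
  exact ⟨{
    k := 1
    hk := .inl rfl
    sph := iff_of_true h rfl
    w := fun x => ⟨e x 0, e x 1⟩
    t := fun x => e x 2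
    ext := fun x y h1 h2 => hinj (by
      ext i
      fin_cases i
      · exact congrArg Complex.re h1
      · exact congrArg Complex.im h1
      · exact h2)
    mem := fun x => by
      rw [Complex.normSq_mk]; linarith [hn x]
    pos := fun h => absurd rfl h
    surj := fun z s hz _ => by
      have h1 : !₂[z.re, z.im, s] ∈ range e := by
        rw [hr, mem_sphere_zero_iff_norm, EuclideanSpace.norm_eq, Fin.sum_univ_three,
          Real.sqrt_eq_one]
        rw [Complex.normSq_apply] at hz
        simp
        linarith
      obtain ⟨x, hx⟩ := h1
      exact ⟨x, by rw [hx]; rfl, by rw [hx]; rfl⟩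
    q_eq := fun x y => by
      have h1 := hn x
      have h2 := hn y
      rw [chordSq, if_pos rfl, hd, Real.cos_arccos, hin, Complex.normSq_apply]
      · simp only [Complex.sub_re, Complex.sub_im]
        linear_combination h1 + h2
      · rw [hin]
        nlinarith [sq_nonneg (e x 0 + e y 0), sq_nonneg (e x 1 + e y 1), sq_nonneg (e x 2 + e y 2)]
      · rw [hin]
        nlinarith [sq_nonneg (e x 0 - e y 0), sq_nonneg (e x 1 - e y 1), sq_nonneg (e x 2 - e y 2)]
    dist_le_pi := fun _ => dist_le_pi_of_sphere h }⟩

theorem exists_kModel_of_euclidean (h : IsEuclideanSpaceForm X 2) : Nonempty (KModel X) := by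
  obtain ⟨e⟩ := h
  have hd : ∀ x y, dist x y ^ 2 = (e x 0 - e y 0) ^ 2 + (e x 1 - e y 1) ^ 2 := fun x y => by
    rw [← e.dist_eq, EuclideanSpace.dist_eq, Real.sq_sqrt (by positivity), Fin.sum_univ_two,
      Real.dist_eq, Real.dist_eq, sq_abs, sq_abs]
  exact ⟨{
    k := 0
    hk := .inr (.inl rfl)
    sph := iff_of_false (fun h => by
      have h1 := dist_le_pi_of_sphere h (e.symm !₂[4, 0]) (e.symm !₂[0, 0])
      have h2 := hd (e.symm !₂[4, 0]) (e.symm !₂[0, 0])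
      simp only [e.apply_symm_apply] at h2
      norm_num at h2
      have h3 : dist (e.symm !₂[4, 0]) (e.symm !₂[0, 0]) ≤ 4 := h1.trans Real.pi_le_four
      have h4 := Real.pi_lt_four
      nlinarith [dist_nonneg (x := e.symm !₂[4, 0]) (y := e.symm !₂[0, 0])]) (by norm_num)
    w := fun x => ⟨e x 0, e x 1⟩
    t := fun _ => 1
    ext := fun x y h1 _ => e.injective (by
      ext i
      fin_cases i
      · exact congrArg Complex.re h1
      · exact congrArg Complex.im h1)
    mem := fun x => by simp
    pos := fun _ _ => one_pos
    surj := fun z s hz hs => by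
      refine ⟨e.symm !₂[z.re, z.im], ?_, ?_⟩
      · rw [e.apply_symm_apply]; rfl
      · have := hs (by norm_num)
        nlinarith
    q_eq := fun x y => by
      rw [chordSq, if_neg (by norm_num), if_pos rfl, hd, Complex.normSq_apply]
      simp only [Complex.sub_re, Complex.sub_im]
      ring
    dist_le_pi := fun h => absurd h (by norm_num) }⟩

theorem exists_kModel_of_hyperbolic (h : IsHyperbolicSpace X 2) : Nonempty (KModel X) := by
  obtain ⟨e, hinj, hr, hd⟩ := h
  have hmk : ∀ u v, mink 2 u v = u.1 0 * v.1 0 + u.1 1 * v.1 1 - u.2 * v.2 := fun u v => by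
    rw [mink]
    simp only [PiLp.inner_apply, RCLike.inner_apply, conj_trivial]
    rw [Fin.sum_univ_two]
    ring
  have hmem : ∀ x, mink 2 (e x) (e x) = -1 ∧ 0 < (e x).2 := fun x => by
    have : e x ∈ range e := mem_range_self x
    rwa [hr] at this
  have hsurj : ∀ a b s : ℝ, s ^ 2 - a ^ 2 - b ^ 2 = 1 → 0 < s → ∃ x, e x = (!₂[a, b], s) := by
    intro a b s h1 h2
    have : (!₂[a, b], s) ∈ range e := by
      rw [hr]
      refine ⟨?_, h2⟩
      rw [hmk]
      simp
      linarith
    exact this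
  exact ⟨{
    k := -1
    hk := .inr (.inr rfl)
    sph := iff_of_false (fun h => by
      obtain ⟨x, hx⟩ := hsurj 0 0 1 (by norm_num) one_pos
      obtain ⟨y, hy⟩ := hsurj (Real.sinh 4) 0 (Real.cosh 4) (by
        linarith [Real.cosh_sq 4]) (Real.cosh_pos 4)
      have h1 := hd x y
      rw [hmk, hx, hy] at h1
      simp at h1
      have h2 : |dist x y| = |(4 : ℝ)| := le_antisymm (Real.cosh_le_cosh.1 h1.le)
        (Real.cosh_le_cosh.1 h1.ge)
      rw [abs_of_nonneg dist_nonneg, abs_of_pos (by norm_num)] at h2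
      have h3 := dist_le_pi_of_sphere h x y
      linarith [Real.pi_lt_four]) (by norm_num)
    w := fun x => ⟨(e x).1 0, (e x).1 1⟩
    t := fun x => (e x).2
    ext := fun x y h1 h2 => hinj (Prod.ext (by
      ext i
      fin_cases i
      · exact congrArg Complex.re h1
      · exact congrArg Complex.im h1) h2)
    mem := fun x => by
      have := (hmem x).1
      rw [hmk] at this
      rw [Complex.normSq_mk]
      linarith
    pos := fun _ x => (hmem x).2
    surj := fun z s hz hs => by
      rw [Complex.normSq_apply] at hz
      obtain ⟨x, hx⟩ := hsurj z.re z.im s (by linarith) (hs (by norm_num))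
      exact ⟨x, by rw [hx]; rfl, by rw [hx]⟩
    q_eq := fun x y => by
      have h1 := (hmem x).1
      have h2 := (hmem y).1
      rw [hmk] at h1 h2
      rw [chordSq, if_neg (by norm_num), if_neg (by norm_num), hd, hmk, Complex.normSq_apply]
      simp only [Complex.sub_re, Complex.sub_im]
      linear_combination h1 + h2
    dist_le_pi := fun h => absurd h (by norm_num) }⟩

theorem exists_kModel (h : IsSpaceForm X 2) : Nonempty (KModel X) := by
  rcases h with h | h | h
  · exact exists_kModel_of_sphere h
  · exact exists_kModel_of_euclidean h
  · exact exists_kModel_of_hyperbolic h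

theorem KModel.cond7_of_cond6 (m : KModel X) {K L : Set X} (hK : Body K) (hL : Body L)
    (hsm : IsSphereSpace X 2 → SmoothBody K ∧ SmoothBody L) (h6 : T8Cond6 K L) :
    T8Cond7 K L := by
  obtain ⟨p, r, h1, h2, h3⟩ :=
    m.eq_closedBall_of_manyCongruences hK (m.manyCongruences_of_cond6 hK hL h6 hsm)
  obtain ⟨q, s, h4, h5, h6⟩ :=
    m.eq_closedBall_of_manyCongruences hL
      (m.manyCongruences_of_cond6 hL hK (cond6_symm h6) fun h => (hsm h).symm)
  exact ⟨p, q, r, s, h1, h4, fun h => ⟨h2 h, h5 h⟩, h3, h6⟩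

/-- **Theorem 8.** Under hypothesis (****) with `d = 2`, if both `K` and `L` have
supporting circles at all of their boundary points (for `S²` of radii less than `π/2`),
and for `S²` both `K` and `L` are `C¹`, then conditions (1)–(7) are equivalent. -/
theorem theorem8
    (X : Type*) [MetricSpace X] (hX : IsSpaceForm X 2)
    (K L : Set X)
    (hKcl : IsClosed K) (hLcl : IsClosed L)
    (hKcv : GConvex K) (hLcv : GConvex L)
    (hKint : (interior K).Nonempty) (hLint : (interior L).Nonempty)
    (hKpr : K ≠ univ) (hLpr : L ≠ univ)
    (hKhemi : IsSphereSpace X 2 → ∃ p : X, K ⊆ ball p (Real.pi / 2))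
    (hLhemi : IsSphereSpace X 2 → ∃ p : X, L ⊆ ball p (Real.pi / 2))
    (hKsupp : SupportingSpheres 2 K) (hLsupp : SupportingSpheres 2 L)
    (hsmooth : IsSphereSpace X 2 → SmoothBody K ∧ SmoothBody L) :
    (T8Cond1 K L ↔ T8Cond7 K L) ∧
    (T8Cond2 K L ↔ T8Cond7 K L) ∧
    (T8Cond3 K L ↔ T8Cond7 K L) ∧
    (T8Cond4 K L ↔ T8Cond7 K L) ∧
    (T8Cond5 K L ↔ T8Cond7 K L) ∧
    (T8Cond6 K L ↔ T8Cond7 K L) := by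
  obtain ⟨m⟩ := exists_kModel hX
  have h71 : T8Cond7 K L → T8Cond1 K L := m.cond1_of_cond7
  have h46 : T8Cond4 K L → T8Cond6 K L := m.cond6_of_cond4 hKcl hLcl
  have h35 : T8Cond3 K L → T8Cond5 K L := m.cond5_of_cond3 hKcl hLcl
  have h67 : T8Cond6 K L → T8Cond7 K L :=
    m.cond7_of_cond6 ⟨hKcl, hKcv, hKint, hKpr, hKsupp⟩ ⟨hLcl, hLcv, hLint, hLpr, hLsupp⟩ hsmooth
  exact ⟨⟨fun h => h67 (h46 (cond4_of_cond2 (cond2_of_cond1 h))), h71⟩,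
    ⟨fun h => h67 (h46 (cond4_of_cond2 h)), fun h => cond2_of_cond1 (h71 h)⟩,
    ⟨fun h => h67 (h46 (cond4_of_cond3 h)), fun h => cond3_of_cond1 (h71 h)⟩,
    ⟨fun h => h67 (h46 h), fun h => cond4_of_cond3 (cond3_of_cond1 (h71 h))⟩,
    ⟨fun h => h67 (cond6_of_cond5 h), fun h => h35 (cond3_of_cond1 (h71 h))⟩,
    ⟨h67, fun h => h46 (cond4_of_cond3 (cond3_of_cond1 (h71 h)))⟩⟩

end BallChar
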